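/- Let K be a field of characteristic different from 2 satisfying I^{n+1}K(√-1) = 0, and let φ be a nondegenerate quadratic form over K congruent to a scaled Pfister form modulo I^n K. Then G(φ) = H(φ). -/

import Mathlib

open scoped TensorProduct

/-- A (finite-dimensional) quadratic form over the field `K`, bundled with its
underlying vector space. -/
structure QF (K : Type) [Field K] where
  V : Type
  [iAG : AddCommGroup V]
  [iM : Module K V]
  [iFD : FiniteDimensional K V]
  q : QuadraticForm K V

namespace QF

variable {K : Type} [Field K]

instance (φ : QF K) : AddCommGroup φ.V := φ.iAG
instance (φ : QF K) : Module K φ.V := φ.iM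
instance (φ : QF K) : FiniteDimensional K φ.V := φ.iFD

/-- dimension of a quadratic form -/
noncomputable def dim (φ : QF K) : ℕ := Module.finrank K φ.V

/-- isometry of quadratic forms -/
def Equiv (φ ψ : QF K) : Prop := QuadraticMap.Equivalent φ.q ψ.q

/-- nondegeneracy of a quadratic form (via its polar bilinear form) -/
def Nondeg (φ : QF K) : Prop := (QuadraticMap.polarBilin φ.q).Nondegenerate

/-- scaling a quadratic form by a scalar -/
def smul (a : K) (φ : QF K) : QF K := { V := φ.V, q := a • φ.q }

/-- orthogonal sum of quadratic forms -/
def add (φ ψ : QF K) : QF K := { V := φ.V × ψ.V, q := φ.q.prod ψ.q }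

/-- the zero-dimensional quadratic form -/
noncomputable def zero : QF K := { V := Fin 0 → K, q := QuadraticMap.weightedSumSquares K (fun i : Fin 0 => (1 : K)) }

/-- the form `⟨1⟩` -/
noncomputable def one : QF K := { V := Fin 1 → K, q := QuadraticMap.weightedSumSquares K (fun _ : Fin 1 => (1 : K)) }

/-- the binary form `⟨1, -a⟩ = ⟪a⟫` -/
noncomputable def bin (a : K) : QF K :=
  { V := Fin 2 → K, q := QuadraticMap.weightedSumSquares K ![(1 : K), -a] }

/-- tensor product of quadratic forms -/
noncomputable def tmul [Invertible (2 : K)] (φ ψ : QF K) : QF K :=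
  { V := φ.V ⊗[K] ψ.V, q := QuadraticForm.tmul φ.q ψ.q }

/-- `m` copies of the hyperbolic plane `⟨1, -1⟩` -/
noncomputable def hyperbolics : ℕ → QF K
  | 0 => zero
  | m + 1 => add (bin 1) (hyperbolics m)

/-- a form is hyperbolic if it is isometric to a sum of hyperbolic planes -/
def IsHyperbolic (φ : QF K) : Prop := ∃ m : ℕ, φ.Equiv (hyperbolics m)

/-- anisotropy -/
def Anisotropic (φ : QF K) : Prop := φ.q.Anisotropic

/-- the Witt index -/
noncomputable def wittIndex (φ : QF K) : ℕ :=
  sSup {m : ℕ | ∃ ψ : QF K, φ.Equiv (add (hyperbolics m) ψ)}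

/-- a form is split if its anisotropic part has dimension at most one -/
def IsSplit (φ : QF K) : Prop :=
  ∃ (m : ℕ) (ψ : QF K), ψ.Anisotropic ∧ ψ.dim ≤ 1 ∧ φ.Equiv (add (hyperbolics m) ψ)

/-- `n`-fold orthogonal sum of a fixed form -/
noncomputable def nsmul : ℕ → QF K → QF K
  | 0, _ => zero
  | n + 1, φ => add φ (nsmul n φ)

/-- orthogonal sum of a list of forms -/
noncomputable def sumList : List (QF K) → QF K
  | [] => zero
  | φ :: l => add φ (sumList l)

/-- the Pfister form `⟨⟨a₁, …, aₙ⟩⟩` -/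
noncomputable def pfister [Invertible (2 : K)] : List K → QF K
  | [] => one
  | a :: l => tmul (bin a) (pfister l)

/-- Witt equivalence of quadratic forms -/
def WittEquiv (φ ψ : QF K) : Prop := IsHyperbolic (add φ (smul (-1) ψ))

/-- membership in the `n`-th power of the fundamental ideal: Witt equivalence
to an orthogonal sum of scaled `n`-fold Pfister forms -/
def InFundPow [Invertible (2 : K)] (n : ℕ) (φ : QF K) : Prop :=
  ∃ (r : ℕ) (c : Fin r → K) (l : Fin r → (Fin n → K)),
    (∀ i, c i ≠ 0) ∧
    WittEquiv φ (sumList ((List.finRange r).map fun i => smul (c i) (pfister (List.ofFn (l i)))))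

/-- the group of similarity factors `G(φ) = {a ∈ K× : aφ ≅ φ}`, as a set -/
def G (φ : QF K) : Set K := {a | a ≠ 0 ∧ (smul a φ).Equiv φ}

/-- similarity factors of a family of forms -/
def GT {r : ℕ} (φ : Fin r → QF K) : Set K := ⋂ i, G (φ i)

end QF

/-- a bundled field extension of `K` -/
structure FieldExt (K : Type) [Field K] where
  carrier : Type
  [iF : Field carrier]
  [iA : Algebra K carrier]

attribute [instance] FieldExt.iF FieldExt.iA

namespace QF

variable {K : Type} [Field K]

/-- base change of a quadratic form along a field extension -/
noncomputable def baseChange [Invertible (2 : K)] (L : Type) [Field L] [Algebra K L]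
    (φ : QF K) : QF L :=
  { V := L ⊗[K] φ.V, q := QuadraticForm.baseChange L φ.q }

end QF

/-- the set of nonzero norms of a finite field extension -/
def normSet (K : Type) [Field K] (L : Type) [Field L] [Algebra K L] : Set K :=
  {a | ∃ x : L, x ≠ 0 ∧ Algebra.norm K x = a}

/-- a finite `2`-extension: a tower of quadratic extensions -/
def IsTwoExtension (K : Type) [Field K] (L : Type) [Field L] [Algebra K L] : Prop :=
  FiniteDimensional K L ∧
    ∃ (n : ℕ) (F : Fin (n + 1) → IntermediateField K L),
      F 0 = ⊥ ∧ F (Fin.last n) = ⊤ ∧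
        ∀ i : Fin n, F i.castSucc ≤ F i.succ ∧
          IntermediateField.relfinrank (F i.castSucc) (F i.succ) = 2

/-- a multiquadratic extension: Galois with elementary abelian 2-group -/
def IsMultiquadratic (K : Type) [Field K] (L : Type) [Field L] [Algebra K L] : Prop :=
  FiniteDimensional K L ∧ IsGalois K L ∧ ∀ σ : L ≃ₐ[K] L, σ * σ = 1

namespace QF

variable {K : Type} [Field K] [Invertible (2 : K)]

/-- generating set for `Hyp(φ)`: norms from finite extensions splitting `φ` -/
def hypSet (φ : QF K) : Set K :=
  {a | ∃ L : FieldExt K, FiniteDimensional K L.carrier ∧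
    IsHyperbolic (baseChange L.carrier φ) ∧ a ∈ normSet K L.carrier}

/-- the subgroup `Hyp(φ)` generated by norms of finite extensions splitting `φ` -/
def Hyp (φ : QF K) : Submonoid K := Submonoid.closure (hypSet φ)

/-- generating set for `Hyp₂(φ)`: norms from finite 2-extensions splitting `φ` -/
def hypSet2 (φ : QF K) : Set K :=
  {a | ∃ L : FieldExt K, IsTwoExtension K L.carrier ∧
    IsHyperbolic (baseChange L.carrier φ) ∧ a ∈ normSet K L.carrier}

/-- the subgroup `Hyp₂(φ)` -/
def Hyp2 (φ : QF K) : Submonoid K := Submonoid.closure (hypSet2 φ)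

/-- `H(φ) = K×² · Hyp(φ)` -/
def Hgrp (φ : QF K) : Set K :=
  {x | ∃ s : K, s ≠ 0 ∧ ∃ h ∈ Hyp φ, x = s ^ 2 * h}

/-- `K×² · Hyp₂(φ)` -/
def H2grp (φ : QF K) : Set K :=
  {x | ∃ s : K, s ≠ 0 ∧ ∃ h ∈ Hyp2 φ, x = s ^ 2 * h}

/-- the splitting pattern: the set of Witt indices over all field extensions -/
def Sp (φ : QF K) : Set ℕ :=
  {m | ∃ L : FieldExt K, m = wittIndex (baseChange L.carrier φ)}

end QF

namespace QF

variable {K : Type} [Field K] [Invertible (2 : K)]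

/-- norms from finite extensions splitting all forms in a family -/
def hypSetT {r : ℕ} (φ : Fin r → QF K) : Set K :=
  {a | ∃ L : FieldExt K, FiniteDimensional K L.carrier ∧
    (∀ i, IsHyperbolic (baseChange L.carrier (φ i))) ∧ a ∈ normSet K L.carrier}

/-- the subgroup `Hyp` of a family of forms -/
def HypT {r : ℕ} (φ : Fin r → QF K) : Submonoid K := Submonoid.closure (hypSetT φ)

/-- norms from finite 2-extensions splitting all forms in a family -/
def hypSet2T {r : ℕ} (φ : Fin r → QF K) : Set K :=
  {a | ∃ L : FieldExt K, IsTwoExtension K L.carrier ∧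
    (∀ i, IsHyperbolic (baseChange L.carrier (φ i))) ∧ a ∈ normSet K L.carrier}

/-- the subgroup `Hyp₂` of a family of forms -/
def Hyp2T {r : ℕ} (φ : Fin r → QF K) : Submonoid K := Submonoid.closure (hypSet2T φ)

/-- `H` of a family of forms: `K×² · Hyp` -/
def HgrpT {r : ℕ} (φ : Fin r → QF K) : Set K :=
  {x | ∃ s : K, s ≠ 0 ∧ ∃ h ∈ HypT φ, x = s ^ 2 * h}

end QF

/-- the map `O → O'` between valuation rings induced by a compatible field embedding -/
def liftVSHom {K M : Type} [Field K] [Field M] [Algebra K M]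
    (O : ValuationSubring K) (OM : ValuationSubring M)
    (hc : ∀ x : K, x ∈ O ↔ algebraMap K M x ∈ OM) : O →+* OM where
  toFun x := ⟨algebraMap K M x, (hc x).1 x.2⟩
  map_one' := by ext; simp
  map_mul' x y := by ext; simp
  map_zero' := by ext; simp
  map_add' x y := by ext; simp

/-- `v` is unramified in the subextension `E` of `M/K`: the value group does not grow
and the residue field extension is separable (every residue is a simple root of a
separable polynomial over the residue field of `O`) -/
def UnramifiedIn {K M : Type} [Field K] [Field M] [Algebra K M]
    (O : ValuationSubring K) (OM : ValuationSubring M)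
    (hc : ∀ x : K, x ∈ O ↔ algebraMap K M x ∈ OM) (E : IntermediateField K M) : Prop :=
  (∀ y : M, y ∈ E → y ≠ 0 →
      ∃ x : K, x ≠ 0 ∧ OM.valuation y = OM.valuation (algebraMap K M x)) ∧
  (∀ y : M, y ∈ E → ∀ hy : y ∈ OM, ∃ p : Polynomial O, p.Monic ∧
      (p.map (IsLocalRing.residue O)).Separable ∧
      Polynomial.eval (⟨y, hy⟩ : OM) (p.map (liftVSHom O OM hc)) ∈ IsLocalRing.maximalIdeal OM)

/-- the value group of a valuation, as a subgroup of the units of the codomain -/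
def unitsValueGroup {L Γ : Type} [Field L] [LinearOrderedCommGroupWithZero Γ]
    (w : Valuation L Γ) : Subgroup Γˣ :=
  (Units.map w.toMonoidWithZeroHom.toMonoidHom).range

/-- iterated Laurent series field, bundled with its field structure -/
noncomputable def IterLaurentP (k : Type) [Field k] : ℕ → Σ' (T : Type), Field T :=
  fun n => Nat.rec ⟨k, ‹Field k›⟩
    (fun _ p => by letI := p.2; exact ⟨LaurentSeries p.1, inferInstance⟩) n

/-- iterated Laurent series field `k((t₁))…((tₙ))` -/
@[reducible] noncomputable def IterLaurent (k : Type) [Field k] (n : ℕ) : Type :=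
  (IterLaurentP k n).1

noncomputable instance (k : Type) [Field k] (n : ℕ) : Field (IterLaurent k n) :=
  (IterLaurentP k n).2

/-- the embedding of the coefficient field in the iterated Laurent series field -/
noncomputable def iterC (k : Type) [Field k] : ∀ n, k →+* IterLaurent k n
  | 0 => RingHom.id k
  | n + 1 => (HahnSeries.C : IterLaurent k n →+* LaurentSeries (IterLaurent k n)).comp (iterC k n)

/-- the variables `t₁, …, tₙ` of the iterated Laurent series field -/
noncomputable def tvar (k : Type) [Field k] : ∀ n, Fin n → IterLaurent k n
  | 0 => fun i => i.elim0
  | n + 1 => fun i =>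
      (Fin.lastCases (motive := fun _ => LaurentSeries (IterLaurent k n))
        (HahnSeries.single 1 1) (fun j => HahnSeries.C (tvar k n j)) i : IterLaurent k (n + 1))


set_option linter.unusedSectionVars false

namespace WQ

open QuadraticMap Module

section Geometry

variable {K : Type} [Field K]

theorem nondeg_iff (φ : QF K) : φ.Nondeg ↔ ∀ x, (∀ y, polar φ.q x y = 0) → x = 0 := by
  constructor
  · intro h x hx
    exact h.1 x hx
  · intro h
    refine ⟨h, fun y hy => h y fun x => ?_⟩
    rw [polar_comm]; exact hy x

theorem equiv_refl (φ : QF K) : φ.Equiv φ := QuadraticMap.Equivalent.refl _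
theorem equiv_symm {φ ψ : QF K} (h : φ.Equiv ψ) : ψ.Equiv φ := QuadraticMap.Equivalent.symm h
theorem equiv_trans {φ ψ χ : QF K} (h : φ.Equiv ψ) (h' : ψ.Equiv χ) : φ.Equiv χ :=
  QuadraticMap.Equivalent.trans h h'

theorem equiv_of {φ ψ : QF K} (e : φ.V ≃ₗ[K] ψ.V) (h : ∀ x, ψ.q (e x) = φ.q x) : φ.Equiv ψ :=
  ⟨⟨e, h⟩⟩

theorem equiv_elim {φ ψ : QF K} (h : φ.Equiv ψ) :
    ∃ e : φ.V ≃ₗ[K] ψ.V, ∀ x, ψ.q (e x) = φ.q x := by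
  obtain ⟨e⟩ := h
  exact ⟨e.toLinearEquiv, e.map_app⟩

/-- A form with a totally isotropic subspace of at least half dimension. -/
def Lag (φ : QF K) : Prop :=
  ∃ S : Submodule K φ.V, (∀ x ∈ S, φ.q x = 0) ∧ finrank K φ.V ≤ 2 * finrank K S

theorem Lag.congr {φ ψ : QF K} (h : φ.Equiv ψ) (hL : Lag φ) : Lag ψ := by
  obtain ⟨e, he⟩ := equiv_elim h
  obtain ⟨S, hS, hd⟩ := hL
  refine ⟨S.map e.toLinearMap, ?_, ?_⟩
  · rintro _ ⟨x, hx, rfl⟩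
    have := he x
    simp only [LinearEquiv.coe_coe]
    rw [this, hS x hx]
  · rw [LinearEquiv.finrank_map_eq, ← e.finrank_eq]; exact hd

theorem Nondeg.congr {φ ψ : QF K} (h : φ.Equiv ψ) (hL : φ.Nondeg) : ψ.Nondeg := by
  obtain ⟨e, he⟩ := equiv_elim h
  rw [nondeg_iff] at *
  intro x hx
  have : e.symm x = 0 := by
    apply hL
    intro y
    have := hx (e y)
    simp only [polar] at this ⊢
    rw [← he, ← he, ← he, map_add, e.apply_symm_apply]; exact this
  simpa using this

theorem add_q (φ ψ : QF K) (x : φ.V) (y : ψ.V) :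
    (QF.add φ ψ).q (x, y) = φ.q x + ψ.q y := rfl

theorem add_polar (φ ψ : QF K) (x x' : φ.V) (y y' : ψ.V) :
    polar (QF.add φ ψ).q (x, y) (x', y') = polar φ.q x x' + polar ψ.q y y' := by
  exact polar_prod φ.q ψ.q (x, y) (x', y')

theorem Nondeg.add {φ ψ : QF K} (h : φ.Nondeg) (h' : ψ.Nondeg) : (QF.add φ ψ).Nondeg := by
  rw [nondeg_iff] at *
  rintro ⟨x, y⟩ hxy
  have h1 : x = 0 := h x fun z => by
    have := hxy (z, 0)
    rw [add_polar] at this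
    simpa using this
  have h2 : y = 0 := h' y fun z => by
    have := hxy (0, z)
    rw [add_polar] at this
    simpa using this
  rw [h1, h2]; rfl

theorem Nondeg.smul {φ : QF K} (h : φ.Nondeg) {a : K} (ha : a ≠ 0) : (QF.smul a φ).Nondeg := by
  rw [nondeg_iff] at *
  intro x hx
  apply h x
  intro y
  have := hx y
  have h2 : polar (QF.smul a φ).q x y = a * polar φ.q x y := by
    exact polar_smul φ.q a x y
  rw [h2] at this
  exact (mul_eq_zero.1 this).resolve_left ha

theorem Nondeg.of_add_left {φ ψ : QF K} (h : (QF.add φ ψ).Nondeg) : φ.Nondeg := by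
  rw [nondeg_iff] at *
  intro x hx
  have := h (x, 0) (by
    rintro ⟨y, z⟩
    rw [add_polar, hx]; simp)
  exact congrArg Prod.fst this

theorem Nondeg.of_add_right {φ ψ : QF K} (h : (QF.add φ ψ).Nondeg) : ψ.Nondeg := by
  rw [nondeg_iff] at *
  intro x hx
  have := h (0, x) (by
    rintro ⟨y, z⟩
    rw [add_polar, hx]; simp)
  exact congrArg Prod.snd this

theorem add_congr {φ ψ φ' ψ' : QF K} (h : φ.Equiv φ') (h' : ψ.Equiv ψ') :
    (QF.add φ ψ).Equiv (QF.add φ' ψ') := QuadraticMap.Equivalent.prod h h'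

theorem add_comm' (φ ψ : QF K) : (QF.add φ ψ).Equiv (QF.add ψ φ) :=
  equiv_of (LinearEquiv.prodComm K φ.V ψ.V) (by
    rintro ⟨x, y⟩
    exact add_comm _ _)

theorem add_assoc' (φ ψ χ : QF K) :
    (QF.add (QF.add φ ψ) χ).Equiv (QF.add φ (QF.add ψ χ)) :=
  equiv_of (LinearEquiv.prodAssoc K φ.V ψ.V χ.V) (by
    rintro ⟨⟨x, y⟩, z⟩
    exact (add_assoc _ _ _).symm)

theorem zero_V_sub (x : (QF.zero : QF K).V) : x = 0 := by
  funext i; exact i.elim0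

theorem zero_add' (φ : QF K) : (QF.add QF.zero φ).Equiv φ :=
  equiv_symm <| equiv_of (φ := φ) (ψ := QF.add QF.zero φ)
    { toFun := fun x => (0, x)
      invFun := fun x => x.2
      map_add' := fun x y => by
        show ((0 : (QF.zero : QF K).V), x + y) = (0 + 0, x + y)
        rw [add_zero]
      map_smul' := fun a x => by
        show ((0 : (QF.zero : QF K).V), a • x) = (a • 0, a • x)
        rw [smul_zero]
      left_inv := fun x => rfl
      right_inv := fun x => Prod.ext (zero_V_sub _).symm rfl } (by
    intro x
    show (QF.add QF.zero φ).q (0, x) = φ.q x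
    rw [add_q, QuadraticMap.map_zero, zero_add])

theorem smul_congr (a : K) {φ ψ : QF K} (h : φ.Equiv ψ) : (QF.smul a φ).Equiv (QF.smul a ψ) := by
  obtain ⟨e, he⟩ := equiv_elim h
  refine equiv_of (φ := QF.smul a φ) (ψ := QF.smul a ψ) e fun x => ?_
  exact congrArg (a • ·) (he x)

theorem Lag.zero : Lag (QF.zero : QF K) := by
  refine ⟨⊥, ?_, ?_⟩
  · intro x _; rw [zero_V_sub x, QuadraticMap.map_zero]
  · have : finrank K (QF.zero : QF K).V = 0 := by
      show finrank K (Fin 0 → K) = 0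
      simp
    rw [this]; exact Nat.zero_le _

theorem finrank_add (φ ψ : QF K) :
    finrank K (QF.add φ ψ).V = finrank K φ.V + finrank K ψ.V :=
  Module.finrank_prod (R := K) (M := φ.V) (M' := ψ.V)


theorem finrank_prod_sub {V W : Type} [AddCommGroup V] [Module K V] [AddCommGroup W] [Module K W]
    [FiniteDimensional K V] [FiniteDimensional K W] (S : Submodule K V) (T : Submodule K W) :
    finrank K (S.prod T) = finrank K S + finrank K T := by
  rw [← Module.finrank_prod]
  have h : Function.Injective (LinearMap.prodMap S.subtype T.subtype) := by
    rintro ⟨x, y⟩ ⟨x', y'⟩ h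
    simp only [LinearMap.prodMap_apply, Prod.mk.injEq] at h
    exact Prod.ext (Subtype.ext h.1) (Subtype.ext h.2)
  rw [← LinearMap.finrank_range_of_inj h]
  have : LinearMap.range (LinearMap.prodMap S.subtype T.subtype) = S.prod T := by
    ext ⟨x, y⟩
    constructor
    · rintro ⟨⟨a, b⟩, hab⟩
      simp only [LinearMap.prodMap_apply, Prod.mk.injEq] at hab
      obtain ⟨rfl, rfl⟩ := hab
      exact ⟨a.2, b.2⟩
    · rintro ⟨h1, h2⟩
      exact ⟨(⟨x, h1⟩, ⟨y, h2⟩), rfl⟩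
  rw [this]

theorem polar_zero_of_isot {V : Type} [AddCommGroup V] [Module K V] (q : QuadraticForm K V)
    (S : Submodule K V) (h : ∀ x ∈ S, q x = 0) {x y : V} (hx : x ∈ S) (hy : y ∈ S) :
    polar q x y = 0 := by
  simp [polar, h _ hx, h _ hy, h _ (S.add_mem hx hy)]

theorem lag_cancel_aux {V W : Type} [AddCommGroup V] [Module K V] [AddCommGroup W] [Module K W]
    [FiniteDimensional K V] [FiniteDimensional K W] (q : QuadraticForm K V)
    (q' : QuadraticForm K W) (hnd : (polarBilin (q.prod q')).Nondegenerate)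
    (S : Submodule K (V × W)) (hS : ∀ x ∈ S, q.prod q' x = 0)
    (hd : finrank K (V × W) ≤ 2 * finrank K S)
    (T : Submodule K W) (hT : ∀ x ∈ T, q' x = 0) (hd' : finrank K W ≤ 2 * finrank K T) :
    ∃ U : Submodule K V, (∀ x ∈ U, q x = 0) ∧ finrank K V ≤ 2 * finrank K U := by
  set A : Submodule K (V × W) := (⊤ : Submodule K V).prod T with hA
  set C : Submodule K (V × W) := S ⊓ (⊥ : Submodule K V).prod T with hC
  have hdA : finrank K A = finrank K V + finrank K T := by
    rw [hA, finrank_prod_sub, finrank_top]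
  have h1 : S ⊔ A ≤ LinearMap.BilinForm.orthogonal (polarBilin (q.prod q')) C := by
    refine sup_le ?_ ?_
    · intro x hx
      rw [LinearMap.BilinForm.mem_orthogonal_iff]
      intro y hy
      exact polar_zero_of_isot _ S hS hy.1 hx
    · rintro ⟨x, x'⟩ hx
      rw [LinearMap.BilinForm.mem_orthogonal_iff]
      rintro ⟨y, y'⟩ hy
      obtain ⟨_, hy1, hy2⟩ := hy
      have hy1 : y = 0 := hy1
      show polar (q.prod q') (y, y') (x, x') = 0
      rw [polar_prod]
      simp only [hy1]
      rw [polar_zero_of_isot q' T hT hy2 hx.2]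
      simp
  have h2 := Submodule.finrank_mono h1
  rw [LinearMap.BilinForm.finrank_orthogonal hnd] at h2
  have h3 := Submodule.finrank_sup_add_finrank_inf_eq S A
  have hCle := Submodule.finrank_le C
  set g := (LinearMap.fst K V W).domRestrict (S ⊓ A) with hg
  have h4 := LinearMap.finrank_range_add_finrank_ker g
  have h5 : finrank K (LinearMap.ker g) ≤ finrank K C := by
    rw [← Submodule.finrank_map_subtype_eq]
    apply Submodule.finrank_mono
    rintro _ ⟨⟨x, hx⟩, hx', rfl⟩
    exact ⟨hx.1, hx', hx.2.2⟩
  rw [Module.finrank_prod] at *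
  refine ⟨LinearMap.range g, ?_, by omega⟩
  rintro _ ⟨⟨⟨x, y⟩, hx⟩, rfl⟩
  have e1 := hS _ hx.1
  rw [prod_apply] at e1
  simp only at e1
  rw [hT y hx.2.2, add_zero] at e1
  exact e1

theorem Lag.cancel {φ ψ : QF K} (hφ : φ.Nondeg) (hψ : ψ.Nondeg) (h : Lag (QF.add φ ψ))
    (h' : Lag ψ) : Lag φ := by
  obtain ⟨S, hS, hd⟩ := h
  obtain ⟨T, hT, hd'⟩ := h'
  exact lag_cancel_aux φ.q ψ.q (Nondeg.add hφ hψ) S hS hd T hT hd'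

theorem Lag.add {φ ψ : QF K} (h : Lag φ) (h' : Lag ψ) : Lag (QF.add φ ψ) := by
  obtain ⟨S, hS, hd⟩ := h
  obtain ⟨T, hT, hd'⟩ := h'
  refine ⟨S.prod T, ?_, ?_⟩
  · rintro ⟨x, y⟩ hxy
    rw [add_q, hS x hxy.1, hT y hxy.2, add_zero]
  · rw [finrank_add]
    have := finrank_prod_sub S T
    have h2 : finrank K (S.prod T : Submodule K (QF.add φ ψ).V) = finrank K S + finrank K T := this
    refine le_trans ?_ (le_of_eq (congrArg (2 * ·) h2.symm))
    omega

theorem Lag.smul {φ : QF K} (h : Lag φ) (a : K) : Lag (QF.smul a φ) := by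
  obtain ⟨S, hS, hd⟩ := h
  refine ⟨S, ?_, hd⟩
  intro x hx
  show a • φ.q x = 0
  have : φ.q x = 0 := hS x hx
  exact (congrArg (a • ·) this).trans (smul_zero a)

/-- the one-dimensional form with coefficient `a`. -/
def line (a : K) : QF K := { V := K, q := a • QuadraticMap.sq }

theorem line_q (a x : K) : (line a).q x = a * (x * x) := rfl

theorem line_polar (a x y : K) : polar (line a).q x y = 2 * a * (x * y) := by
  have : polar (line a).q x y = a * ((x + y) * (x + y)) - a * (x * x) - a * (y * y) := rfl
  rw [this]; ring

/-- diagonal form -/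
noncomputable def ofList : List K → QF K
  | [] => QF.zero
  | a :: l => QF.add (line a) (ofList l)

/-- all entries nonzero -/
def NZ (l : List K) : Prop := ∀ a ∈ l, a ≠ 0

theorem NZ.nil : NZ ([] : List K) := by intro a h; simp at h
theorem NZ.cons {a : K} {l : List K} : NZ (a :: l) ↔ a ≠ 0 ∧ NZ l := by
  simp [NZ]
theorem NZ.append {l m : List K} : NZ (l ++ m) ↔ NZ l ∧ NZ m := by
  simp only [NZ, List.mem_append]
  exact ⟨fun h => ⟨fun a ha => h a (Or.inl ha), fun a ha => h a (Or.inr ha)⟩,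
    fun h a ha => ha.elim (h.1 a) (h.2 a)⟩
theorem NZ.perm {l m : List K} (h : l.Perm m) (hl : NZ l) : NZ m := fun a ha => hl a (h.mem_iff.2 ha)
theorem NZ.map {l : List K} (h : NZ l) {c : K} (hc : c ≠ 0) : NZ (l.map (c * ·)) := by
  intro a ha
  obtain ⟨b, hb, rfl⟩ := List.mem_map.1 ha
  exact mul_ne_zero hc (h b hb)

theorem finrank_line (a : K) : finrank K (line a).V = 1 := Module.finrank_self K

theorem finrank_ofList (l : List K) : finrank K (ofList l).V = l.length := by
  induction l with
  | nil =>
    show finrank K (Fin 0 → K) = 0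
    simp
  | cons a l ih =>
    rw [ofList, finrank_add, ih, finrank_line, List.length_cons, add_comm]

theorem ofList_append (l m : List K) :
    (ofList (l ++ m)).Equiv (QF.add (ofList l) (ofList m)) := by
  induction l with
  | nil => exact equiv_symm (zero_add' _)
  | cons a l ih =>
    exact equiv_trans (add_congr (equiv_refl (line a)) ih) (equiv_symm (add_assoc' _ _ _))

theorem ofList_perm {l m : List K} (h : l.Perm m) : (ofList l).Equiv (ofList m) := by
  induction h with
  | nil => exact equiv_refl _
  | cons a _ ih => exact add_congr (equiv_refl _) ih
  | swap a b l =>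
    refine equiv_trans (equiv_symm (add_assoc' _ _ _)) ?_
    refine equiv_trans (add_congr (add_comm' _ _) (equiv_refl _)) ?_
    exact add_assoc' _ _ _
  | trans _ _ ih1 ih2 => exact equiv_trans ih1 ih2

theorem smul_add' (a : K) (φ ψ : QF K) :
    (QF.smul a (QF.add φ ψ)).Equiv (QF.add (QF.smul a φ) (QF.smul a ψ)) :=
  equiv_of (φ := QF.smul a (QF.add φ ψ)) (ψ := QF.add (QF.smul a φ) (QF.smul a ψ))
    (LinearEquiv.refl K (φ.V × ψ.V)) (by
    rintro ⟨x, y⟩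
    exact (mul_add a (φ.q x) (ψ.q y)).symm)

theorem smul_line (c a : K) : (QF.smul c (line a)).Equiv (line (c * a)) :=
  equiv_of (φ := QF.smul c (line a)) (ψ := line (c * a)) (LinearEquiv.refl K K) (by
    intro x
    change K at x
    exact mul_assoc c a (x * x : K))

theorem smul_zero' (c : K) : (QF.smul c QF.zero).Equiv QF.zero :=
  equiv_of (φ := QF.smul c QF.zero) (ψ := QF.zero) (LinearEquiv.refl K (Fin 0 → K)) (by
    intro x
    have h1 : x = 0 := zero_V_sub x
    subst h1
    rw [QuadraticMap.map_zero]
    exact QuadraticMap.map_zero _)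

theorem ofList_smul (c : K) (l : List K) :
    (QF.smul c (ofList l)).Equiv (ofList (l.map (c * ·))) := by
  induction l with
  | nil => exact smul_zero' c
  | cons a l ih =>
    exact equiv_trans (smul_add' c _ _) (add_congr (smul_line c a) ih)

theorem Nondeg.zero : (QF.zero : QF K).Nondeg := by
  rw [nondeg_iff]; intro x _; exact zero_V_sub x

theorem Nondeg.line [NeZero (2 : K)] {a : K} (ha : a ≠ 0) : (line a).Nondeg := by
  rw [nondeg_iff]
  intro (x : K) hx
  have h := hx x
  rw [line_polar] at h
  have h2 : (2 : K) ≠ 0 := NeZero.ne 2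
  have h3 : (x : K) = 0 := by
    simpa [h2, ha] using h
  exact h3

theorem Nondeg.ofList [NeZero (2 : K)] {l : List K} (h : NZ l) : (ofList l).Nondeg := by
  induction l with
  | nil => exact Nondeg.zero
  | cons a l ih =>
    rw [NZ.cons] at h
    exact Nondeg.add (Nondeg.line h.1) (ih h.2)

theorem NZ.of_nondeg {l : List K} (h : (ofList l).Nondeg) : NZ l := by
  induction l with
  | nil => exact NZ.nil
  | cons a l ih =>
    rw [NZ.cons]
    refine ⟨?_, ih (Nondeg.of_add_right h)⟩
    rintro rfl
    have h1 := Nondeg.of_add_left h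
    rw [nondeg_iff] at h1
    have h2 := h1 (1 : K) (by
      intro (y : K)
      rw [line_polar]
      ring)
    exact one_ne_zero (α := K) h2

end Geometry
end WQ


set_option linter.unusedSectionVars false

namespace WQ

open QuadraticMap Module

section WittRing

variable {K : Type} [Field K]

/-- formal class of a list in the monoid algebra -/
noncomputable def cls0 (l : List K) : MonoidAlgebra ℤ K :=
  (l.map (MonoidAlgebra.of ℤ K)).sum

theorem cls0_append (l m : List K) : cls0 (l ++ m) = cls0 l + cls0 m := by
  simp [cls0]

theorem cls0_mul (c : K) (l : List K) :
    MonoidAlgebra.of ℤ K c * cls0 l = cls0 (l.map (c * ·)) := by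
  simp only [cls0, List.map_map]
  rw [← List.sum_map_mul_left]
  congr 1
  apply List.map_congr_left
  intro a _
  simp only [Function.comp, map_mul]

open Classical in
theorem cls0_coeff (l : List K) (x : K) : (cls0 l).coeff x = (l.count x : ℤ) := by
  induction l with
  | nil => simp [cls0]
  | cons a l ih =>
    have : cls0 (a :: l) = MonoidAlgebra.of ℤ K a + cls0 l := by simp [cls0]
    rw [this, MonoidAlgebra.coeff_add, Finsupp.add_apply, ih, List.count_cons]
    simp only [MonoidAlgebra.of_apply, MonoidAlgebra.coeff_single, Finsupp.single_apply,
      beq_iff_eq]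
    push_cast
    ring

/-- membership in the ideal of relations -/
def Rel (x : MonoidAlgebra ℤ K) : Prop :=
  ∃ l m : List K, ∃ k : ℤ, NZ l ∧ NZ m ∧ Lag (ofList l) ∧ Lag (ofList m) ∧
    x = cls0 l - cls0 m + k • MonoidAlgebra.of ℤ K 0

theorem lag_append {l m : List K} (h : Lag (ofList l)) (h' : Lag (ofList m)) :
    Lag (ofList (l ++ m)) :=
  Lag.congr (equiv_symm (ofList_append l m)) (Lag.add h h')

theorem Rel.zero : Rel (0 : MonoidAlgebra ℤ K) :=
  ⟨[], [], 0, NZ.nil, NZ.nil, Lag.zero, Lag.zero, by simp⟩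

theorem Rel.add {x y : MonoidAlgebra ℤ K} (hx : Rel x) (hy : Rel y) : Rel (x + y) := by
  obtain ⟨l, m, k, h1, h2, h3, h4, rfl⟩ := hx
  obtain ⟨l', m', k', h1', h2', h3', h4', rfl⟩ := hy
  refine ⟨l ++ l', m ++ m', k + k', NZ.append.2 ⟨h1, h1'⟩, NZ.append.2 ⟨h2, h2'⟩,
    lag_append h3 h3', lag_append h4 h4', ?_⟩
  rw [cls0_append, cls0_append, add_smul]; abel

theorem Rel.neg {x : MonoidAlgebra ℤ K} (hx : Rel x) : Rel (-x) := by
  obtain ⟨l, m, k, h1, h2, h3, h4, rfl⟩ := hx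
  refine ⟨m, l, -k, h2, h1, h4, h3, ?_⟩
  rw [neg_smul]; abel

theorem Rel.zsmul {x : MonoidAlgebra ℤ K} (hx : Rel x) (n : ℤ) : Rel (n • x) := by
  induction n using Int.induction_on with
  | zero => rw [zero_smul]; exact Rel.zero
  | succ n ih => rw [add_smul, one_smul]; exact ih.add hx
  | pred n ih => rw [sub_smul, one_smul, sub_eq_add_neg]; exact ih.add hx.neg

theorem cls0_zero_mul (l : List K) :
    MonoidAlgebra.of ℤ K 0 * cls0 l = (l.length : ℤ) • MonoidAlgebra.of ℤ K 0 := by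
  rw [cls0_mul, cls0]
  simp

theorem Rel.of_mul {x : MonoidAlgebra ℤ K} (hx : Rel x) (c : K) :
    Rel (MonoidAlgebra.of ℤ K c * x) := by
  obtain ⟨l, m, k, h1, h2, h3, h4, rfl⟩ := hx
  by_cases hc : c = 0
  · subst hc
    refine ⟨[], [], l.length - m.length + k, NZ.nil, NZ.nil, Lag.zero, Lag.zero, ?_⟩
    rw [mul_add, mul_sub, cls0_zero_mul, cls0_zero_mul, mul_smul_comm, ← map_mul, zero_mul,
      add_smul, sub_smul]
    simp
  · refine ⟨l.map (c * ·), m.map (c * ·), k, h1.map hc, h2.map hc,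
      (h3.smul c).congr (ofList_smul c l), (h4.smul c).congr (ofList_smul c m), ?_⟩
    rw [mul_add, mul_sub, cls0_mul, cls0_mul, mul_smul_comm, ← map_mul, mul_zero]

/-- The ideal of relations of the Witt ring -/
def relIdeal (K : Type) [Field K] : Ideal (MonoidAlgebra ℤ K) where
  carrier := {x | Rel x}
  zero_mem' := Rel.zero
  add_mem' := Rel.add
  smul_mem' := by
    intro c x hx
    simp only [Set.mem_ofPred_eq, smul_eq_mul] at *
    induction c using MonoidAlgebra.induction_on with
    | of m => exact hx.of_mul m
    | add a b ha hb => rw [add_mul]; exact ha.add hb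
    | smul r a ha => rw [smul_mul_assoc]; exact ha.zsmul r

/-- The Witt ring -/
def W (K : Type) [Field K] : Type := MonoidAlgebra ℤ K ⧸ relIdeal K

noncomputable instance (K : Type) [Field K] : CommRing (W K) :=
  inferInstanceAs (CommRing (MonoidAlgebra ℤ K ⧸ relIdeal K))

/-- quotient map -/
noncomputable def mkW (K : Type) [Field K] : MonoidAlgebra ℤ K →+* W K :=
  Ideal.Quotient.mk (relIdeal K)

theorem mkW_eq_zero {x : MonoidAlgebra ℤ K} : mkW K x = 0 ↔ Rel x :=
  Ideal.Quotient.eq_zero_iff_mem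

/-- class of the one-dimensional form -/
noncomputable def u (a : K) : W K := mkW K (MonoidAlgebra.of ℤ K a)

/-- class of a list -/
noncomputable def cls (l : List K) : W K := (l.map u).sum

theorem cls_eq (l : List K) : cls l = mkW K (cls0 l) := by
  induction l with
  | nil => simp [cls, cls0]
  | cons a l ih =>
    simp only [cls, cls0, List.map_cons, List.sum_cons, map_add] at *
    rw [ih]; rfl

theorem u_mul (a b : K) : u (a * b) = u a * u b := by
  rw [u, u, u, map_mul, map_mul]

theorem u_one : u (1 : K) = 1 := by
  rw [u, map_one, map_one]

theorem cls_nil : cls ([] : List K) = 0 := rfl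
theorem cls_cons (a : K) (l : List K) : cls (a :: l) = u a + cls l := by simp [cls]
theorem cls_append (l m : List K) : cls (l ++ m) = cls l + cls m := by simp [cls]
theorem cls_map (c : K) (l : List K) : cls (l.map (c * ·)) = u c * cls l := by
  induction l with
  | nil => simp [cls]
  | cons a l ih => simp only [List.map_cons, cls_cons, u_mul] at *; rw [ih]; ring
theorem cls_perm {l m : List K} (h : l.Perm m) : cls l = cls m :=
  (h.map u).sum_eq

theorem cls_zero_of_lag {l : List K} (h : NZ l) (h' : Lag (ofList l)) : cls l = 0 := by
  rw [cls_eq, mkW_eq_zero]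
  exact ⟨l, [], 0, h, NZ.nil, h', Lag.zero, by simp [cls0]⟩

theorem u_zero : u (0 : K) = 0 := by
  rw [u, mkW_eq_zero]
  exact ⟨[], [], 1, NZ.nil, NZ.nil, Lag.zero, Lag.zero, by simp [cls0]⟩

theorem lag_of_cls_zero [NeZero (2 : K)] {l : List K} (hl : NZ l) (h : cls l = 0) :
    Lag (ofList l) := by
  classical
  rw [cls_eq, mkW_eq_zero] at h
  obtain ⟨m, m', k, h1, h2, h3, h4, h5⟩ := h
  have key : (l ++ m').Perm m := by
    rw [List.perm_iff_count]
    intro x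
    by_cases hx : x = 0
    · subst hx
      rw [List.count_eq_zero.2, List.count_eq_zero.2]
      · exact fun h => h1 0 h rfl
      · intro h
        exact (NZ.append.2 ⟨hl, h2⟩) 0 h rfl
    · have := congrArg (fun y => MonoidAlgebra.coeff y x) h5
      simp only [MonoidAlgebra.coeff_add, MonoidAlgebra.coeff_sub, Finsupp.add_apply,
        Finsupp.sub_apply, cls0_coeff, MonoidAlgebra.coeff_smul, Finsupp.smul_apply,
        MonoidAlgebra.of_apply, MonoidAlgebra.coeff_single, Finsupp.single_apply,
        if_neg (Ne.symm hx), smul_zero, add_zero] at this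
      rw [List.count_append]
      omega
  have h6 : Lag (QF.add (ofList l) (ofList m')) :=
    h3.congr (equiv_trans (ofList_perm key.symm) (ofList_append _ _))
  exact Lag.cancel (Nondeg.ofList hl) (Nondeg.ofList h2) h6 h4

end WittRing
end WQ


set_option linter.unusedSectionVars false

namespace WQ

open QuadraticMap Module

section Lists

variable {K : Type} [Field K]

/-- a form represents x -/
def RepF (φ : QF K) (x : K) : Prop := ∃ v, φ.q v = x
/-- isotropic form -/
def IsotF (φ : QF K) : Prop := ∃ v, v ≠ 0 ∧ φ.q v = 0

/-- a list represents x -/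
def Rep (l : List K) (x : K) : Prop := RepF (ofList l) x
/-- isotropic list -/
def Isot (l : List K) : Prop := IsotF (ofList l)
/-- isometry of lists -/
def Iso (l m : List K) : Prop := (ofList l).Equiv (ofList m)

theorem RepF.congr {φ ψ : QF K} (h : φ.Equiv ψ) {x : K} (hx : RepF φ x) : RepF ψ x := by
  obtain ⟨e, he⟩ := equiv_elim h
  obtain ⟨v, hv⟩ := hx
  exact ⟨e v, by rw [he, hv]⟩

theorem IsotF.congr {φ ψ : QF K} (h : φ.Equiv ψ) (hx : IsotF φ) : IsotF ψ := by
  obtain ⟨e, he⟩ := equiv_elim h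
  obtain ⟨v, hv, hq⟩ := hx
  exact ⟨e v, by simpa using hv, by rw [he, hq]⟩

theorem RepF.scale {φ : QF K} {x : K} (h : RepF φ x) (t : K) : RepF φ (t * t * x) := by
  obtain ⟨v, hv⟩ := h
  exact ⟨t • v, by rw [QuadraticMap.map_smul, hv, smul_eq_mul]⟩

theorem Iso.refl (l : List K) : Iso l l := equiv_refl _
theorem Iso.symm {l m : List K} (h : Iso l m) : Iso m l := equiv_symm h
theorem Iso.trans {l m k : List K} (h : Iso l m) (h' : Iso m k) : Iso l k := equiv_trans h h'
theorem Iso.of_perm {l m : List K} (h : l.Perm m) : Iso l m := ofList_perm h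
theorem Iso.length {l m : List K} (h : Iso l m) : l.length = m.length := by
  obtain ⟨e, _⟩ := equiv_elim h
  rw [← finrank_ofList, ← finrank_ofList, e.finrank_eq]
theorem Iso.append {l m l' m' : List K} (h : Iso l m) (h' : Iso l' m') :
    Iso (l ++ l') (m ++ m') :=
  equiv_trans (ofList_append _ _) (equiv_trans (add_congr h h') (equiv_symm (ofList_append _ _)))
theorem Iso.cons (a : K) {l m : List K} (h : Iso l m) : Iso (a :: l) (a :: m) :=
  add_congr (equiv_refl _) h
theorem Iso.map (c : K) {l m : List K} (h : Iso l m) :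
    Iso (l.map (c * ·)) (m.map (c * ·)) :=
  equiv_trans (equiv_symm (ofList_smul c l)) (equiv_trans (smul_congr c h) (ofList_smul c m))
theorem NZ.iso [NeZero (2 : K)] {l m : List K} (h : Iso l m) (hl : NZ l) : NZ m :=
  NZ.of_nondeg (Nondeg.congr h (Nondeg.ofList hl))
theorem Rep.iso {l m : List K} (h : Iso l m) {x : K} (hx : Rep l x) : Rep m x := RepF.congr h hx
theorem Isot.iso {l m : List K} (h : Iso l m) (hx : Isot l) : Isot m := IsotF.congr h hx

theorem rep_nil {x : K} : Rep [] x ↔ x = 0 := by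
  constructor
  · rintro ⟨v, rfl⟩
    rw [zero_V_sub v]; exact QuadraticMap.map_zero _
  · rintro rfl; exact ⟨0, QuadraticMap.map_zero _⟩

theorem rep_cons {a x : K} {l : List K} : Rep (a :: l) x ↔ ∃ t y, Rep l y ∧ x = a * (t * t) + y := by
  constructor
  · rintro ⟨⟨t, v⟩, rfl⟩
    exact ⟨t, _, ⟨v, rfl⟩, rfl⟩
  · rintro ⟨t, y, ⟨v, rfl⟩, rfl⟩
    exact ⟨(t, v), rfl⟩

theorem rep_zero (l : List K) : Rep l 0 := ⟨0, QuadraticMap.map_zero _⟩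

theorem rep_append {l m : List K} {x : K} :
    Rep (l ++ m) x ↔ ∃ y z, Rep l y ∧ Rep m z ∧ x = y + z := by
  induction l generalizing x with
  | nil =>
    simp only [List.nil_append, rep_nil]
    constructor
    · intro h; exact ⟨0, x, rfl, h, by simp⟩
    · rintro ⟨y, z, rfl, h, rfl⟩; simpa using h
  | cons a l ih =>
    simp only [List.cons_append, rep_cons, ih]
    constructor
    · rintro ⟨t, y, ⟨y1, z1, h1, h2, rfl⟩, rfl⟩
      exact ⟨_, z1, ⟨t, y1, h1, rfl⟩, h2, by ring⟩
    · rintro ⟨y, z, ⟨t, y1, h1, rfl⟩, h2, rfl⟩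
      exact ⟨t, _, ⟨y1, z, h1, h2, rfl⟩, by ring⟩

theorem rep_map {l : List K} {c x : K} (h : Rep l x) : Rep (l.map (c * ·)) (c * x) := by
  obtain ⟨v, rfl⟩ := h
  exact RepF.congr (ofList_smul c l) ⟨v, rfl⟩

theorem rep_map_iff {l : List K} {c x : K} : Rep (l.map (c * ·)) x ↔ ∃ y, Rep l y ∧ x = c * y := by
  constructor
  · intro h
    obtain ⟨v, hv⟩ := RepF.congr (equiv_symm (ofList_smul c l)) h
    exact ⟨_, ⟨v, rfl⟩, hv.symm⟩
  · rintro ⟨y, hy, rfl⟩; exact rep_map hy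

theorem Rep.scale {l : List K} {x : K} (h : Rep l x) (t : K) : Rep l (t * t * x) := RepF.scale h t

theorem q_add (φ : QF K) (x y : φ.V) : φ.q (x + y) = φ.q x + φ.q y + polar φ.q x y :=
  QuadraticMap.map_add φ.q x y

variable [NeZero (2 : K)]

/-- splitting off a represented value, keeping track of orthogonal vectors -/
theorem split_off {φ : QF K} (hφ : φ.Nondeg) (v : φ.V) (hv : φ.q v ≠ 0) :
    ∃ ψ : QF K, ψ.Nondeg ∧ φ.Equiv (QF.add (line (φ.q v)) ψ) ∧
      ∀ v', polar φ.q v v' = 0 → RepF ψ (φ.q v') := by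
  have h2 : (2 : K) ≠ 0 := NeZero.ne 2
  let B : φ.V →ₗ[K] K := polarBilin φ.q v
  have hB : ∀ x, B x = polar φ.q v x := fun x => rfl
  have hvv : polar φ.q v v = 2 * φ.q v := by
    rw [polar_self]; simp [two_mul, two_smul]
  have hvv' : B v ≠ 0 := by rw [hB, hvv]; exact mul_ne_zero h2 hv
  let ψ : QF K := { V := LinearMap.ker B, q := φ.q.comp (LinearMap.ker B).subtype }
  have hψ : ∀ w : LinearMap.ker B, ψ.q w = φ.q (w : φ.V) := fun w => rfl
  let e : φ.V ≃ₗ[K] K × LinearMap.ker B :=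
    { toFun := fun x => (B x / B v, ⟨x - (B x / B v) • v, by
        rw [LinearMap.mem_ker, map_sub, map_smul, smul_eq_mul, div_mul_cancel₀ _ hvv', sub_self]⟩)
      invFun := fun p => p.1 • v + p.2
      map_add' := fun x y => by
        refine Prod.ext ?_ (Subtype.ext ?_)
        · simp [add_div]
        · simp only [map_add, add_div, add_smul, Prod.snd_add, Submodule.coe_add]; abel
      map_smul' := fun a x => by
        refine Prod.ext ?_ (Subtype.ext ?_)
        · simp [mul_div_assoc]
        · simp only [map_smul, smul_eq_mul, mul_div_assoc, mul_smul, RingHom.id_apply,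
            Prod.smul_snd, Submodule.coe_smul, smul_sub]
      left_inv := fun x => by simp
      right_inv := fun p => by
        have h1 : B (p.1 • v + p.2) = p.1 * B v := by
          have := p.2.2
          rw [LinearMap.mem_ker] at this
          rw [map_add, map_smul, this, add_zero, smul_eq_mul]
        refine Prod.ext ?_ (Subtype.ext ?_)
        · simp only [h1]; exact mul_div_cancel_right₀ _ hvv'
        · simp only [h1]
          rw [mul_div_cancel_right₀ _ hvv']; simp }
  have hE : (QF.add (line (φ.q v)) ψ).Equiv φ := by
    refine equiv_of (φ := QF.add (line (φ.q v)) ψ) (ψ := φ) e.symm ?_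
    rintro ⟨(t : K), (w : LinearMap.ker B)⟩
    show φ.q (t • v + (w : φ.V)) = φ.q v * (t * t) + φ.q (w : φ.V)
    have hw : polar φ.q v w = 0 := w.2
    rw [q_add, QuadraticMap.map_smul, polar_smul_left, hw]
    simp; ring
  refine ⟨ψ, ?_, equiv_symm hE, ?_⟩
  · exact Nondeg.of_add_right (Nondeg.congr (equiv_symm hE) hφ)
  · intro v' hv'
    exact ⟨(⟨v', hv'⟩ : LinearMap.ker B), rfl⟩

theorem exists_val_ne {φ : QF K} (hφ : φ.Nondeg) (h : finrank K φ.V ≠ 0) : ∃ v, φ.q v ≠ 0 := by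
  by_contra! hc
  have : Nontrivial φ.V := Module.nontrivial_of_finrank_pos (R := K) (Nat.pos_of_ne_zero h)
  obtain ⟨x, hx⟩ := exists_ne (0 : φ.V)
  apply hx
  rw [nondeg_iff] at hφ
  apply hφ
  intro y
  simp [polar, hc]

theorem exists_list {φ : QF K} (hφ : φ.Nondeg) : ∃ l, NZ l ∧ φ.Equiv (ofList l) := by
  induction h : finrank K φ.V generalizing φ with
  | zero =>
    refine ⟨[], NZ.nil, ?_⟩
    have h0 : finrank K φ.V = finrank K (Fin 0 → K) := by
      rw [h]; exact (finrank_ofList ([] : List K)).symm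
    let e1 := LinearEquiv.ofFinrankEq φ.V (Fin 0 → K) h0
    let e0 : φ.V ≃ₗ[K] (ofList ([] : List K)).V := e1
    refine equiv_of (ψ := ofList []) e0 ?_
    intro x
    have : Subsingleton φ.V := Module.finrank_zero_iff.1 h
    rw [Subsingleton.elim x 0, LinearEquiv.map_zero, QuadraticMap.map_zero, QuadraticMap.map_zero]
  | succ n ih =>
    obtain ⟨v, hv⟩ := exists_val_ne hφ (by omega)
    obtain ⟨ψ, hψ, he, _⟩ := split_off hφ v hv
    obtain ⟨e, _⟩ := equiv_elim he
    have h1 := e.finrank_eq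
    rw [finrank_add, finrank_line, h] at h1
    obtain ⟨l, hl, hl'⟩ := ih hψ (by omega)
    exact ⟨φ.q v :: l, NZ.cons.2 ⟨hv, hl⟩, equiv_trans he (add_congr (equiv_refl _) hl')⟩

theorem isot_universal {φ : QF K} (hφ : φ.Nondeg) (h : IsotF φ) :
    ∃ ψ : QF K, ψ.Nondeg ∧ φ.Equiv (QF.add (line 1) (QF.add (line (-1)) ψ)) := by
  have h2 : (2 : K) ≠ 0 := NeZero.ne 2
  obtain ⟨v, hv0, hv⟩ := h
  obtain ⟨w, hw⟩ : ∃ w, polar φ.q v w ≠ 0 := by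
    by_contra! hc
    exact hv0 ((nondeg_iff φ).1 hφ v hc)
  set p := polar φ.q v w with hp
  set z := ((1 - φ.q w) / p) • v + w with hz
  have hz1 : φ.q z = 1 := by
    rw [hz, q_add, QuadraticMap.map_smul, polar_smul_left, hv, ← hp]
    simp only [smul_eq_mul]
    field_simp; ring
  have hpz : polar φ.q v z = p := by
    rw [hz, polar_add_right, polar_smul_right, polar_self, hv]; simp [hp]
  have hzz : polar φ.q z z = 2 := by
    rw [polar_self, hz1]; simp
  have hz2 : polar φ.q z (z + (-(2 / p)) • v) = 0 := by
    rw [polar_add_right, polar_smul_right, polar_comm φ.q z v, hpz, hzz]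
    simp only [smul_eq_mul]
    field_simp; ring
  have hz3 : φ.q (z + (-(2 / p)) • v) = -1 := by
    rw [q_add, QuadraticMap.map_smul, polar_smul_right, polar_comm φ.q z v, hpz,
      hv, hz1]
    simp only [smul_eq_mul]
    field_simp; ring
  obtain ⟨ψ, hψ, he, hr⟩ := split_off hφ z (by rw [hz1]; exact one_ne_zero)
  obtain ⟨y, hy⟩ := hr _ hz2
  rw [hz3] at hy
  obtain ⟨χ, hχ, he', -⟩ := split_off hψ y (by rw [hy]; exact neg_ne_zero.2 one_ne_zero)
  rw [hz1] at he
  rw [hy] at he'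
  exact ⟨χ, hχ, equiv_trans he (add_congr (equiv_refl _) he')⟩

theorem isot_split {l : List K} (hl : NZ l) (h : Isot l) :
    ∃ l', NZ l' ∧ Iso l (1 :: -1 :: l') := by
  obtain ⟨ψ, hψ, he⟩ := isot_universal (Nondeg.ofList hl) h
  obtain ⟨l', hl', he'⟩ := exists_list hψ
  exact ⟨l', hl', equiv_trans he (add_congr (equiv_refl _) (add_congr (equiv_refl _) he'))⟩

theorem rep_split {l : List K} (hl : NZ l) {c : K} (hc : c ≠ 0) (h : Rep l c) :
    ∃ l', NZ l' ∧ Iso l (c :: l') := by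
  obtain ⟨v, rfl⟩ := h
  obtain ⟨ψ, hψ, he, -⟩ := split_off (Nondeg.ofList hl) v hc
  obtain ⟨l', hl', he'⟩ := exists_list hψ
  exact ⟨l', hl', equiv_trans he (add_congr (equiv_refl _) he')⟩

theorem isot_rep {l : List K} (hl : NZ l) (h : Isot l) (x : K) : Rep l x := by
  have h2 : (2 : K) ≠ 0 := NeZero.ne 2
  obtain ⟨l', _, he⟩ := isot_split hl h
  refine Rep.iso he.symm ?_
  rw [rep_cons]
  refine ⟨(1 + x) / 2, -(((1 - x) / 2) * ((1 - x) / 2)), ?_, ?_⟩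
  · rw [rep_cons]
    exact ⟨(1 - x) / 2, 0, rep_zero _, by ring⟩
  · field_simp; ring

theorem isot_append {φ ψ : QF K} (h : Lag (QF.add φ ψ)) (hd : finrank K ψ.V < finrank K φ.V) :
    IsotF φ := by
  obtain ⟨S, hS, hd'⟩ := h
  rw [finrank_add] at hd'
  let g0 : (QF.add φ ψ).V →ₗ[K] ψ.V := LinearMap.snd K φ.V ψ.V
  let g := g0.domRestrict S
  have h1 : finrank K S ≤ finrank K ψ.V → False := by omega
  have hker : LinearMap.ker g ≠ ⊥ := by
    intro hk
    rw [LinearMap.ker_eq_bot] at hk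
    exact h1 (LinearMap.finrank_le_finrank_of_injective hk)
  obtain ⟨⟨⟨x, y⟩, hx⟩, hx1, hx2⟩ := (Submodule.ne_bot_iff _).1 hker
  have hy : y = 0 := hx1
  subst hy
  refine ⟨x, ?_, ?_⟩
  · rintro rfl; exact hx2 rfl
  · have := hS _ hx
    rw [add_q, QuadraticMap.map_zero, add_zero] at this
    exact this

theorem isot_of_cls {l m : List K} (hl : NZ l) (hm : NZ m) (h : cls (l ++ m) = 0)
    (hlen : m.length < l.length) : Isot l := by
  have h1 := lag_of_cls_zero (NZ.append.2 ⟨hl, hm⟩) h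
  refine isot_append (h1.congr (ofList_append l m)) ?_
  rwa [finrank_ofList, finrank_ofList]

theorem lag_iso_neg {φ : QF K} : Lag (QF.add φ (QF.smul (-1) φ)) := by
  let d : φ.V →ₗ[K] φ.V × φ.V := LinearMap.prod LinearMap.id LinearMap.id
  have hd : Function.Injective d := fun x y h => congrArg Prod.fst h
  refine ⟨(LinearMap.range d : Submodule K (φ.V × φ.V)), ?_, ?_⟩
  · rintro _ ⟨x, rfl⟩
    show φ.q x + (-1) * φ.q x = 0
    ring
  · rw [finrank_add]
    have h1 := LinearMap.finrank_range_of_inj hd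
    have h3 : finrank K (QF.smul (-1) φ).V = finrank K φ.V := rfl
    refine le_trans ?_ (le_of_eq (congrArg (2 * ·) h1.symm))
    omega

theorem u_neg_one : u (-1 : K) = -1 := by
  have h : cls ([1, -1] : List K) = 0 := by
    apply cls_zero_of_lag
    · intro a ha; simp at ha; rcases ha with rfl | rfl <;> simp
    · have h0 : (ofList ([1] ++ [-1] : List K)).Equiv (QF.add (ofList [1]) (ofList [-1])) :=
        ofList_append _ _
      have h1 := ofList_smul (-1 : K) [1]
      simp only [List.map, mul_one] at h1
      exact (lag_iso_neg (φ := ofList [1])).congr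
        (equiv_trans (add_congr (equiv_refl _) h1) (equiv_symm h0))
  rw [cls_cons, cls_cons, cls_nil, u_one, add_zero] at h
  exact (neg_eq_of_add_eq_zero_right h).symm

theorem u_neg (a : K) : u (-a) = -u a := by
  rw [← neg_one_mul, u_mul, u_neg_one, neg_one_mul]

theorem Iso.cls {l m : List K} (h : Iso l m) (hl : NZ l) : cls l = cls m := by
  have hm := hl.iso h
  have h1 : Lag (ofList (l ++ m.map ((-1) * ·))) := by
    refine (lag_iso_neg (φ := ofList l)).congr ?_
    refine equiv_trans ?_ (equiv_symm (ofList_append _ _))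
    exact add_congr (equiv_refl _) (equiv_trans (smul_congr _ h) (ofList_smul _ _))
  have h2 := cls_zero_of_lag (NZ.append.2 ⟨hl, hm.map (neg_ne_zero.2 one_ne_zero)⟩) h1
  rw [cls_append, cls_map, u_neg_one] at h2
  linear_combination h2

theorem iso_of_cls {l m : List K} (hl : NZ l) (hm : NZ m) (h : WQ.cls l = WQ.cls m)
    (hlen : l.length = m.length) : Iso l m := by
  induction l generalizing m with
  | nil =>
    have : m = [] := List.length_eq_zero_iff.1 hlen.symm
    rw [this]; exact Iso.refl _
  | cons a l ih =>
    rw [NZ.cons] at hl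
    have hneg : (-1 : K) ≠ 0 := neg_ne_zero.2 one_ne_zero
    have hnm : NZ (m.map ((-1) * ·)) := hm.map hneg
    have h1 : WQ.cls ((a :: m.map ((-1) * ·)) ++ l) = 0 := by
      rw [cls_append, cls_cons, cls_map, u_neg_one, ← h, cls_cons]; ring
    have h2 : Isot (a :: m.map ((-1) * ·)) :=
      isot_of_cls (NZ.cons.2 ⟨hl.1, hnm⟩) hl.2 h1 (by simp at *; omega)
    have h3 : Rep m a := by
      obtain ⟨⟨(t : K), v⟩, hv0, hv⟩ := h2
      have hv' : a * (t * t) + (ofList (m.map ((-1) * ·))).q v = 0 := hv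
      by_cases ht : t = 0
      · apply isot_rep hm
        have : Isot (m.map ((-1) * ·)) := by
          refine ⟨v, ?_, ?_⟩
          · rintro rfl; apply hv0; rw [ht]; rfl
          · rw [ht] at hv'; simpa using hv'
        obtain ⟨w, hw, hw'⟩ := IsotF.congr (equiv_symm (ofList_smul (-1) m)) this
        refine ⟨w, hw, ?_⟩
        have hw2 : (-1) * (ofList m).q w = 0 := hw'
        simpa using hw2
      · have hr : Rep (m.map ((-1) * ·)) (-(a * (t * t))) := ⟨v, by linear_combination hv'⟩
        obtain ⟨y, hy, hy'⟩ := rep_map_iff.1 hr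
        have := hy.scale t⁻¹
        convert this using 1
        have : y = a * (t * t) := by linear_combination hy'
        rw [this]; field_simp
    obtain ⟨m', hm', hi⟩ := rep_split hm hl.1 h3
    have h4 := hi.cls hm
    rw [cls_cons] at h4 h
    have h5 := ih hl.2 hm' (add_left_cancel (h.trans h4)) (by
      have := hi.length
      simp at *; omega)
    exact (h5.cons a).trans hi.symm

end Lists
end WQ

set_option linter.unusedSectionVars false

namespace WQ

open QuadraticMap Module

section Rels

variable {K : Type} [Field K]

theorem iso_sq (a : K) {t : K} (ht : t ≠ 0) : Iso [a * (t * t)] [a] := by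
  refine add_congr ?_ (equiv_refl _)
  refine equiv_of (φ := line (a * (t * t))) (ψ := line a)
    (LinearEquiv.smulOfNeZero K K t ht) ?_
  intro (x : K)
  show a * ((t * x) * (t * x)) = a * (t * t) * (x * x)
  ring

theorem iso_add (a b : K) (h : a + b ≠ 0) : Iso [a + b, a * b * (a + b)] [a, b] := by
  let e : (K × (K × (Fin 0 → K))) ≃ₗ[K] (K × (K × (Fin 0 → K))) :=
    { toFun := fun p => (p.1 - b * p.2.1, p.1 + a * p.2.1, p.2.2)
      invFun := fun p => ((a * p.1 + b * p.2.1) / (a + b), (p.2.1 - p.1) / (a + b), p.2.2)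
      map_add' := fun p q => by
        refine Prod.ext ?_ (Prod.ext ?_ ?_) <;> simp <;> ring
      map_smul' := fun c p => by
        refine Prod.ext ?_ (Prod.ext ?_ ?_) <;> simp <;> ring
      left_inv := fun p => by
        refine Prod.ext ?_ (Prod.ext ?_ ?_) <;> simp <;> field_simp <;> ring
      right_inv := fun p => by
        refine Prod.ext ?_ (Prod.ext ?_ ?_) <;> simp <;> field_simp <;> ring }
  refine equiv_of (φ := ofList [a + b, a * b * (a + b)]) (ψ := ofList [a, b]) e ?_
  rintro ⟨(x : K), (y : K), (z : Fin 0 → K)⟩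
  show a * ((x - b * y) * (x - b * y)) + (b * ((x + a * y) * (x + a * y)) + (QF.zero : QF K).q z) =
    (a + b) * (x * x) + (a * b * (a + b) * (y * y) + (QF.zero : QF K).q z)
  ring

theorem bin_iso (a : K) : (QF.bin a).Equiv (ofList [1, -a]) := by
  let e : (Fin 2 → K) ≃ₗ[K] (K × (K × (Fin 0 → K))) :=
    { toFun := fun p => (p 0, p 1, 0)
      invFun := fun p => ![p.1, p.2.1]
      map_add' := fun p q => by
        refine Prod.ext ?_ (Prod.ext ?_ ?_) <;> simp
      map_smul' := fun c p => by
        refine Prod.ext ?_ (Prod.ext ?_ ?_) <;> simp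
      left_inv := fun p => by
        funext i; fin_cases i <;> simp
      right_inv := fun p => by
        refine Prod.ext ?_ (Prod.ext ?_ ?_)
        · simp
        · simp
        · funext i; exact i.elim0 }
  refine equiv_of (φ := QF.bin a) (ψ := ofList [1, -a]) e ?_
  intro (x : Fin 2 → K)
  have h1 : (ofList [1, -a]).q (e x) = 1 * (x 0 * x 0) + (-a * (x 1 * x 1) + (QF.zero : QF K).q 0) := rfl
  refine h1.trans ?_
  rw [QuadraticMap.map_zero]
  show _ = weightedSumSquares K ![(1 : K), -a] x
  rw [weightedSumSquares_apply]
  simp [Fin.sum_univ_two]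

/-- hyperbolic list -/
def hl : ℕ → List K
  | 0 => []
  | m + 1 => 1 :: -1 :: hl m

theorem hyp_iso (m : ℕ) : (QF.hyperbolics m : QF K).Equiv (ofList (hl m)) := by
  induction m with
  | zero => exact equiv_refl _
  | succ m ih =>
    refine equiv_trans (add_congr (bin_iso 1) ih) ?_
    exact equiv_symm (ofList_append [1, -1] (hl m))

variable [NeZero (2 : K)]

theorem hl_nz (m : ℕ) : NZ (hl m : List K) := by
  induction m with
  | zero => exact NZ.nil
  | succ m ih => exact NZ.cons.2 ⟨one_ne_zero, NZ.cons.2 ⟨neg_ne_zero.2 one_ne_zero, ih⟩⟩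

theorem hl_cls (m : ℕ) : cls (hl m : List K) = 0 := by
  induction m with
  | zero => rfl
  | succ m ih => rw [hl, cls_cons, cls_cons, ih, u_neg_one, u_one]; ring

theorem u_sq {t : K} (ht : t ≠ 0) : u (t * t) = 1 := by
  have := (iso_sq 1 ht).cls (by intro a ha; simp at ha; subst ha; simpa using ht)
  simpa [cls_cons, cls_nil, u_one] using this

theorem u_mul_sq (a : K) {t : K} (ht : t ≠ 0) : u (a * (t * t)) = u a := by
  rw [u_mul, u_sq ht, mul_one]

theorem u_mul_self {a : K} (ha : a ≠ 0) : u a * u a = 1 := by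
  rw [← u_mul, u_sq ha]

theorem u_add {a b : K} (ha : a ≠ 0) (hb : b ≠ 0) (h : a + b ≠ 0) :
    u a + u b = u (a + b) + u (a * b * (a + b)) := by
  have := (iso_add a b h).cls (by
    intro x hx; simp at hx; rcases hx with rfl | rfl
    · exact h
    · exact mul_ne_zero (mul_ne_zero ha hb) h)
  simpa [cls_cons, cls_nil] using this.symm

theorem not_isot_nil : ¬ Isot ([] : List K) := by
  rintro ⟨v, hv, _⟩; exact hv (zero_V_sub v)

theorem isot_of_lag {l : List K} (h : Lag (ofList l)) (hl : l ≠ []) : Isot l := by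
  obtain ⟨S, hS, hd⟩ := h
  rw [finrank_ofList] at hd
  have hl' : 0 < l.length := List.length_pos_iff.2 hl
  have : S ≠ ⊥ := by
    rintro rfl
    rw [finrank_bot] at hd
    omega
  obtain ⟨x, hx, hx'⟩ := (Submodule.ne_bot_iff _).1 this
  exact ⟨x, hx', hS x hx⟩

/-- Witt decomposition -/
theorem exists_aniso (l : List K) (hl : NZ l) :
    ∃ m, NZ m ∧ ¬ Isot m ∧ cls m = cls l ∧ m.length ≤ l.length := by
  induction h : l.length using Nat.strong_induction_on generalizing l with
  | _ n ih =>
    by_cases hi : Isot l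
    · obtain ⟨l', hl', he⟩ := isot_split hl hi
      have h1 := he.length
      simp at h1
      obtain ⟨m, h3, h4, h5, h6⟩ := ih l'.length (by omega) l' hl' rfl
      refine ⟨m, h3, h4, ?_, by omega⟩
      rw [h5, he.cls hl, cls_cons, cls_cons, u_neg_one, u_one]; ring
    · exact ⟨l, hl, hi, rfl, h.le⟩

theorem aniso_nil {l : List K} (hl : NZ l) (h : ¬ Isot l) (h0 : cls l = 0) : l = [] := by
  by_contra hne
  exact h (isot_of_lag (lag_of_cls_zero hl h0) hne)

theorem hyperbolic_of_cls {l : List K} (hl : NZ l) (h : cls l = 0) :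
    ∃ m, Iso l (WQ.hl m) := by
  induction hn : l.length using Nat.strong_induction_on generalizing l with
  | _ n ih =>
    by_cases hi : l = []
    · subst hi; exact ⟨0, Iso.refl _⟩
    · obtain ⟨l', hl', he⟩ := isot_split hl (isot_of_lag (lag_of_cls_zero hl h) hi)
      have h1 := he.length
      simp at h1
      have h2 := he.cls hl
      rw [cls_cons, cls_cons, u_neg_one, u_one, h] at h2
      obtain ⟨m, hm⟩ := ih l'.length (by omega) hl' (by linear_combination -h2) rfl
      exact ⟨m + 1, he.trans ((hm.cons _).cons _)⟩

theorem isHyperbolic_iff {φ : QF K} {l : List K} (hl : NZ l) (h : φ.Equiv (ofList l)) :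
    φ.IsHyperbolic ↔ cls l = 0 := by
  constructor
  · rintro ⟨m, hm⟩
    have : Iso l (WQ.hl m) := equiv_trans (equiv_symm h) (equiv_trans hm (hyp_iso m))
    rw [this.cls hl, hl_cls]
  · intro h0
    obtain ⟨m, hm⟩ := hyperbolic_of_cls hl h0
    exact ⟨m, equiv_trans h (equiv_trans hm (equiv_symm (hyp_iso m)))⟩

theorem IsHyperbolic.nondeg {φ : QF K} (h : φ.IsHyperbolic) : φ.Nondeg := by
  obtain ⟨m, hm⟩ := h
  exact Nondeg.congr (equiv_symm (equiv_trans hm (hyp_iso m))) (Nondeg.ofList (hl_nz m))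

theorem rep_of_cls_cons {l m : List K} (hl : NZ l) (hm : NZ m) (h : cls l = cls m)
    (hlen : l.length ≤ m.length) {x : K} (hx : Rep l x) : Rep m x := by
  rcases Nat.lt_or_ge l.length m.length with h1 | h1
  · have h2 : cls (m ++ l.map ((-1) * ·)) = 0 := by
      rw [cls_append, cls_map, u_neg_one, h]; ring
    exact isot_rep hm (isot_of_cls hm (hl.map (neg_ne_zero.2 one_ne_zero)) h2 (by simpa using h1)) x
  · exact hx.iso (iso_of_cls hl hm h (le_antisymm hlen h1))

/-- every class is the class of a list -/
theorem exists_cls (x : W K) : ∃ l : List K, NZ l ∧ cls l = x := by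
  obtain ⟨y, rfl⟩ : ∃ y, mkW K y = x := Ideal.Quotient.mk_surjective x
  induction y using MonoidAlgebra.induction_on with
  | of m =>
    by_cases hm : m = 0
    · subst hm; exact ⟨[], NZ.nil, u_zero.symm⟩
    · exact ⟨[m], by intro a ha; simp at ha; rwa [ha], by rw [cls_cons, cls_nil, add_zero]; rfl⟩
  | add a b ha hb =>
    obtain ⟨l, hl, hl'⟩ := ha
    obtain ⟨m, hm, hm'⟩ := hb
    exact ⟨l ++ m, NZ.append.2 ⟨hl, hm⟩, by rw [cls_append, hl', hm', map_add]⟩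
  | smul r a ha =>
    obtain ⟨l, hl, hl'⟩ := ha
    rw [map_zsmul, ← hl']
    induction r using Int.induction_on with
    | zero => exact ⟨[], NZ.nil, by rw [zero_smul]; rfl⟩
    | succ n ih =>
      obtain ⟨m, hm, hm'⟩ := ih
      exact ⟨m ++ l, NZ.append.2 ⟨hm, hl⟩, by rw [cls_append, hm', add_smul, one_smul]⟩
    | pred n ih =>
      obtain ⟨m, hm, hm'⟩ := ih
      refine ⟨m ++ l.map ((-1) * ·), NZ.append.2 ⟨hm, hl.map (neg_ne_zero.2 one_ne_zero)⟩, ?_⟩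
      rw [cls_append, hm', sub_smul, one_smul, cls_map, u_neg_one]; ring

end Rels
end WQ

set_option linter.unusedSectionVars false

namespace WQ

open QuadraticMap Module

section Pfister

variable {K : Type} [Field K]

/-- Pfister product over a base list -/
def plA (A : List K) : List K → List K
  | [] => A
  | a :: t => plA A t ++ (plA A t).map ((-a) * ·)

/-- relative pure part -/
def ppr (A : List K) : List K → List K
  | [] => []
  | a :: t => ppr A t ++ (plA A t).map ((-a) * ·)

/-- Pfister list -/
abbrev pl (s : List K) : List K := plA [1] s

/-- Pfister class -/
noncomputable def pf (s : List K) : W K := (s.map (fun a => 1 - u a)).prod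

theorem pf_nil : pf ([] : List K) = 1 := rfl
theorem pf_cons (a : K) (s : List K) : pf (a :: s) = (1 - u a) * pf s := by simp [pf]
theorem pf_append (s t : List K) : pf (s ++ t) = pf s * pf t := by simp [pf]

theorem plA_append (A t s : List K) : plA A (t ++ s) = plA (plA A s) t := by
  induction t with
  | nil => rfl
  | cons a t ih => simp only [List.cons_append, plA, ih]

theorem plA_perm (A t : List K) : (plA A t).Perm (A ++ ppr A t) := by
  induction t with
  | nil => simp [plA, ppr]
  | cons a t ih =>
    simp only [plA, ppr]
    rw [← List.append_assoc]
    exact ih.append_right _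

theorem plA_length (A t : List K) : (plA A t).length = A.length * 2 ^ t.length := by
  induction t with
  | nil => simp [plA]
  | cons a t ih => simp [plA, ih, pow_succ]; ring

theorem plA_nz {A t : List K} (hA : NZ A) (ht : NZ t) : NZ (plA A t) := by
  induction t with
  | nil => exact hA
  | cons a t ih =>
    rw [NZ.cons] at ht
    exact NZ.append.2 ⟨ih ht.2, (ih ht.2).map (neg_ne_zero.2 ht.1)⟩

theorem ppr_nz {A t : List K} (hA : NZ A) (ht : NZ t) : NZ (ppr A t) := by
  have := (plA_nz hA ht).perm (plA_perm A t)
  exact (NZ.append.1 this).2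

theorem nz_one : NZ ([1] : List K) := by intro a ha; simp at ha; subst ha; exact one_ne_zero

theorem pl_nz {s : List K} (hs : NZ s) : NZ (pl s) := plA_nz nz_one hs

theorem pl_rep_one (s : List K) : Rep (pl s) 1 := by
  refine Rep.iso (Iso.of_perm (plA_perm [1] s).symm) ?_
  exact rep_cons.2 ⟨1, 0, rep_zero _, by ring⟩

variable [NeZero (2 : K)]

theorem plA_cls (A t : List K) : cls (plA A t) = cls A * pf t := by
  induction t with
  | nil => simp [plA, pf_nil]
  | cons a t ih => rw [plA, cls_append, cls_map, ih, pf_cons, u_neg]; ring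

theorem pl_cls (s : List K) : cls (pl s) = pf s := by
  rw [pl, plA_cls, cls_cons, cls_nil, u_one]; ring

theorem pl_length (s : List K) : (pl s).length = 2 ^ s.length := by
  rw [pl, plA_length]; simp

theorem rep_plA_cons {A t : List K} {a x : K} (h : Rep (plA A (a :: t)) x) :
    ∃ y z, Rep (plA A t) y ∧ Rep (plA A t) z ∧ x = y - a * z := by
  obtain ⟨y, z', hy, hz, rfl⟩ := rep_append.1 h
  obtain ⟨z, hz2, rfl⟩ := rep_map_iff.1 hz
  exact ⟨y, z, hy, hz2, by ring⟩

theorem pf_round {s : List K} (hs : NZ s) {x : K} (hx : x ≠ 0) (h : Rep (pl s) x) :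
    u x * pf s = pf s := by
  induction s generalizing x with
  | nil =>
    obtain ⟨t, y, hy, rfl⟩ := rep_cons.1 h
    rw [rep_nil] at hy
    subst hy
    have ht : t ≠ 0 := by rintro rfl; simp at hx
    simp [u_sq ht]
  | cons a s ih =>
    rw [NZ.cons] at hs
    obtain ⟨y, z, hy, hz, rfl⟩ := rep_plA_cons h
    rw [pf_cons]
    have ha := u_mul_self hs.1
    by_cases hz0 : z = 0
    · subst hz0
      simp only [mul_zero, sub_zero] at *
      have := ih hs.2 hx hy
      linear_combination (1 - u a) * this
    · have h1 := ih hs.2 hz0 hz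
      by_cases hy0 : y = 0
      · subst hy0
        rw [zero_sub, u_neg, u_mul]
        linear_combination (-u a * (1 - u a)) * h1 + pf s * ha
      · have h2 := ih hs.2 hy0 hy
        have haz : -(a * z) ≠ 0 := neg_ne_zero.2 (mul_ne_zero hs.1 hz0)
        have h3 := u_add hy0 haz (by rwa [← sub_eq_add_neg])
        rw [← sub_eq_add_neg] at h3
        have h4 := u_mul_self hx
        simp only [u_mul, u_neg] at h3
        set X := u (y - a * z)
        set σ := pf s
        set A := u a
        set Y := u y
        set Z := u z
        -- (Y - A Z) σ = X (1 - A Y Z) σ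
        have e1 : (1 - A) * σ = X * (1 - A) * σ := by
          linear_combination σ * h3 - h2 + A * h1 - X * A * Y * h1 - X * A * h2
        linear_combination -e1
   
theorem pf_isot {s : List K} (hs : NZ s) (h : Isot (pl s)) : pf s = 0 := by
  induction s with
  | nil =>
    exfalso
    obtain ⟨⟨(t : K), v⟩, hv, hq⟩ := h
    have h1 : 1 * (t * t) + (ofList ([] : List K)).q v = 0 := hq
    have hv0 : v = 0 := zero_V_sub v
    subst hv0
    rw [QuadraticMap.map_zero] at h1
    have : t = 0 := by simpa using h1
    subst this
    exact hv rfl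
  | cons a s ih =>
    rw [NZ.cons] at hs
    rw [pf_cons]
    by_cases hi : Isot (pl s)
    · rw [ih hs.2 hi, mul_zero]
    · obtain ⟨⟨v, w⟩, hv, hq⟩ := IsotF.congr (ofList_append _ _) h
      rw [add_q] at hq
      obtain ⟨w', hw', hww⟩ : ∃ w' : (ofList (pl s)).V, -a * (ofList (pl s)).q w' =
          (ofList ((pl s).map ((-a) * ·))).q w ∧ (w' = 0 → w = 0) := by
        obtain ⟨e, he⟩ := equiv_elim (ofList_smul (-a) (pl s))
        refine ⟨e.symm w, ?_, ?_⟩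
        · rw [← e.apply_symm_apply w, he]
          simp only [LinearEquiv.apply_symm_apply]
          rfl
        · intro h0
          have := congrArg e h0
          simp only [LinearEquiv.apply_symm_apply] at this
          rw [this]
          exact map_zero e
      rw [← hw'] at hq
      have hw0 : (ofList (pl s)).q w' ≠ 0 := by
        intro h0
        rw [h0, mul_zero, add_zero] at hq
        have a1 : w' = 0 := by by_contra hc; exact hi ⟨w', hc, h0⟩
        have a2 : v = 0 := by by_contra hc; exact hi ⟨v, hc, hq⟩
        apply hv
        rw [hww a1, a2]; rfl
      have hv0 : (ofList (pl s)).q v ≠ 0 := by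
        intro h0
        rw [h0, zero_add] at hq
        exact mul_ne_zero (neg_ne_zero.2 hs.1) hw0 hq
      have h1 := pf_round hs.2 hv0 ⟨v, rfl⟩
      have h2 := pf_round hs.2 hw0 ⟨w', rfl⟩
      have h3 : (ofList (pl s)).q v = a * (ofList (pl s)).q w' := by linear_combination hq
      rw [h3, u_mul] at h1
      linear_combination u a * h2 - h1

theorem rep_of_pf {s : List K} (hs : NZ s) {x : K} (hx : x ≠ 0) (h : (1 - u x) * pf s = 0) :
    Rep (pl s) x := by
  have h1 : cls ((pl s).map (x * ·)) = cls (pl s) := by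
    rw [cls_map, pl_cls]; linear_combination -h
  have h2 : Rep ((pl s).map (x * ·)) (x * 1) := rep_map (pl_rep_one s)
  rw [mul_one] at h2
  exact rep_of_cls_cons ((pl_nz hs).map hx) (pl_nz hs) h1 (by simp) h2

/-- pure subform theorem, relative version -/
theorem pure_slot {s t : List K} (hs : NZ s) (ht : NZ t) {e : K} (he : e ≠ 0)
    (h : Rep (ppr (pl s) t) e) :
    ∃ t', NZ t' ∧ t'.length + 1 = t.length ∧ pf s * pf t = pf s * ((1 + u e) * pf t') := by
  induction t generalizing e with
  | nil => exact absurd (rep_nil.1 h) he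
  | cons a t ih =>
    rw [NZ.cons] at ht
    obtain ⟨e1, g', h1, h2, rfl⟩ := rep_append.1 h
    obtain ⟨g, h2', rfl⟩ := rep_map_iff.1 h2
    by_cases hg : g = 0
    · subst hg
      simp only [mul_zero, add_zero] at *
      obtain ⟨t', ht', hl, he'⟩ := ih ht.2 he h1
      refine ⟨a :: t', NZ.cons.2 ⟨ht.1, ht'⟩, by simp; omega, ?_⟩
      rw [pf_cons, pf_cons]
      linear_combination (1 - u a) * he'
    · have hr := pf_round (s := t ++ s) (NZ.append.2 ⟨ht.2, hs⟩) hg (by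
        rw [pl, plA_append]; exact h2')
      rw [pf_append] at hr
      by_cases he1 : e1 = 0
      · subst he1
        refine ⟨t, ht.2, rfl, ?_⟩
        rw [pf_cons, zero_add, u_mul, u_neg]
        linear_combination u a * hr
      · obtain ⟨t', ht', hl, he'⟩ := ih ht.2 he1 h1
        refine ⟨(a * g * e1) :: t', NZ.cons.2 ⟨mul_ne_zero (mul_ne_zero ht.1 hg) he1, ht'⟩,
          by simp; omega, ?_⟩
        have hag : -a * g ≠ 0 := mul_ne_zero (neg_ne_zero.2 ht.1) hg
        have h3 := u_add he1 hag he
        have h4 := u_mul_self he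
        rw [pf_cons, pf_cons]
        simp only [u_mul, u_neg] at h3 ⊢
        set E := u (e1 + -a * g)
        linear_combination u a * hr + (1 - u a * u g) * he' + (pf s * pf t') * h3

theorem pure_slot' {s : List K} (hs : NZ s) {e : K} (he : e ≠ 0) (h : Rep (ppr [1] s) e) :
    ∃ t', NZ t' ∧ t'.length + 1 = s.length ∧ pf s = (1 + u e) * pf t' := by
  obtain ⟨t', h1, h2, h3⟩ := pure_slot (s := []) NZ.nil hs he h
  exact ⟨t', h1, h2, by simpa [pf_nil] using h3⟩

end Pfister
end WQ

set_option linter.unusedSectionVars false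

namespace WQ

open QuadraticMap Module
open scoped TensorProduct

section BaseChange

variable {K : Type} [Field K] (L : Type) [Field L] [Algebra K L]

theorem bc_equiv [Invertible (2 : K)] {φ : QF K} {ψ : QF L} (e : (L ⊗[K] φ.V) ≃ₗ[L] ψ.V)
    (h : ∀ v, ψ.q (e (1 ⊗ₜ v)) = algebraMap K L (φ.q v)) : (QF.baseChange L φ).Equiv ψ := by
  have key : QuadraticForm.baseChange L φ.q = ψ.q.comp e.toLinearMap := by
    apply baseChange_ext
    intro m
    rw [QuadraticForm.baseChange_tmul, QuadraticMap.comp_apply]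
    simp only [LinearEquiv.coe_coe, h]
    simp [Algebra.smul_def]
  refine equiv_of (φ := QF.baseChange L φ) (ψ := ψ) e ?_
  intro (x : L ⊗[K] φ.V)
  have : QuadraticForm.baseChange L φ.q x = ψ.q (e x) := by rw [key]; rfl
  exact this.symm

theorem bc_q [Invertible (2 : K)] (φ : QF K) (v : φ.V) :
    (QF.baseChange L φ).q ((1 : L) ⊗ₜ[K] v) = algebraMap K L (φ.q v) := by
  show QuadraticForm.baseChange L φ.q ((1 : L) ⊗ₜ[K] v) = _
  rw [QuadraticForm.baseChange_tmul]
  simp [Algebra.smul_def]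

theorem bc_congr [Invertible (2 : K)] {φ ψ : QF K} (h : φ.Equiv ψ) :
    (QF.baseChange L φ).Equiv (QF.baseChange L ψ) := by
  obtain ⟨e, he⟩ := equiv_elim h
  refine bc_equiv L (ψ := QF.baseChange L ψ) (e.baseChange K L φ.V ψ.V) ?_
  intro v
  have : (e.baseChange K L φ.V ψ.V) (1 ⊗ₜ v) = (1 : L) ⊗ₜ[K] (e v) := rfl
  exact ((congrArg (QF.baseChange L ψ).q this).trans (bc_q L ψ (e v))).trans (by rw [he])

theorem bc_add [Invertible (2 : K)] (φ ψ : QF K) :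
    (QF.baseChange L (QF.add φ ψ)).Equiv (QF.add (QF.baseChange L φ) (QF.baseChange L ψ)) := by
  refine bc_equiv L (φ := QF.add φ ψ) (ψ := QF.add (QF.baseChange L φ) (QF.baseChange L ψ))
    (TensorProduct.prodRight K L L φ.V ψ.V) ?_
  rintro ⟨v, w⟩
  have h1 := bc_q L φ v
  have h2 := bc_q L ψ w
  have h3 : (QF.add (QF.baseChange L φ) (QF.baseChange L ψ)).q
      ((TensorProduct.prodRight K L L φ.V ψ.V) (1 ⊗ₜ (v, w))) =
      (QF.baseChange L φ).q ((1 : L) ⊗ₜ[K] v) + (QF.baseChange L ψ).q ((1 : L) ⊗ₜ[K] w) := rfl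
  refine h3.trans ?_
  rw [h1, h2, add_q, map_add]

theorem bc_line [Invertible (2 : K)] (a : K) :
    (QF.baseChange L (line a)).Equiv (line (algebraMap K L a)) := by
  refine bc_equiv L (φ := line a) (ψ := line (algebraMap K L a))
    (TensorProduct.AlgebraTensorModule.rid K L L) ?_
  intro (x : K)
  have : (TensorProduct.AlgebraTensorModule.rid K L L) (1 ⊗ₜ x) = algebraMap K L x := by
    rw [TensorProduct.AlgebraTensorModule.rid_tmul, Algebra.smul_def, mul_one]
  have h2 : (line (algebraMap K L a)).q ((TensorProduct.AlgebraTensorModule.rid K L L) (1 ⊗ₜ x)) =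
    (line (algebraMap K L a)).q (algebraMap K L x) := congrArg _ this
  refine h2.trans ?_
  rw [line_q, line_q]; simp

theorem bc_zero [Invertible (2 : K)] : (QF.baseChange L (QF.zero : QF K)).Equiv QF.zero := by
  have : finrank L (L ⊗[K] (Fin 0 → K)) = finrank L (Fin 0 → L) := by
    rw [Module.finrank_baseChange]; simp
  let e := LinearEquiv.ofFinrankEq (L ⊗[K] (Fin 0 → K)) (Fin 0 → L) this
  refine bc_equiv L (φ := QF.zero) (ψ := QF.zero) e ?_
  intro v
  have h1 : v = 0 := zero_V_sub v
  have h2 : (e (1 ⊗ₜ v) : (QF.zero : QF L).V) = 0 := zero_V_sub _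
  rw [h1, QuadraticMap.map_zero, map_zero]
  refine (congrArg (QF.zero : QF L).q (zero_V_sub _)).trans ?_
  exact QuadraticMap.map_zero _

theorem bc_ofList [Invertible (2 : K)] (l : List K) :
    (QF.baseChange L (ofList l)).Equiv (ofList (l.map (algebraMap K L))) := by
  induction l with
  | nil => exact bc_zero L
  | cons a l ih =>
    exact equiv_trans (bc_add L (line a) (ofList l)) (add_congr (bc_line L a) ih)

theorem neZero_ext [NeZero (2 : K)] : NeZero (2 : L) := by
  refine ⟨?_⟩
  have h : (2 : K) ≠ 0 := NeZero.ne 2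
  rw [← map_ofNat (algebraMap K L) 2]
  exact (map_ne_zero (algebraMap K L)).2 h

theorem NZ.ext {l : List K} (h : NZ l) : NZ (l.map (algebraMap K L)) := by
  intro a ha
  obtain ⟨b, hb, rfl⟩ := List.mem_map.1 ha
  exact (map_ne_zero _).2 (h b hb)

variable [NeZero (2 : K)] [NeZero (2 : L)]

theorem Iso.ext {l m : List K} (h : Iso l m) :
    Iso (l.map (algebraMap K L)) (m.map (algebraMap K L)) := by
  let _ : Invertible (2 : K) := invertibleOfNonzero (NeZero.ne 2)
  exact equiv_trans (equiv_symm (bc_ofList L l)) (equiv_trans (bc_congr L h) (bc_ofList L m))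

theorem hl_map (m : ℕ) : (hl m : List K).map (algebraMap K L) = hl m := by
  induction m with
  | zero => rfl
  | succ m ih => simp [hl, ih]

theorem lag_ext {l : List K} (hl : NZ l) (h : Lag (ofList l)) :
    Lag (ofList (l.map (algebraMap K L))) := by
  obtain ⟨m, hm⟩ := hyperbolic_of_cls hl (cls_zero_of_lag hl h)
  have h1 := hm.ext L
  rw [hl_map] at h1
  exact Lag.congr h1.symm (lag_of_cls_zero (hl_nz m) (hl_cls m))

/-- the functorial map on monoid algebras -/
noncomputable def resA : MonoidAlgebra ℤ K →+* MonoidAlgebra ℤ L :=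
  MonoidAlgebra.mapDomainRingHom ℤ (algebraMap K L : K →* L)

theorem resA_of (a : K) : resA L (MonoidAlgebra.of ℤ K a) = MonoidAlgebra.of ℤ L (algebraMap K L a) := by
  simp [resA]

theorem resA_cls0 (l : List K) : resA L (cls0 l) = cls0 (l.map (algebraMap K L)) := by
  simp only [cls0, map_list_sum, List.map_map]
  congr 1
  apply List.map_congr_left
  intro a _
  exact resA_of L a

/-- restriction of scalars map of Witt rings -/
noncomputable def res : W K →+* W L :=
  Ideal.Quotient.lift (relIdeal K) ((mkW L).comp (resA L)) (by
    rintro a ⟨l, m, k, h1, h2, h3, h4, rfl⟩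
    rw [RingHom.comp_apply, mkW_eq_zero]
    refine ⟨l.map (algebraMap K L), m.map (algebraMap K L), k, h1.ext L, h2.ext L,
      lag_ext L h1 h3, lag_ext L h2 h4, ?_⟩
    rw [map_add, map_sub, map_zsmul, resA_cls0, resA_cls0, resA_of, map_zero])

theorem res_u (a : K) : res L (u a) = u (algebraMap K L a) := by
  show (mkW L) (resA L (MonoidAlgebra.of ℤ K a)) = _
  rw [resA_of]; rfl

theorem res_cls (l : List K) : res L (cls l) = cls (l.map (algebraMap K L)) := by
  simp only [cls, map_list_sum, List.map_map]
  congr 1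
  apply List.map_congr_left
  intro a _
  exact res_u L a

theorem res_pf (s : List K) : res L (pf s) = pf (s.map (algebraMap K L)) := by
  induction s with
  | nil => simp [pf_nil]
  | cons a s ih => rw [List.map_cons, pf_cons, pf_cons, map_mul, ih, map_sub, map_one, res_u]

theorem plA_ext (A t : List K) :
    (plA A t).map (algebraMap K L) = plA (A.map (algebraMap K L)) (t.map (algebraMap K L)) := by
  induction t with
  | nil => rfl
  | cons a t ih =>
    simp only [plA, List.map_cons, List.map_append, ih, List.map_map]
    congr 1
    rw [← ih, List.map_map]
    apply List.map_congr_left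
    intro x _; simp

theorem ppr_ext (A t : List K) :
    (ppr A t).map (algebraMap K L) = ppr (A.map (algebraMap K L)) (t.map (algebraMap K L)) := by
  induction t with
  | nil => rfl
  | cons a t ih =>
    simp only [ppr, List.map_cons, List.map_append, ih, List.map_map]
    congr 1
    rw [← plA_ext, List.map_map]
    apply List.map_congr_left
    intro x _; simp

theorem pl_ext (s : List K) : (pl s).map (algebraMap K L) = pl (s.map (algebraMap K L)) := by
  rw [pl, plA_ext]; simp

theorem res_res (M : Type) [Field M] [Algebra L M] [Algebra K M] [IsScalarTower K L M]
    [NeZero (2 : M)] (x : W K) : res M (res L x) = res M x := by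
  obtain ⟨l, _, rfl⟩ := exists_cls x
  rw [res_cls, res_cls, res_cls, List.map_map]
  congr 1
  apply List.map_congr_left
  intro a _
  exact (IsScalarTower.algebraMap_apply K L M a).symm

end BaseChange
end WQ

set_option linter.unusedSectionVars false
set_option linter.style.haveILetI false

namespace WQ

open QuadraticMap Module Polynomial

section Transfer

theorem lag_of_inj {K : Type} [Field K] {φ : QF K} {E : Type} [AddCommGroup E] [Module K E]
    (g : E →ₗ[K] φ.V) (hg : Function.Injective g) (h0 : ∀ x, φ.q (g x) = 0)
    (hd : finrank K φ.V ≤ 2 * finrank K E) : Lag φ := by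
  refine ⟨LinearMap.range g, ?_, ?_⟩
  · rintro _ ⟨x, rfl⟩; exact h0 x
  · rwa [LinearMap.finrank_range_of_inj hg]

variable {K L : Type} [Field K] [Field L] [Algebra K L] [FiniteDimensional K L]

/-- Restriction of scalars module structure -/
@[reducible] def rsm (K : Type) {L : Type} [Field K] [Field L] [Algebra K L] (V : Type) [AddCommGroup V] [Module L V] :
    Module K V := Module.compHom V (algebraMap K L)

theorem rst (K : Type) {L : Type} [Field K] [Field L] [Algebra K L] (V : Type) [AddCommGroup V]
    [Module L V] : letI := rsm K (L := L) V; IsScalarTower K L V := by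
  letI := rsm K (L := L) V
  refine ⟨fun a b v => ?_⟩
  have : (a • b) • v = (algebraMap K L a) • (b • v) := by rw [Algebra.smul_def, mul_smul]
  exact this

/-- Scharlau transfer -/
noncomputable def tr (s : L →ₗ[K] K) (φ : QF L) : QF K :=
  letI := rsm K (L := L) φ.V
  haveI : IsScalarTower K L φ.V := rst K φ.V
  haveI : FiniteDimensional K φ.V := Module.Finite.trans L _
  { V := φ.V
    q := s.compQuadraticMap' φ.q }

theorem tr_q (s : L →ₗ[K] K) (φ : QF L) (v : φ.V) : (tr s φ).q v = s (φ.q v) := rfl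

theorem tr_smul (s : L →ₗ[K] K) (φ : QF L) (a : K) (v : φ.V) :
    ((a • (show (tr s φ).V from v) : (tr s φ).V) : φ.V) = algebraMap K L a • v := rfl

theorem tr_finrank (s : L →ₗ[K] K) (φ : QF L) :
    finrank K (tr s φ).V = finrank K L * finrank L φ.V := by
  letI := rsm K (L := L) φ.V
  haveI : IsScalarTower K L φ.V := rst K φ.V
  have : finrank K φ.V = finrank K L * finrank L φ.V :=
    (Module.finrank_mul_finrank K L φ.V).symm
  exact this

theorem tr_congr (s : L →ₗ[K] K) {φ ψ : QF L} (h : φ.Equiv ψ) : (tr s φ).Equiv (tr s ψ) := by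
  obtain ⟨e, he⟩ := equiv_elim h
  let e' : (tr s φ).V ≃ₗ[K] (tr s ψ).V :=
    { toFun := e
      invFun := e.symm
      map_add' := e.map_add
      map_smul' := fun a v => e.map_smul (algebraMap K L a) v
      left_inv := e.left_inv
      right_inv := e.right_inv }
  refine equiv_of (φ := tr s φ) (ψ := tr s ψ) e' ?_
  intro (x : φ.V)
  exact congrArg s (he x)

theorem tr_add (s : L →ₗ[K] K) (φ ψ : QF L) :
    (tr s (QF.add φ ψ)).Equiv (QF.add (tr s φ) (tr s ψ)) := by
  let e : (tr s (QF.add φ ψ)).V ≃ₗ[K] (QF.add (tr s φ) (tr s ψ)).V :=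
    { toFun := fun x => x
      invFun := fun x => x
      map_add' := fun _ _ => rfl
      map_smul' := fun _ _ => rfl
      left_inv := fun _ => rfl
      right_inv := fun _ => rfl }
  refine equiv_of (φ := tr s (QF.add φ ψ)) (ψ := QF.add (tr s φ) (tr s ψ)) e ?_
  intro (x : φ.V × ψ.V)
  have : s (φ.q x.1) + s (ψ.q x.2) = s (φ.q x.1 + ψ.q x.2) := (map_add s _ _).symm
  exact this

theorem tr_zero (s : L →ₗ[K] K) : (tr s (QF.zero : QF L)).Equiv QF.zero := by
  have h0 : finrank K (tr s (QF.zero : QF L)).V = 0 := by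
    rw [tr_finrank]
    have : finrank L (Fin 0 → L) = 0 := by simp
    have h : finrank L (QF.zero : QF L).V = 0 := this
    rw [h, mul_zero]
  have h1 : finrank K (QF.zero : QF K).V = 0 := by
    have : finrank K (Fin 0 → K) = 0 := by simp
    exact this
  refine equiv_of (LinearEquiv.ofFinrankEq _ _ (h0.trans h1.symm)) ?_
  intro x
  have h2 := zero_V_sub ((LinearEquiv.ofFinrankEq _ _ (h0.trans h1.symm)) x :
    (QF.zero : QF K).V)
  rw [h2]
  have h3 : x = 0 := by
    apply (LinearEquiv.ofFinrankEq _ _ (h0.trans h1.symm)).injective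
    rw [h2]; simp
  rw [h3, QuadraticMap.map_zero, QuadraticMap.map_zero]

theorem tr_lag (s : L →ₗ[K] K) {φ : QF L} (h : Lag φ) : Lag (tr s φ) := by
  obtain ⟨S, hS, hd⟩ := h
  have h4 : finrank K L * finrank L φ.V ≤ 2 * (finrank K L * finrank L S) := by nlinarith
  rw [← tr_finrank s] at h4
  letI := rsm K (L := L) φ.V
  haveI : IsScalarTower K L φ.V := rst K φ.V
  let S' : Submodule K φ.V := S.restrictScalars K
  have h1 : finrank K S' = finrank K L * finrank L S :=
      (Module.finrank_mul_finrank K L S).symm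
  rw [← h1] at h4
  refine ⟨S', ?_, h4⟩
  intro (x : φ.V) hx
  have : s (φ.q x) = 0 := by rw [hS x hx, map_zero]
  exact this

theorem tr_line_smul (s : L →ₗ[K] K) (a : K) (z : L) :
    (tr s (line (algebraMap K L a * z))).Equiv (QF.smul a (tr s (line z))) := by
  refine equiv_of (φ := tr s (line (algebraMap K L a * z))) (ψ := QF.smul a (tr s (line z)))
    (LinearEquiv.refl K (tr s (line z)).V) ?_
  intro (x : L)
  have : a * s (z * (x * x)) = s (algebraMap K L a * z * (x * x)) := by
    rw [mul_assoc, ← Algebra.smul_def, map_smul, smul_eq_mul]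
  exact this

/-- identity map into the transfer of a line -/
noncomputable def trl (s : L →ₗ[K] K) (z : L) : L →ₗ[K] (tr s (line z)).V :=
  { toFun := fun x => (x : L)
    map_add' := fun _ _ => rfl
    map_smul' := fun a x => (Algebra.smul_def a x) }

theorem trl_inj (s : L →ₗ[K] K) (z : L) : Function.Injective (trl s z) := fun _ _ h => h

theorem trl_q (s : L →ₗ[K] K) (z x : L) : (tr s (line z)).q (trl s z x) = s (z * (x * x)) := rfl

/-- `m` diagonalizes the transfer of `⟨z⟩` -/
def TrL (s : L →ₗ[K] K) (z : L) (m : List K) : Prop := (tr s (line z)).Equiv (ofList m)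

theorem tr_ofList {s : L →ₗ[K] K} {z : L} {m : List K} (h : TrL s z m) (l : List K) :
    (tr s (ofList (l.map fun a => algebraMap K L a * z))).Equiv
      (ofList (l.flatMap fun a => m.map (a * ·))) := by
  induction l with
  | nil => exact tr_zero s
  | cons a l ih =>
    rw [List.map_cons, List.flatMap_cons]
    refine equiv_trans (tr_add s _ _) (equiv_trans (add_congr ?_ ih) (equiv_symm (ofList_append _ _)))
    exact equiv_trans (tr_line_smul s a z) (equiv_trans (smul_congr a h) (ofList_smul a m))

theorem flat_nz {m l : List K} (hm : NZ m) (hl : NZ l) : NZ (l.flatMap fun a => m.map (a * ·)) := by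
  intro x hx
  obtain ⟨a, ha, hx⟩ := List.mem_flatMap.1 hx
  exact (hm.map (hl a ha)) x hx

theorem flat_cls {m : List K} (l : List K) :
    cls (l.flatMap fun a => m.map (a * ·)) = cls l * cls m := by
  induction l with
  | nil => simp [cls_nil]
  | cons a l ih => rw [List.flatMap_cons, cls_append, ih, cls_cons, cls_map]; ring

variable [NeZero (2 : K)] [NeZero (2 : L)]

theorem tr_nondeg {s : L →ₗ[K] K} (hs : s ≠ 0) {z : L} (hz : z ≠ 0) : (tr s (line z)).Nondeg := by
  rw [nondeg_iff]
  intro (x : L) hx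
  by_contra hne
  apply hs
  ext y
  have hx0 : (x : L) ≠ 0 := hne
  have h2 : (2 : L) ≠ 0 := NeZero.ne 2
  let y' : L := y / (2 * z * x)
  have h1 : polar (tr s (line z)).q x y' = s (polar (line z).q x y') := by
    simp only [polar, map_sub]; rfl
  have h3 := h1.symm.trans (hx y')
  rw [line_polar] at h3
  have h4 : 2 * z * (x * y') = y := by simp only [y']; field_simp
  rw [h4] at h3
  simpa using h3

theorem exists_TrL {s : L →ₗ[K] K} (hs : s ≠ 0) {z : L} (hz : z ≠ 0) : ∃ m, NZ m ∧ TrL s z m := by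
  obtain ⟨m, h1, h2⟩ := exists_list (tr_nondeg hs hz)
  exact ⟨m, h1, h2⟩

theorem transfer {s : L →ₗ[K] K} {z : L} (hz : z ≠ 0) {m1 m2 : List K} (h1 : NZ m1) (h2 : NZ m2)
    (t1 : TrL s 1 m1) (t2 : TrL s z m2) {x y : W K} (h : res L x + u z * res L y = 0) :
    x * cls m1 + y * cls m2 = 0 := by
  obtain ⟨l, hl, rfl⟩ := exists_cls x
  obtain ⟨l', hl', rfl⟩ := exists_cls y
  have e1 := tr_ofList t1 l
  have e2 := tr_ofList t2 l'
  simp only [mul_one] at e1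
  have hnz : NZ ((l.map (algebraMap K L)) ++ (l'.map (algebraMap K L)).map (z * ·)) :=
    NZ.append.2 ⟨hl.ext L, (hl'.ext L).map hz⟩
  have hl0 : Lag (ofList ((l.map (algebraMap K L)) ++ (l'.map (algebraMap K L)).map (z * ·))) := by
    apply lag_of_cls_zero hnz
    rw [cls_append, cls_map, ← res_cls, ← res_cls, h]
  have e3 : (l'.map (algebraMap K L)).map (z * ·) = l'.map fun a => algebraMap K L a * z := by
    rw [List.map_map]; apply List.map_congr_left; intro a _; simp [mul_comm]
  rw [e3] at hl0
  have h4 := tr_lag s (Lag.congr (ofList_append _ _) hl0)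
  have h5 := Lag.congr (equiv_trans (equiv_trans (tr_add s _ _) (add_congr e1 e2))
    (equiv_symm (ofList_append _ _))) h4
  have h6 := cls_zero_of_lag (NZ.append.2 ⟨flat_nz h1 hl, flat_nz h2 hl'⟩) h5
  rw [cls_append, flat_cls, flat_cls] at h6
  exact h6

end Transfer

section PB

variable {K L : Type} [Field K] [Field L] [Algebra K L] [FiniteDimensional K L]

/-- constant-coefficient functional of a power basis -/
noncomputable def pbs (pb : PowerBasis K L) : L →ₗ[K] K := pb.basis.coord ⟨0, pb.dim_pos⟩

theorem pbs_lt (pb : PowerBasis K L) {P : K[X]} (h : P.natDegree < pb.dim) :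
    pbs pb (aeval pb.gen P) = P.coeff 0 := by
  rw [aeval_eq_sum_range' h, map_sum, Finset.sum_eq_single_of_mem 0]
  · have : pb.gen ^ 0 = pb.basis ⟨0, pb.dim_pos⟩ := by rw [pb.basis_eq_pow]
    rw [this, map_smul, pbs, Basis.coord_apply, Basis.repr_self]
    simp
  · simp [pb.dim_pos]
  · intro i hi hne
    have hi' : i < pb.dim := Finset.mem_range.1 hi
    have : pb.gen ^ i = pb.basis ⟨i, hi'⟩ := by rw [pb.basis_eq_pow]
    rw [this, map_smul, pbs, Basis.coord_apply, Basis.repr_self]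
    rw [Finsupp.single_apply, if_neg]
    · simp
    · intro h; exact hne (by simpa using h)

theorem pbs_le (pb : PowerBasis K L) {P : K[X]} (h : P.natDegree ≤ pb.dim) :
    pbs pb (aeval pb.gen P) = P.coeff 0 - P.coeff pb.dim * (minpoly K pb.gen).coeff 0 := by
  have hm : (minpoly K pb.gen).natDegree = pb.dim := pb.natDegree_minpoly
  have hmon : (minpoly K pb.gen).Monic := minpoly.monic pb.isIntegral_gen
  have h1 : (P - C (P.coeff pb.dim) * minpoly K pb.gen).natDegree < pb.dim := by
    have hle : (P - C (P.coeff pb.dim) * minpoly K pb.gen).natDegree ≤ pb.dim := by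
      refine (natDegree_sub_le _ _).trans (max_le h ?_)
      exact (natDegree_C_mul_le _ _).trans hm.le
    refine lt_of_le_of_ne hle ?_
    intro heq
    have h0 : (P - C (P.coeff pb.dim) * minpoly K pb.gen).coeff pb.dim = 0 := by
      rw [coeff_sub, coeff_C_mul]
      have : (minpoly K pb.gen).coeff pb.dim = 1 := by rw [← hm]; exact hmon
      rw [this]; ring
    have h2 : (P - C (P.coeff pb.dim) * minpoly K pb.gen).leadingCoeff = 0 := by
      rw [leadingCoeff, heq, h0]
    rw [leadingCoeff_eq_zero] at h2
    rw [h2] at heq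
    simp at heq
    have := pb.dim_pos
    omega
  have h2 := pbs_lt pb h1
  rw [map_sub, map_mul, minpoly.aeval, mul_zero, sub_zero] at h2
  rw [h2]; simp

theorem pb_inj (pb : PowerBasis K L) {P : K[X]} (h : P.natDegree < pb.dim)
    (h0 : aeval pb.gen P = 0) : P = 0 := by
  by_contra hne
  have := natDegree_le_natDegree (minpoly.degree_le_of_ne_zero K pb.gen hne h0)
  rw [pb.natDegree_minpoly] at this
  omega

theorem finrank_degreeLT (k : ℕ) : finrank K (degreeLT K k) = k := by
  rw [(degreeLTEquiv K k).finrank_eq]; simp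

theorem natDegree_degreeLT {k : ℕ} (p : degreeLT K k) : (p : K[X]).natDegree ≤ k - 1 := by
  by_cases h : (p : K[X]) = 0
  · rw [h]; simp
  · have := (natDegree_lt_iff_degree_lt h).2 (mem_degreeLT.1 p.2)
    omega

theorem pbs_ne (pb : PowerBasis K L) : pbs pb ≠ 0 := by
  intro h
  have := pbs_lt pb (P := C 1) (by simpa using pb.dim_pos)
  rw [h] at this
  simp at this

/-- evaluation at the generator on polynomials of bounded degree -/
noncomputable def evl (pb : PowerBasis K L) (k : ℕ) : degreeLT K k →ₗ[K] L :=
  (aeval pb.gen).toLinearMap ∘ₗ (degreeLT K k).subtype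

theorem evl_apply (pb : PowerBasis K L) (k : ℕ) (p : degreeLT K k) :
    evl pb k p = aeval pb.gen (p : K[X]) := rfl

/-- coefficient functional -/
noncomputable def cfl (k i : ℕ) : degreeLT K k →ₗ[K] K :=
  (lcoeff K i) ∘ₗ (degreeLT K k).subtype

theorem cfl_apply (k i : ℕ) (p : degreeLT K k) : cfl k i p = (p : K[X]).coeff i := rfl

theorem evl_inj (pb : PowerBasis K L) {k : ℕ} (hk : k - 1 < pb.dim) : Function.Injective (evl pb k) := by
  rw [← LinearMap.ker_eq_bot, LinearMap.ker_eq_bot']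
  intro p hp
  have := natDegree_degreeLT p
  exact Subtype.ext (pb_inj pb (by omega) hp)

theorem finrank_tr_line (s : L →ₗ[K] K) (z : L) : finrank K (tr s (line z)).V = finrank K L := by
  rw [tr_finrank, finrank_line, mul_one]

/-- even degree: transfer of `⟨x⟩` is zero -/
theorem tr_gen_even (pb : PowerBasis K L) {k : ℕ} (hk : pb.dim = 2 * k) :
    Lag (tr (pbs pb) (line pb.gen)) := by
  have hpos := pb.dim_pos
  let g : degreeLT K k →ₗ[K] (tr (pbs pb) (line pb.gen)).V := trl _ _ ∘ₗ evl pb k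
  refine lag_of_inj g (fun p q h => evl_inj pb (by omega) (trl_inj (pbs pb) pb.gen h)) ?_ ?_
  · intro p
    have h1 : pbs pb (pb.gen * (aeval pb.gen (p : K[X]) * aeval pb.gen (p : K[X]))) = 0 := by
      have h2 := pbs_lt pb (P := X * ((p : K[X]) * (p : K[X]))) (by
        have := natDegree_degreeLT p
        have h3 := natDegree_mul_le (p := (X : K[X])) (q := ((p : K[X]) * (p : K[X])))
        have h4 := natDegree_mul_le (p := (p : K[X])) (q := (p : K[X]))
        rw [natDegree_X] at h3
        omega)
      simp only [map_mul, aeval_X] at h2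
      rw [h2]; simp
    exact h1
  · rw [finrank_tr_line, finrank_degreeLT, pb.finrank, hk]

theorem norm_pb (pb : PowerBasis K L) {k : ℕ} (hk : pb.dim = 2 * k) :
    Algebra.norm K pb.gen = (minpoly K pb.gen).coeff 0 := by
  rw [Algebra.PowerBasis.norm_gen_eq_coeff_zero_minpoly, hk]; simp

/-- even degree: transfer of `⟨1⟩` is `⟨1,-N⟩` -/
theorem tr_one_even (pb : PowerBasis K L) {k : ℕ} (hk : pb.dim = 2 * k) :
    Lag (QF.add (tr (pbs pb) (line 1)) (ofList [-1, Algebra.norm K pb.gen])) := by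
  have hpos := pb.dim_pos
  let g : degreeLT K (k + 1) →ₗ[K] ((tr (pbs pb) (line 1)).V × (K × (K × (Fin 0 → K)))) :=
    (trl _ _ ∘ₗ evl pb (k + 1)).prod ((cfl (k + 1) 0).prod ((cfl (k + 1) k).prod 0))
  let g' : degreeLT K (k + 1) →ₗ[K]
    (QF.add (tr (pbs pb) (line 1)) (ofList [-1, Algebra.norm K pb.gen])).V := g
  refine lag_of_inj g' ?_ ?_ ?_
  · intro p q h
    have h1 : g p = g q := h
    exact evl_inj pb (by omega) (trl_inj _ _ (congrArg Prod.fst h1))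
  · intro p
    have h1 : pbs pb (1 * (aeval pb.gen (p : K[X]) * aeval pb.gen (p : K[X]))) +
      ((-1) * ((p : K[X]).coeff 0 * (p : K[X]).coeff 0) +
        (Algebra.norm K pb.gen * ((p : K[X]).coeff k * (p : K[X]).coeff k) + 0)) = 0 := by
      have h5 : (p : K[X]).natDegree ≤ k := natDegree_degreeLT p
      have h2 := pbs_le pb (P := ((p : K[X]) * (p : K[X]))) (by
        have h4 := natDegree_mul_le (p := (p : K[X])) (q := (p : K[X]))
        omega)
      simp only [map_mul] at h2
      rw [one_mul, h2, norm_pb pb hk, hk, two_mul, coeff_mul_add_eq_of_natDegree_le h5 h5,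
        mul_coeff_zero]
      ring
    refine Eq.trans ?_ h1
    have h6 : (QF.zero : QF K).q 0 = 0 := QuadraticMap.map_zero _
    rw [← h6]
    rfl
  · rw [finrank_add, finrank_tr_line, finrank_degreeLT, pb.finrank, hk, finrank_ofList]
    simp; omega

/-- odd degree: transfer of `⟨1⟩` is `⟨1⟩` -/
theorem tr_one_odd (pb : PowerBasis K L) {k : ℕ} (hk : pb.dim = 2 * k + 1) :
    Lag (QF.add (tr (pbs pb) (line 1)) (ofList [-1])) := by
  have hpos := pb.dim_pos
  let g : degreeLT K (k + 1) →ₗ[K] ((tr (pbs pb) (line 1)).V × (K × (Fin 0 → K))) :=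
    (trl _ _ ∘ₗ evl pb (k + 1)).prod ((cfl (k + 1) 0).prod 0)
  let g' : degreeLT K (k + 1) →ₗ[K]
    (QF.add (tr (pbs pb) (line 1)) (ofList [-1])).V := g
  refine lag_of_inj g' ?_ ?_ ?_
  · intro p q h
    have h1 : g p = g q := h
    exact evl_inj pb (by omega) (trl_inj _ _ (congrArg Prod.fst h1))
  · intro p
    have h1 : pbs pb (1 * (aeval pb.gen (p : K[X]) * aeval pb.gen (p : K[X]))) +
      ((-1) * ((p : K[X]).coeff 0 * (p : K[X]).coeff 0) + 0) = 0 := by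
      have h5 : (p : K[X]).natDegree ≤ k := natDegree_degreeLT p
      have h2 := pbs_lt pb (P := ((p : K[X]) * (p : K[X]))) (by
        have h4 := natDegree_mul_le (p := (p : K[X])) (q := (p : K[X]))
        omega)
      simp only [map_mul] at h2
      rw [one_mul, h2, mul_coeff_zero]
      ring
    refine Eq.trans ?_ h1
    have h6 : (QF.zero : QF K).q 0 = 0 := QuadraticMap.map_zero _
    rw [← h6]
    rfl
  · rw [finrank_add, finrank_tr_line, finrank_degreeLT, pb.finrank, hk, finrank_ofList]
    simp; omega

variable [NeZero (2 : K)] [NeZero (2 : L)]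

theorem cls_of_TrL {s : L →ₗ[K] K} {z : L} {m n : List K} (hm : NZ m) (hn : NZ n) (h : TrL s z m)
    (hL : Lag (QF.add (tr s (line z)) (ofList n))) : cls m = - cls n := by
  have h1 := Lag.congr (equiv_trans (add_congr h (equiv_refl _)) (equiv_symm (ofList_append _ _))) hL
  have h2 := cls_zero_of_lag (NZ.append.2 ⟨hm, hn⟩) h1
  rw [cls_append] at h2
  linear_combination h2

theorem gen_ne_zero_even (pb : PowerBasis K L) {k : ℕ} (hk : pb.dim = 2 * k) : pb.gen ≠ 0 := by
  intro h
  have hpos := pb.dim_pos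
  have h1 := pb_inj pb (P := X) (by rw [natDegree_X]; omega) (by rw [aeval_X, h])
  exact X_ne_zero h1

theorem exists_tr_even (pb : PowerBasis K L) {k : ℕ} (hk : pb.dim = 2 * k) :
    ∃ m1 m2 : List K, NZ m1 ∧ NZ m2 ∧ TrL (pbs pb) 1 m1 ∧ TrL (pbs pb) pb.gen m2 ∧
      cls m1 = 1 - u (Algebra.norm K pb.gen) ∧ cls m2 = 0 := by
  have hx := gen_ne_zero_even pb hk
  obtain ⟨m1, h1, t1⟩ := exists_TrL (pbs_ne pb) (z := (1 : L)) one_ne_zero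
  obtain ⟨m2, h2, t2⟩ := exists_TrL (pbs_ne pb) hx
  refine ⟨m1, m2, h1, h2, t1, t2, ?_, ?_⟩
  · rw [cls_of_TrL h1 ?_ t1 (tr_one_even pb hk), cls_cons, cls_cons, cls_nil, u_neg_one]
    · ring
    · refine NZ.cons.2 ⟨by simp, NZ.cons.2 ⟨?_, NZ.nil⟩⟩
      rwa [Algebra.norm_ne_zero_iff]
  · exact cls_zero_of_lag h2 (Lag.congr t2 (tr_gen_even pb hk))

theorem transfer_even (pb : PowerBasis K L) {k : ℕ} (hk : pb.dim = 2 * k) {x y : W K}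
    (h : res L x + u pb.gen * res L y = 0) : (1 - u (Algebra.norm K pb.gen)) * x = 0 := by
  obtain ⟨m1, m2, h1, h2, t1, t2, c1, c2⟩ := exists_tr_even pb hk
  have := transfer (gen_ne_zero_even pb hk) h1 h2 t1 t2 h
  rw [c1, c2] at this
  linear_combination this

theorem transfer_odd (pb : PowerBasis K L) {k : ℕ} (hk : pb.dim = 2 * k + 1) {x : W K}
    (h : res L x = 0) : x = 0 := by
  obtain ⟨m1, h1, t1⟩ := exists_TrL (pbs_ne pb) (z := (1 : L)) one_ne_zero
  have := transfer (one_ne_zero) h1 h1 t1 t1 (x := x) (y := 0) (by rw [h]; simp)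
  rw [cls_of_TrL h1 ?_ t1 (tr_one_odd pb hk), cls_cons, cls_nil, u_neg_one] at this
  · linear_combination this
  · exact NZ.cons.2 ⟨by simp, NZ.nil⟩

end PB
end WQ

set_option linter.unusedSectionVars false
set_option linter.style.haveILetI false

namespace WQ

open QuadraticMap Module Polynomial
open scoped IntermediateField

theorem odd_inj {K : Type} [Field K] [NeZero (2 : K)] {L : Type} [Field L] [Algebra K L]
    [FiniteDimensional K L] [NeZero (2 : L)] (ho : Odd (finrank K L)) {y : W K}
    (h : res L y = 0) : y = 0 := by
  induction hn : finrank K L using Nat.strong_induction_on generalizing K with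
  | _ n ih =>
    by_cases h1 : finrank K L = 1
    · have ht : (Algebra.adjoin K {(1 : L)}) = ⊤ := by
        rw [eq_top_iff, ← Subalgebra.bot_eq_top_iff_finrank_eq_one.2 h1]
        exact bot_le
      let pb := PowerBasis.ofAdjoinEqTop (IsIntegral.of_finite K (1 : L)) ht
      have : pb.dim = 2 * 0 + 1 := by rw [← pb.finrank, h1]
      exact transfer_odd pb this h
    · have hne : (⊥ : Subalgebra K L) ≠ ⊤ := fun h' => h1 (Subalgebra.bot_eq_top_iff_finrank_eq_one.1 h')
      obtain ⟨x, hx⟩ : ∃ x : L, x ∉ (⊥ : Subalgebra K L) := by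
        by_contra hcon
        push Not at hcon
        exact hne (eq_top_iff.2 fun x _ => hcon x)
      have hmul := finrank_mul_finrank K K⟮x⟯ L
      have : NeZero (2 : K⟮x⟯) := neZero_ext (K := K) K⟮x⟯
      rw [← hmul] at ho
      obtain ⟨o1, o2⟩ := Nat.odd_mul.1 ho
      have hgt : finrank K K⟮x⟯ ≠ 1 := by
        intro h2
        rw [IntermediateField.finrank_eq_one_iff, IntermediateField.adjoin_simple_eq_bot_iff] at h2
        apply hx
        rw [IntermediateField.mem_bot] at h2
        exact Algebra.mem_bot.2 h2
      have hpos : 0 < finrank K⟮x⟯ L := finrank_pos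
      have hpos' : 0 < finrank K K⟮x⟯ := finrank_pos
      have h3 : res K⟮x⟯ y = 0 := by
        refine ih (finrank K⟮x⟯ L) ?_ o2 ?_ rfl
        · rw [← hn, ← hmul]; nlinarith [show 2 ≤ finrank K K⟮x⟯ by omega]
        · rw [res_res, h]
      let pb := IntermediateField.adjoin.powerBasis (IsIntegral.of_finite K x)
      obtain ⟨k, hk⟩ := o1
      rw [pb.finrank] at hk
      exact transfer_odd pb hk h3

/-- the norm principle -/
theorem norm_principle {K : Type} [Field K] [NeZero (2 : K)] {L : Type} [Field L] [Algebra K L]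
    [FiniteDimensional K L] [NeZero (2 : L)] {y : W K} (h : res L y = 0) {x : L} (hx : x ≠ 0) :
    u (Algebra.norm K x) * y = y := by
  have : NeZero (2 : K⟮x⟯) := neZero_ext (K := K) K⟮x⟯
  let pb := IntermediateField.adjoin.powerBasis (IsIntegral.of_finite K x)
  have hg : pb.gen = IntermediateField.AdjoinSimple.gen K x :=
    IntermediateField.adjoin.powerBasis_gen _
  have hgx : algebraMap K⟮x⟯ L pb.gen = x := by
    rw [hg]; exact IntermediateField.AdjoinSimple.algebraMap_gen K x
  have hN : Algebra.norm K x = (Algebra.norm K pb.gen) ^ finrank K⟮x⟯ L := by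
    rw [← map_pow, ← Algebra.norm_algebraMap, hgx, Algebra.norm_norm]
  have hg0 : pb.gen ≠ 0 := by
    intro h0; rw [h0, map_zero] at hgx; exact hx hgx.symm
  have hN0 : Algebra.norm K pb.gen ≠ 0 := Algebra.norm_ne_zero_iff.2 hg0
  rcases Nat.even_or_odd (finrank K⟮x⟯ L) with ⟨e, he⟩ | ho
  · rw [hN, he, pow_add, u_sq (pow_ne_zero _ hN0), one_mul]
  · have h3 : res K⟮x⟯ y = 0 := odd_inj ho (by rw [res_res, h])
    have hu : u (Algebra.norm K x) = u (Algebra.norm K pb.gen) := by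
      obtain ⟨e, he⟩ := ho
      rw [hN, he, pow_succ, two_mul, pow_add, u_mul, u_sq (pow_ne_zero _ hN0), one_mul]
    rw [hu]
    rcases Nat.even_or_odd' pb.dim with ⟨k, hk | hk⟩
    · have := transfer_even pb hk (x := y) (y := 0) (by rw [h3]; simp)
      linear_combination -this
    · have := transfer_odd pb hk h3
      rw [this, mul_zero]

end WQ

set_option linter.unusedSectionVars false
set_option linter.style.haveILetI false

namespace WQ

open QuadraticMap Module Polynomial

section QE

/-- `M = K(r)` is a quadratic extension with `r² = b` -/
structure QE {K : Type} [Field K] (b : K) (M : Type) [Field M] [Algebra K M] (r : M) : Prop where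
  sq : r * r = algebraMap K M b
  span : ∀ x : M, ∃ p q : K, x = algebraMap K M p + algebraMap K M q * r
  nsq : ∀ t : K, t * t ≠ b

theorem exists_QE {K : Type} [Field K] {b : K} (hb : ∀ t : K, t * t ≠ b) :
    ∃ (M : Type) (_ : Field M) (_ : Algebra K M) (r : M), QE b M r := by
  have hirr : Irreducible (X ^ 2 - C b : K[X]) := by
    refine X_pow_sub_C_irreducible_of_prime Nat.prime_two ?_
    intro t ht
    exact hb t (by rw [← ht]; ring)
  haveI : Fact (Irreducible (X ^ 2 - C b : K[X])) := ⟨hirr⟩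
  have hmon : (X ^ 2 - C b : K[X]).Monic := monic_X_pow_sub_C b two_ne_zero
  refine ⟨AdjoinRoot (X ^ 2 - C b : K[X]), inferInstance, inferInstance, AdjoinRoot.root _, ?_, ?_, hb⟩
  · have h := AdjoinRoot.eval₂_root (X ^ 2 - C b : K[X])
    simp only [eval₂_sub, eval₂_pow, eval₂_X, eval₂_C] at h
    rw [← pow_two, AdjoinRoot.algebraMap_eq]
    linear_combination h
  · intro x
    obtain ⟨P, rfl⟩ := AdjoinRoot.mk_surjective x
    rw [← modByMonic_add_div P (X ^ 2 - C b)]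
    set R := P %ₘ (X ^ 2 - C b)
    have hR : R.natDegree < 2 := by
      have := natDegree_modByMonic_lt P hmon (by
        intro h
        have h2 : (X ^ 2 - C b : K[X]).natDegree = 2 := natDegree_X_pow_sub_C
        rw [h] at h2; simp at h2)
      rwa [natDegree_X_pow_sub_C] at this
    refine ⟨R.coeff 0, R.coeff 1, ?_⟩
    rw [map_add, map_mul, AdjoinRoot.mk_self, zero_mul, add_zero]
    conv_lhs => rw [R.as_sum_range' 2 hR]
    simp [Finset.sum_range_succ, ← C_mul_X_pow_eq_monomial, AdjoinRoot.algebraMap_eq]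

variable {K : Type} [Field K] {b : K} {M : Type} [Field M] [Algebra K M] {r : M}

theorem QE.uniq (h : QE b M r) {p q : K} (h0 : algebraMap K M p + algebraMap K M q * r = 0) :
    p = 0 ∧ q = 0 := by
  have hq : q = 0 := by
    by_contra hq
    apply h.nsq (p / q)
    apply (algebraMap K M).injective
    have hq' : algebraMap K M q ≠ 0 := (_root_.map_ne_zero _).2 hq
    have hr : r = - (algebraMap K M p / algebraMap K M q) := by
      field_simp; linear_combination h0
    rw [← h.sq, hr]; simp
  subst hq
  simpa using h0

theorem QE.uniq' (h : QE b M r) {p q p' q' : K}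
    (h0 : algebraMap K M p + algebraMap K M q * r = algebraMap K M p' + algebraMap K M q' * r) :
    p = p' ∧ q = q' := by
  have := h.uniq (p := p - p') (q := q - q') (by rw [map_sub, map_sub]; linear_combination h0)
  exact ⟨sub_eq_zero.1 this.1, sub_eq_zero.1 this.2⟩

theorem QE.gen (h : QE b M r) (p : K) {q : K} (hq : q ≠ 0) :
    ∃ pb : PowerBasis K M, pb.gen = algebraMap K M p + algebraMap K M q * r ∧ pb.dim = 2 * 1 ∧
      minpoly K pb.gen = X ^ 2 + (C (-(2 * p)) * X + C (p * p - b * (q * q))) := by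
  set z := algebraMap K M p + algebraMap K M q * r with hz
  have hq' : algebraMap K M q ≠ 0 := (_root_.map_ne_zero _).2 hq
  set P : K[X] := X ^ 2 + (C (-(2 * p)) * X + C (p * p - b * (q * q))) with hP
  have hdeg : (C (-(2 * p)) * X + C (p * p - b * (q * q)) : K[X]).natDegree < 2 := by
    have := natDegree_linear_le (a := -(2 * p)) (b := p * p - b * (q * q)); omega
  have hmon : P.Monic := by
    apply monic_X_pow_add
    exact (degree_le_natDegree).trans_lt (by exact_mod_cast hdeg)
  have hPd : P.natDegree = 2 := by
    rw [hP, natDegree_add_eq_left_of_natDegree_lt, natDegree_X_pow]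
    rwa [natDegree_X_pow]
  have hev : aeval z P = 0 := by
    simp only [hP, map_add, map_mul, map_pow, aeval_X, aeval_C, map_neg, map_sub, map_ofNat]
    rw [hz, ← h.sq]; ring
  have hzInt : IsIntegral K z := ⟨P, hmon, by rwa [← aeval_def]⟩
  have hz' : z ∉ (algebraMap K M).range := by
    rintro ⟨c, hc⟩
    have h1 := h.uniq' (p := p) (q := q) (p' := c) (q' := 0) (by rw [← hz, hc]; simp)
    exact hq h1.2
  have h2 : 2 ≤ (minpoly K z).natDegree := (minpoly.two_le_natDegree_iff hzInt).2 hz'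
  have hmin : minpoly K z = P := by
    refine (eq_of_monic_of_dvd_of_natDegree_le (minpoly.monic hzInt) hmon (minpoly.dvd K z hev) ?_).symm
    omega
  have hadj : Algebra.adjoin K {z} = ⊤ := by
    rw [eq_top_iff]
    intro x _
    obtain ⟨p', q', rfl⟩ := h.span x
    have hzm : z ∈ Algebra.adjoin K {z} := Algebra.subset_adjoin rfl
    have hr : r = (algebraMap K M q⁻¹) * (z - algebraMap K M p) := by
      rw [hz, map_inv₀]; field_simp; ring
    have hrm : r ∈ Algebra.adjoin K {z} := by
      rw [hr]
      exact mul_mem (Subalgebra.algebraMap_mem _ _) (sub_mem hzm (Subalgebra.algebraMap_mem _ _))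
    exact add_mem (Subalgebra.algebraMap_mem _ _) (mul_mem (Subalgebra.algebraMap_mem _ _) hrm)
  have hg : (PowerBasis.ofAdjoinEqTop hzInt hadj).gen = z := PowerBasis.ofAdjoinEqTop_gen hzInt hadj
  refine ⟨PowerBasis.ofAdjoinEqTop hzInt hadj, hg, ?_, ?_⟩
  · rw [← PowerBasis.natDegree_minpoly, hg, hmin, hPd]
  · rw [hg, hmin]

theorem QE.finite (h : QE b M r) : FiniteDimensional K M := by
  obtain ⟨pb, -⟩ := h.gen 0 one_ne_zero
  exact pb.finite

theorem QE.norm (h : QE b M r) (p : K) {q : K} (hq : q ≠ 0) :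
    Algebra.norm K (algebraMap K M p + algebraMap K M q * r) = p * p - b * (q * q) := by
  haveI := h.finite
  obtain ⟨pb, h1, h2, h3⟩ := h.gen p hq
  rw [← h1, norm_pb pb h2, h3]; simp

theorem QE.finrank (h : QE b M r) : finrank K M = 2 := by
  haveI := h.finite
  obtain ⟨pb, h1, h2, h3⟩ := h.gen 0 one_ne_zero
  rw [pb.finrank, h2]

variable [NeZero (2 : K)] [NeZero (2 : M)]

theorem QE.transfer (h : QE b M r) {z : M} (hz : ∀ p, z ≠ algebraMap K M p) {x y : W K}
    (h0 : res M x + u z * res M y = 0) : (1 - u (Algebra.norm K z)) * x = 0 := by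
  haveI := h.finite
  obtain ⟨p, q, rfl⟩ := h.span z
  have hq : q ≠ 0 := by rintro rfl; exact hz p (by simp)
  obtain ⟨pb, h1, h2, h3⟩ := h.gen p hq
  rw [← h1] at h0 ⊢
  exact transfer_even pb h2 h0

/-- values over a quadratic extension -/
theorem q_lemma (h : QE b M r) (l : List K) (x : (ofList (l.map (algebraMap K M))).V) :
    ∃ v v' : (ofList l).V, (ofList (l.map (algebraMap K M))).q x =
      algebraMap K M ((ofList l).q v + b * (ofList l).q v') +
        algebraMap K M (polar (ofList l).q v v') * r ∧ (x ≠ 0 → v ≠ 0 ∨ v' ≠ 0) := by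
  induction l with
  | nil =>
    have hx : x = 0 := zero_V_sub (K := M) x
    subst hx
    refine ⟨0, 0, ?_, fun h => absurd rfl h⟩
    rw [QuadraticMap.map_zero, QuadraticMap.map_zero, polar_zero_left]; simp
  | cons a l ih =>
    obtain ⟨(t : M), (y : (ofList (l.map (algebraMap K M))).V)⟩ := x
    obtain ⟨v, v', h1, h2⟩ := ih y
    obtain ⟨p, q, ht⟩ := h.span t
    let V : (ofList (a :: l)).V := ((p, v) : K × (ofList l).V)
    let V' : (ofList (a :: l)).V := ((q, v') : K × (ofList l).V)
    refine ⟨V, V', ?_, ?_⟩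
    · have e1 : (ofList ((a :: l).map (algebraMap K M))).q ((t, y) : M × _) =
        algebraMap K M a * (t * t) + (ofList (l.map (algebraMap K M))).q y := rfl
      have e2 : (ofList (a :: l)).q V = a * (p * p) + (ofList l).q v := rfl
      have e3 : (ofList (a :: l)).q V' = a * (q * q) + (ofList l).q v' := rfl
      have e4 : polar (ofList (a :: l)).q V V' = 2 * a * (p * q) + polar (ofList l).q v v' := by
        have := add_polar (line a) (ofList l) (p : K) (q : K) v v'
        rw [line_polar] at this
        exact this
      refine e1.trans ?_
      rw [h1, e2, e3, e4, ht]
      simp only [map_add, map_mul, map_ofNat, ← h.sq]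
      ring
    · intro hne
      by_contra hcon
      push Not at hcon
      apply hne
      have a1 : p = 0 := congrArg Prod.fst hcon.1
      have a2 : v = 0 := congrArg Prod.snd hcon.1
      have a3 : q = 0 := congrArg Prod.fst hcon.2
      have a4 : v' = 0 := congrArg Prod.snd hcon.2
      have a5 : y = 0 := by
        by_contra hy
        rcases h2 hy with h | h
        · exact h a2
        · exact h a4
      have a6 : t = 0 := by rw [ht, a1, a3]; simp
      exact Prod.ext a6 a5

theorem QE.isot (h : QE b M r) {l : List K} (hl : NZ l) (ha : ¬ Isot l)
    (hi : Isot (l.map (algebraMap K M))) :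
    ∃ c l', c ≠ 0 ∧ NZ l' ∧ Iso l (c :: -(b * c) :: l') := by
  obtain ⟨x, hx, hq⟩ := hi
  obtain ⟨v, v', h1, h2⟩ := q_lemma h l x
  rw [h1] at hq
  obtain ⟨h3, h4⟩ := h.uniq hq
  have hc : (ofList l).q v' ≠ 0 := by
    intro h0
    have hv' : v' = 0 := by
      by_contra hne; exact ha ⟨v', hne, h0⟩
    have hv : v = 0 := by
      by_contra hne; exact ha ⟨v, hne, by simpa [h0] using h3⟩
    rcases h2 hx with h | h
    · exact h hv
    · exact h hv'
  have hb : b ≠ 0 := fun h0 => h.nsq 0 (by rw [h0]; ring)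
  obtain ⟨ψ, hψ, he, hr⟩ := split_off (Nondeg.ofList hl) v' hc
  have hr1 := hr v (by rw [polar_comm]; exact h4)
  obtain ⟨m, hm, hm'⟩ := exists_list hψ
  have hr2 : Rep m ((ofList l).q v) := RepF.congr hm' hr1
  have hv : (ofList l).q v = -(b * (ofList l).q v') := by linear_combination h3
  rw [hv] at hr2
  obtain ⟨m', hm1, hm2⟩ := rep_split hm (neg_ne_zero.2 (mul_ne_zero hb hc)) hr2
  exact ⟨_, m', hc, hm1, equiv_trans he (add_congr (equiv_refl _) (equiv_trans hm' hm2))⟩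

theorem QE.rep (h : QE b M r) {l : List K} (hl : NZ l) {e : K}
    (hi : Rep (l.map (algebraMap K M)) (algebraMap K M e)) :
    (∃ y, Rep l y ∧ e = b * y) ∨
    ∃ x y l', x ≠ 0 ∧ NZ l' ∧ Iso l (x :: l') ∧ Rep l' y ∧ e = x + b * y := by
  obtain ⟨X, hX⟩ := hi
  obtain ⟨v, v', h1, -⟩ := q_lemma h l X
  rw [hX] at h1
  obtain ⟨h3, h4⟩ := h.uniq' (p := e) (q := 0) ((by rw [map_zero, zero_mul, add_zero] :
    algebraMap K M e + algebraMap K M 0 * r = algebraMap K M e).trans h1)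
  by_cases hx : (ofList l).q v = 0
  · left
    exact ⟨_, ⟨v', rfl⟩, by rw [h3, hx, zero_add]⟩
  · right
    obtain ⟨ψ, hψ, he, hr⟩ := split_off (Nondeg.ofList hl) v hx
    have hr1 := hr v' h4.symm
    obtain ⟨m, hm, hm'⟩ := exists_list hψ
    exact ⟨_, (ofList l).q v', m, hx, hm, equiv_trans he (add_congr (equiv_refl _) hm'),
      RepF.congr hm' hr1, h3⟩

end QE

section ZeroN

/-- all `N`-fold Pfister forms are hyperbolic -/
def ZeroN (M : Type) [Field M] (N : ℕ) : Prop := ∀ s : List M, NZ s → s.length = N → pf s = 0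

theorem ZeroN.ge {M : Type} [Field M] {N : ℕ} (h : ZeroN M N) {s : List M} (hs : NZ s)
    (hN : N ≤ s.length) : pf s = 0 := by
  rw [← List.take_append_drop N s, pf_append, h (s.take N), zero_mul]
  · exact fun a ha => hs a (List.mem_of_mem_take ha)
  · simp [hN]

variable {M : Type} [Field M] [NeZero (2 : M)] {b : M} {M' : Type} [Field M'] [Algebra M M']
  [NeZero (2 : M')] {r : M'}

theorem zeroN_one (h : QE b M' r) {N : ℕ} (hZ : ZeroN M N) {t : List M} (ht : NZ t)
    (hN : t.length + 1 = N) {z : M'} (hz : z ≠ 0) : (1 - u z) * res M' (pf t) = 0 := by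
  haveI := h.finite
  obtain ⟨p, q, hpq⟩ := h.span z
  have hsc : ∀ k : M, k ≠ 0 → u (algebraMap M M' k) * res M' (pf t) = res M' (pf t) := by
    intro k hk
    have h1 := hZ (k :: t) (NZ.cons.2 ⟨hk, ht⟩) (by simpa using hN)
    have h2 := congrArg (res M') h1
    rw [pf_cons, map_mul, map_sub, map_one, res_u, map_zero] at h2
    linear_combination -h2
  by_cases hq : q = 0
  · subst hq
    have hz' : z = algebraMap M M' p := by rw [hpq]; simp
    have hp : p ≠ 0 := by rintro rfl; exact hz (by rw [hz']; simp)
    rw [hz']; linear_combination -(hsc p hp)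
  · obtain ⟨pb, h1, h2, h3⟩ := h.gen p hq
    rw [← hpq] at h1
    obtain ⟨m1, m2, n1, n2, t1, t2, c1, c2⟩ := exists_tr_even pb h2
    have e1 := tr_ofList t1 (pl t)
    simp only [mul_one] at e1
    have hcl : cls ((pl t).flatMap fun a => m1.map (a * ·)) = 0 := by
      rw [flat_cls, pl_cls, c1]
      have hn : Algebra.norm M pb.gen ≠ 0 := by rw [Algebra.norm_ne_zero_iff, h1]; exact hz
      have := hZ (Algebra.norm M pb.gen :: t) (NZ.cons.2 ⟨hn, ht⟩) (by simpa using hN)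
      rw [pf_cons] at this
      linear_combination this
    have hlag := Lag.congr (equiv_symm e1) (lag_of_cls_zero (flat_nz n1 (pl_nz ht)) hcl)
    have hfin : 0 < finrank M (tr (pbs pb) (ofList ((pl t).map (algebraMap M M')))).V := by
      rw [tr_finrank, finrank_ofList, List.length_map, pl_length]
      exact Nat.mul_pos finrank_pos (by positivity)
    obtain ⟨S, hS, hd⟩ := hlag
    have hSne : S ≠ ⊥ := by
      rintro rfl
      exact absurd (hfin.trans_le hd) (by simp)
    obtain ⟨(v : (ofList ((pl t).map (algebraMap M M'))).V), hv, hv0⟩ := Submodule.exists_mem_ne_zero_of_ne_bot hSne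
    have hv0' : v ≠ 0 := hv0
    have hsv : pbs pb ((ofList ((pl t).map (algebraMap M M'))).q v) = 0 := hS v hv
    obtain ⟨k, hk⟩ : ∃ k : M, (ofList ((pl t).map (algebraMap M M'))).q v = algebraMap M M' k * z := by
      obtain ⟨p', q', hy⟩ := h.span ((ofList ((pl t).map (algebraMap M M'))).q v)
      have hq' : algebraMap M M' q ≠ 0 := (_root_.map_ne_zero _).2 hq
      set a := p' - q' / q * p
      set k := q' / q
      have hy2 : (ofList ((pl t).map (algebraMap M M'))).q v = aeval pb.gen (C a + C k * X) := by
        rw [hy, map_add, map_mul, aeval_C, aeval_C, aeval_X, h1, hpq]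
        simp only [a, k, map_sub, map_mul, map_div₀]
        field_simp; ring
      have hd : (C a + C k * X : M[X]).natDegree < pb.dim := by
        rw [add_comm, h2]
        have := natDegree_linear_le (a := k) (b := a); omega
      rw [hy2, pbs_lt pb hd] at hsv
      have ha : a = 0 := by simpa using hsv
      refine ⟨k, ?_⟩
      rw [hy2, ha, map_add, map_mul, aeval_C, aeval_C, aeval_X, h1]; simp
    rw [res_pf]
    by_cases hk0 : k = 0
    · have : Isot ((pl t).map (algebraMap M M')) := ⟨v, hv0', by rw [hk, hk0]; simp⟩
      rw [pl_ext] at this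
      rw [pf_isot (ht.ext M') this, mul_zero]
    · have hr : Rep ((pl t).map (algebraMap M M')) (algebraMap M M' k * z) := ⟨v, hk⟩
      rw [pl_ext] at hr
      have h4 := pf_round (ht.ext M') (mul_ne_zero ((_root_.map_ne_zero _).2 hk0) hz) hr
      have h5 := hsc k hk0
      rw [res_pf] at h5
      rw [u_mul] at h4
      linear_combination (-1 : W M') * h4 + u z * h5

theorem zeroN_up (h : QE b M' r) {N : ℕ} (hZ : ZeroN M N) (k : ℕ) : ∀ {s : List M'} {t : List M},
    NZ s → NZ t → s.length = k → s.length + t.length = N → pf s * res M' (pf t) = 0 := by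
  induction k with
  | zero =>
    intro s t hs ht hk hN
    rw [List.length_eq_zero_iff] at hk
    subst hk
    rw [hZ t ht (by simpa using hN), map_zero, mul_zero]
  | succ k ih =>
    intro s t hs ht hk hN
    match s, hs, hk, hN with
    | [z], hs, hk, hN =>
      rw [pf_cons, pf_nil, mul_one]
      exact zeroN_one h hZ ht (by simp at hN; omega) (NZ.cons.1 hs).1
    | x :: y :: s, hs, hk, hN =>
      obtain ⟨hx, hs'⟩ := NZ.cons.1 hs
      obtain ⟨hy, hs0⟩ := NZ.cons.1 hs'
      simp only [List.length_cons] at hk hN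
      have IH : ∀ (y : M') (p : M), y ≠ 0 → p ≠ 0 →
          (1 - u y) * pf s * ((1 - u (algebraMap M M' p)) * res M' (pf t)) = 0 := by
        intro y p hy hp
        have := ih (s := y :: s) (t := p :: t) (NZ.cons.2 ⟨hy, hs0⟩) (NZ.cons.2 ⟨hp, ht⟩)
          (by simp; omega) (by simp; omega)
        rw [pf_cons, pf_cons, map_mul, map_sub, map_one, res_u] at this
        exact this
      obtain ⟨p1, q1, h1⟩ := h.span x
      obtain ⟨p2, q2, h2⟩ := h.span y
      rw [pf_cons, pf_cons]
      by_cases hq1 : q1 = 0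
      · have hx' : x = algebraMap M M' p1 := by rw [h1, hq1]; simp
        have hp : p1 ≠ 0 := by rintro rfl; exact hx (by rw [hx']; simp)
        rw [hx']; linear_combination IH y p1 hy hp
      by_cases hq2 : q2 = 0
      · have hx' : y = algebraMap M M' p2 := by rw [h2, hq2]; simp
        have hp : p2 ≠ 0 := by rintro rfl; exact hy (by rw [hx']; simp)
        rw [hx']; linear_combination IH x p2 hx hp
      have hq1' : algebraMap M M' q1 ≠ 0 := (_root_.map_ne_zero _).2 hq1
      have hq2' : algebraMap M M' (-q2) ≠ 0 := (_root_.map_ne_zero _).2 (neg_ne_zero.2 hq2)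
      have hq2'' : algebraMap M M' q2 ≠ 0 := (_root_.map_ne_zero _).2 (hq2)
      set X := x / algebraMap M M' q1 with hX
      set Y := y / algebraMap M M' (-q2) with hY
      have hX0 : X ≠ 0 := div_ne_zero hx hq1'
      have hY0 : Y ≠ 0 := div_ne_zero hy hq2'
      have ux : u x = u (algebraMap M M' q1) * u X := by
        rw [← u_mul, hX, mul_div_cancel₀ _ hq1']
      have uy : u y = u (algebraMap M M' (-q2)) * u Y := by
        rw [← u_mul, hY, mul_div_cancel₀ _ hq2']
      have i1 := IH y q1 hy hq1
      have i2 := IH X (-q2) hX0 (neg_ne_zero.2 hq2)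
      have hsum : X + Y = algebraMap M M' (p1 / q1 - p2 / q2) := by
        rw [hX, hY, h1, h2]
        simp only [map_sub, map_div₀, map_neg]
        field_simp; ring
      have key : (1 - u X) * (1 - u Y) * (pf s * res M' (pf t)) = 0 := by
        by_cases hr : p1 / q1 - p2 / q2 = 0
        · rw [hr, map_zero] at hsum
          have : Y = -X := by linear_combination hsum
          rw [this, u_neg]
          linear_combination (-(pf s * res M' (pf t))) * u_mul_self hX0
        · have hr' : X + Y ≠ 0 := by rw [hsum]; exact (_root_.map_ne_zero _).2 hr
          have e1 := u_add hX0 hY0 hr'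
          have i3 := IH (-(X * Y)) _ (neg_ne_zero.2 (mul_ne_zero hX0 hY0)) hr
          rw [← hsum, u_neg, u_mul] at i3
          rw [u_mul, u_mul] at e1
          linear_combination i3 - (pf s * res M' (pf t)) * e1
      rw [uy] at i1
      rw [ux, uy]
      linear_combination i1 + u (algebraMap M M' q1) * i2 +
        u (algebraMap M M' q1) * u (algebraMap M M' (-q2)) * key

theorem ZeroN.up (h : QE b M' r) {N : ℕ} (hZ : ZeroN M N) : ZeroN M' N := by
  intro s hs hN
  have := zeroN_up h hZ N hs NZ.nil hN (by simpa using hN)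
  simpa [pf_nil] using this

end ZeroN
end WQ

set_option linter.unusedSectionVars false
set_option linter.style.haveILetI false

namespace WQ

open QuadraticMap Module Polynomial

section CN

/-- `I^N` vanishes over `K(√-1)`, on the level of Pfister forms -/
def CN (K : Type) [Field K] (N : ℕ) : Prop :=
  ∃ (M : Type) (_ : Field M) (_ : Algebra K M) (i : M), i * i = -1 ∧
    (∀ x : M, ∃ p q : K, x = algebraMap K M p + algebraMap K M q * i) ∧ ZeroN M N

variable {K : Type} [Field K]

theorem CN.mono {N N' : ℕ} (h : CN K N) (hN : N ≤ N') : CN K N' := by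
  obtain ⟨M, _, _, i, h1, h2, h3⟩ := h
  exact ⟨M, _, _, i, h1, h2, fun s hs hl => h3.ge hs (by omega)⟩

theorem CN.cases [NeZero (2 : K)] {N : ℕ} (h : CN K N) : ZeroN K N ∨
    ((∀ t : K, t * t ≠ -1) ∧
    ∃ (M : Type) (_ : Field M) (_ : Algebra K M) (i : M), QE (-1 : K) M i ∧ ZeroN M N) := by
  obtain ⟨M, _, _, i, h1, h2, h3⟩ := h
  by_cases ht : ∃ t : K, t * t = -1
  · left
    obtain ⟨t, ht⟩ := ht
    have hi : i = algebraMap K M t ∨ i = - algebraMap K M t := by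
      apply mul_self_eq_mul_self_iff.1
      rw [h1, ← map_mul, ht]; simp
    have hsur : ∀ x : M, ∃ p : K, algebraMap K M p = x := by
      intro x
      obtain ⟨p, q, rfl⟩ := h2 x
      rcases hi with hi | hi
      · exact ⟨p + q * t, by rw [hi]; simp⟩
      · exact ⟨p - q * t, by rw [hi]; simp; ring⟩
    have hone : finrank K M = 1 := by
      apply Subalgebra.bot_eq_top_iff_finrank_eq_one.1
      rw [eq_top_iff]
      intro x _
      exact Algebra.mem_bot.2 (hsur x)
    haveI : FiniteDimensional K M := FiniteDimensional.of_finrank_pos (by omega)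
    have : NeZero (2 : M) := neZero_ext (K := K) M
    intro s hs hl
    refine odd_inj (L := M) (by rw [hone]; exact odd_one) ?_
    rw [res_pf]
    exact h3 _ (hs.ext M) (by simpa using hl)
  · right
    push Not at ht
    exact ⟨ht, M, _, _, i, ⟨by rw [h1]; simp, h2, ht⟩, h3⟩

theorem QE.lift {b : K} {K1 : Type} [Field K1] [Algebra K K1] {r : K1} (h : QE b K1 r)
    (M : Type) [Field M] [Algebra K M] {ρ : M} (hρ : ρ * ρ = algebraMap K M b) :
    ∃ g : K1 →+* M, (∀ x, g (algebraMap K K1 x) = algebraMap K M x) ∧ g r = ρ := by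
  obtain ⟨pb, h1, h2, h3⟩ := h.gen 0 one_ne_zero
  have h1' : pb.gen = r := by rw [h1]; simp
  refine ⟨(pb.lift ρ (by
    rw [h3]; simp [← hρ]; ring)).toRingHom, ?_, ?_⟩
  · intro x
    exact AlgHom.commutes _ x
  · rw [← h1']
    exact pb.lift_gen _ _

theorem CN.up [NeZero (2 : K)] {N : ℕ} (hC : CN K N) {b : K} {K1 : Type} [Field K1] [Algebra K K1]
    {r : K1} (h : QE b K1 r) : CN K1 N := by
  obtain ⟨M, _, _, i, h1, h2, h3⟩ := hC
  by_cases hb : ∃ β : M, β * β = algebraMap K M b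
  · obtain ⟨β, hβ⟩ := hb
    obtain ⟨g, g1, g2⟩ := h.lift M hβ
    let alg : Algebra K1 M := g.toAlgebra
    refine ⟨M, _, alg, i, h1, ?_, h3⟩
    intro x
    obtain ⟨p, q, rfl⟩ := h2 x
    refine ⟨algebraMap K K1 p, algebraMap K K1 q, ?_⟩
    rw [← g1, ← g1]; rfl
  · push Not at hb
    obtain ⟨M1, _, _, ρ, hM⟩ := exists_QE hb
    have : NeZero (2 : M) := neZero_ext (K := K) M
    have : NeZero (2 : M1) := neZero_ext (K := M) M1
    let algK : Algebra K M1 := ((algebraMap M M1).comp (algebraMap K M)).toAlgebra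
    obtain ⟨g, g1, g2⟩ := h.lift M1 (ρ := ρ) hM.sq
    let alg : Algebra K1 M1 := g.toAlgebra
    refine ⟨M1, _, alg, algebraMap M M1 i, by rw [← map_mul, h1]; simp, ?_, h3.up hM⟩
    intro x
    obtain ⟨y, y', rfl⟩ := hM.span x
    obtain ⟨p, q, rfl⟩ := h2 y
    obtain ⟨p', q', rfl⟩ := h2 y'
    refine ⟨algebraMap K K1 p + algebraMap K K1 p' * r, algebraMap K K1 q + algebraMap K K1 q' * r, ?_⟩
    have ha : ∀ z : K1, @algebraMap K1 M1 _ _ alg z = g z := fun z => rfl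
    have hk : ∀ z : K, g (algebraMap K K1 z) = algebraMap M M1 (algebraMap K M z) := g1
    rw [ha, ha]
    simp only [map_add, map_mul, hk, g2]
    ring

variable [NeZero (2 : K)]

theorem isot_append_cases {l m : List K} (h : Isot (l ++ m)) :
    Isot l ∨ Isot m ∨ ∃ x, x ≠ 0 ∧ Rep l x ∧ Rep m (-x) := by
  obtain ⟨⟨v, w⟩, hv, hq⟩ := IsotF.congr (ofList_append _ _) h
  rw [add_q] at hq
  by_cases hx : (ofList l).q v = 0
  · by_cases hv0 : v = 0
    · right; left
      refine ⟨w, ?_, by simpa [hx] using hq⟩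
      rintro rfl
      exact hv (by rw [hv0]; rfl)
    · left; exact ⟨v, hv0, hx⟩
  · right; right
    exact ⟨_, hx, ⟨v, rfl⟩, ⟨w, by linear_combination hq⟩⟩

theorem isot_append_right {l m : List K} (h : Isot m) : Isot (l ++ m) := by
  obtain ⟨v, hv, hq⟩ := h
  refine IsotF.congr (equiv_symm (ofList_append l m)) ⟨((0 : (ofList l).V), v), ?_, ?_⟩
  · intro h0
    exact hv (congrArg Prod.snd h0)
  · rw [add_q, QuadraticMap.map_zero, zero_add, hq]

theorem sq_of_isot {c : K} (hc : c ≠ 0) (h : Isot [c, c]) : ∃ t : K, t * t = -1 := by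
  have hnz : NZ [c, c] := NZ.cons.2 ⟨hc, NZ.cons.2 ⟨hc, NZ.nil⟩⟩
  obtain ⟨l', h1, h2⟩ := isot_split hnz h
  have hl := h2.length
  have : l' = [] := by
    apply List.length_eq_zero_iff.1; simpa using hl.symm
  subst this
  have h3 := h2.cls hnz
  simp only [cls_cons, cls_nil, u_neg_one, u_one] at h3
  have h4 : Rep [-c] c := rep_of_cls_cons (l := [c]) (NZ.cons.2 ⟨hc, NZ.nil⟩)
    (NZ.cons.2 ⟨neg_ne_zero.2 hc, NZ.nil⟩) (by simp only [cls_cons, cls_nil, u_neg]; linear_combination h3)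
    (by simp) (rep_cons.2 ⟨1, 0, rep_zero _, by ring⟩)
  obtain ⟨t, y, hy, ht⟩ := rep_cons.1 h4
  rw [rep_nil] at hy
  subst hy
  refine ⟨t, ?_⟩
  have : c * (t * t + 1) = 0 := by linear_combination ht
  rcases mul_eq_zero.1 this with h | h
  · exact absurd h hc
  · linear_combination h

theorem pp_cls (s : List K) : pf s = 1 + cls (ppr [1] s) := by
  have h1 := cls_perm (plA_perm [1] s)
  rw [cls_append, cls_cons, cls_nil, u_one] at h1
  have h2 := pl_cls s
  rw [pl] at h2
  rw [← h2, h1]; ring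

theorem pp_length (s : List K) : (ppr [1] s).length + 1 = 2 ^ s.length := by
  have h1 := (plA_perm [1] s).length_eq
  have h2 := pl_length s
  rw [pl, h1] at h2
  simp at h2; omega

theorem pp_isot {s : List K} (hs : NZ s) (h : Isot (ppr [1] s)) : pf s = 0 :=
  pf_isot hs (Isot.iso (Iso.of_perm (plA_perm [1] s).symm) (isot_append_right h))

/-- splitting over a quadratic extension -/
theorem kill_split {b : K} {M : Type} [Field M] [Algebra K M] [NeZero (2 : M)] {r : M}
    (h : QE b M r) {s : List K} (hs : NZ s) (hne : pf s ≠ 0) (h0 : res M (pf s) = 0) :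
    ∃ γ, NZ γ ∧ γ.length + 1 = s.length ∧ pf s = (1 - u b) * pf γ := by
  have hb : b ≠ 0 := fun h0 => h.nsq 0 (by rw [h0]; ring)
  have han : ¬ Isot (pl s) := fun hi => hne (pf_isot hs hi)
  have hi : Isot ((pl s).map (algebraMap K M)) := by
    apply isot_of_lag
    · apply lag_of_cls_zero ((pl_nz hs).ext M)
      rw [← res_cls, pl_cls, h0]
    · intro hn
      have := congrArg List.length hn
      rw [List.length_map, pl_length] at this
      simp at this
  obtain ⟨c, l', hc, hl', hiso⟩ := h.isot (pl_nz hs) han hi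
  have hrep : Rep (pl s) c := Rep.iso hiso.symm (rep_cons.2 ⟨1, 0, rep_zero _, by ring⟩)
  have h1 := pf_round hs hc hrep
  have h2 := hiso.cls (pl_nz hs)
  rw [pl_cls, cls_cons, cls_cons, u_neg, u_mul] at h2
  have hcc := u_mul_self hc
  have hlen := hiso.length
  rw [pl_length, ← pp_length] at hlen
  simp only [List.length_cons] at hlen
  have h3 : Rep (ppr [1] s) (-b) := by
    refine rep_of_cls_cons (l := (-b) :: l'.map (c * ·)) (NZ.cons.2 ⟨neg_ne_zero.2 hb, hl'.map hc⟩)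
      (ppr_nz nz_one hs) ?_ (by simp; omega) (rep_cons.2 ⟨1, 0, rep_zero _, by ring⟩)
    have h4 := pp_cls s
    rw [cls_cons, cls_map, u_neg]
    linear_combination h4 + h1 - u c * h2 - (1 - u b) * hcc
  obtain ⟨γ, g1, g2, g3⟩ := pure_slot' hs (neg_ne_zero.2 hb) h3
  exact ⟨γ, g1, g2, by rw [g3, u_neg]; ring⟩

theorem half {N : ℕ} (hC : CN K N) (hN : 2 ≤ N) {s : List K} (hs : NZ s) (hl : s.length = N) :
    ∃ σ, NZ σ ∧ σ.length + 1 = N ∧ pf s = 2 * pf σ := by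
  by_cases h0 : pf s = 0
  · refine ⟨List.replicate (N - 1) 1, ?_, by simp; omega, ?_⟩
    · intro a ha
      rw [(List.mem_replicate.1 ha).2]; exact one_ne_zero
    · obtain ⟨k, hk⟩ : ∃ k, N - 1 = k + 1 := ⟨N - 2, by omega⟩
      rw [h0, hk, List.replicate_succ, pf_cons, u_one]; ring
  · rcases hC.cases with hZ | ⟨_, M, _, _, i, hQ, hZ⟩
    · exact absurd (hZ s hs hl) h0
    · have : NeZero (2 : M) := neZero_ext (K := K) M
      obtain ⟨γ, g1, g2, g3⟩ := kill_split hQ hs h0 (by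
        rw [res_pf]; exact hZ _ (hs.ext M) (by simpa using hl))
      refine ⟨γ, g1, by omega, ?_⟩
      rw [g3, u_neg_one]; ring

theorem w_kill {N : ℕ} (hC : CN K N) {w p q : K} (hw : w ≠ 0) (hpq : w = p * p + q * q) {γ : List K}
    (hγ : NZ γ) (hl : N ≤ γ.length + 1) : (1 - u w) * pf γ = 0 := by
  rcases hC.cases with hZ | ⟨_, M, _, _, i, hQ, hZ⟩
  · rw [← pf_cons]; exact hZ.ge (NZ.cons.2 ⟨hw, hγ⟩) (by simpa using hl)
  · have : NeZero (2 : M) := neZero_ext (K := K) M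
    by_cases hq : q = 0
    · have hp : p ≠ 0 := by rintro rfl; apply hw; rw [hpq, hq]; ring
      rw [hpq, hq, mul_zero, add_zero, u_sq hp]; ring
    · set z : M := algebraMap K M p + algebraMap K M q * i with hz
      have hn := hQ.norm p hq
      have hnz : ∀ p', z ≠ algebraMap K M p' := by
        intro p' hp'
        exact hq (hQ.uniq' (p := p) (q := q) (p' := p') (q' := 0) (by rw [← hz, hp']; simp)).2
      have hz0 : z ≠ 0 := by simpa using hnz 0
      have h1 : pf (z :: γ.map (algebraMap K M)) = 0 :=
        hZ.ge (NZ.cons.2 ⟨hz0, hγ.ext M⟩) (by simpa using hl)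
      rw [pf_cons, ← res_pf] at h1
      have h2 := hQ.transfer hnz (x := pf γ) (y := -pf γ) (by rw [map_neg]; linear_combination h1)
      rw [hz, hn] at h2
      rw [hpq]; simpa using h2

theorem rep_two {c x : K} (h : Rep [c, c] x) : ∃ p q, x = c * (p * p + q * q) := by
  obtain ⟨p, y, hy, rfl⟩ := rep_cons.1 h
  obtain ⟨q, y', hy', rfl⟩ := rep_cons.1 hy
  rw [rep_nil] at hy'
  exact ⟨p, q, by rw [hy']; ring⟩

theorem tors_one {N : ℕ} (hC : CN K N) {s : List K} (hs : NZ s) (hl : N ≤ s.length)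
    (h : 2 * pf s = 0) : pf s = 0 := by
  rcases hC.cases with hZ | ⟨hsq, -⟩
  · exact hZ.ge hs hl
  have hpp := ppr_nz nz_one hs
  have h1 : Isot ([1, 1] ++ ppr [1] s) := by
    refine isot_of_cls (m := ppr [1] s) (NZ.append.2 ⟨NZ.cons.2 ⟨one_ne_zero, nz_one⟩, hpp⟩) hpp ?_ (by simp)
    rw [cls_append, cls_append, cls_cons, cls_cons, cls_nil, u_one]
    have := pp_cls s
    linear_combination h - 2 * this
  rcases isot_append_cases h1 with h2 | h2 | ⟨x, hx, h2, h3⟩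
  · obtain ⟨t, ht⟩ := sq_of_isot one_ne_zero h2
    exact absurd ht (hsq t)
  · exact pp_isot hs h2
  · obtain ⟨p, q, hpq⟩ := rep_two h2
    rw [one_mul] at hpq
    obtain ⟨γ, g1, g2, g3⟩ := pure_slot' hs (neg_ne_zero.2 hx) h3
    have := w_kill hC hx hpq g1 (by omega)
    rw [g3, u_neg]; linear_combination this

theorem pf_neg_one (s : List K) : pf (-1 :: s) = 2 * pf s := by
  rw [pf_cons, u_neg_one]; ring

theorem nz_neg_one {s : List K} (hs : NZ s) : NZ (-1 :: s) :=
  NZ.cons.2 ⟨neg_ne_zero.2 one_ne_zero, hs⟩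

theorem tors_pow {N : ℕ} (hC : CN K N) (j : ℕ) : ∀ {s : List K}, NZ s → N ≤ s.length →
    2 ^ j * pf s = 0 → pf s = 0 := by
  induction j with
  | zero => intro s hs hl h; simpa using h
  | succ j ih =>
    intro s hs hl h
    have := ih (nz_neg_one hs) (by simp; omega) (by rw [pf_neg_one]; linear_combination h)
    rw [pf_neg_one] at this
    exact tors_one hC hs hl this

theorem exists_mul_list (s : List K) (hs : NZ s) (m : ℕ) :
    ∃ l, NZ l ∧ cls l = (m : W K) * pf s ∧ l.length = m * 2 ^ s.length := by
  induction m with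
  | zero => exact ⟨[], NZ.nil, by simp [cls_nil], by simp⟩
  | succ m ih =>
    obtain ⟨l, h1, h2, h3⟩ := ih
    refine ⟨pl s ++ l, NZ.append.2 ⟨pl_nz hs, h1⟩, ?_, ?_⟩
    · rw [cls_append, pl_cls, h2]; push_cast; ring
    · rw [List.length_append, pl_length, h3]; ring

theorem pow_two_pf (s : List K) (m : ℕ) : pf (List.replicate m (-1) ++ s) = 2 ^ m * pf s := by
  induction m with
  | zero => simp
  | succ m ih => rw [List.replicate_succ, List.cons_append, pf_neg_one, ih]; ring

theorem tors_int {s : List K} (hs : NZ s) {m : ℤ} (hm : m ≠ 0) (h : (m : W K) * pf s = 0) :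
    ∃ j : ℕ, 2 ^ j * pf s = 0 := by
  have h' : ((m.natAbs : ℕ) : W K) * pf s = 0 := by
    rcases Int.natAbs_eq m with he | he
    · rw [he] at h; simpa using h
    · rw [he] at h; simpa using h
  set k := m.natAbs with hk
  have hk0 : 0 < k := Int.natAbs_pos.2 hm
  have hlt : k < 2 ^ k := Nat.lt_two_pow_self
  obtain ⟨l, h1, h2, h3⟩ := exists_mul_list s hs (2 ^ k - k)
  have hnz : NZ (List.replicate k (-1) ++ s) := by
    refine NZ.append.2 ⟨?_, hs⟩
    intro a ha
    rw [(List.mem_replicate.1 ha).2]; exact neg_ne_zero.2 one_ne_zero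
  refine ⟨k, ?_⟩
  rw [← pow_two_pf]
  apply pf_isot hnz
  refine isot_of_cls (m := l.map ((-1) * ·)) (pl_nz hnz) (h1.map (neg_ne_zero.2 one_ne_zero)) ?_ ?_
  · rw [cls_append, cls_map, pl_cls, h2, pow_two_pf, u_neg_one, Nat.cast_sub hlt.le]
    push_cast
    linear_combination h'
  · rw [List.length_map, h3, pl_length, List.length_append, List.length_replicate, pow_add]
    exact Nat.mul_lt_mul_of_pos_right (by omega) (by positivity)

end CN
end WQ

set_option linter.unusedSectionVars false
set_option linter.style.haveILetI false

namespace WQ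

open QuadraticMap Module Polynomial

section Star

variable {K : Type} [Field K] [NeZero (2 : K)]

theorem rep_plA {A : List K} {x : K} (h : Rep A x) (t : List K) : Rep (plA A t) x :=
  Rep.iso (Iso.of_perm (plA_perm A t).symm) (rep_append.2 ⟨x, 0, h, rep_zero _, by ring⟩)

theorem ppr_cls (s t : List K) : pf s * pf t = pf s + cls (ppr (pl s) t) := by
  have h1 := cls_perm (plA_perm (pl s) t)
  rw [cls_append, plA_cls, pl_cls] at h1
  exact h1

theorem ppr_length (s t : List K) :
    (ppr (pl s) t).length + 2 ^ s.length = 2 ^ s.length * 2 ^ t.length := by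
  have h1 := (plA_perm (pl s) t).length_eq
  rw [List.length_append, plA_length, pl_length] at h1
  omega

theorem rep_ppr_cons {A : List K} {a x : K} {t : List K} (h : Rep (plA A t) x) :
    Rep (ppr A (a :: t)) (-a * x) :=
  rep_append.2 ⟨0, _, rep_zero _, rep_map h, by ring⟩

theorem rep_ppr_cons' {A : List K} {a x y : K} {t : List K} (h : Rep (plA A t) x)
    (h' : Rep (ppr A t) y) : Rep (ppr A (a :: t)) (y - a * x) :=
  rep_append.2 ⟨y, _, h', rep_map h, by ring⟩

theorem star_twist {N : ℕ} {w : K} (hw0 : w ≠ 0)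
    (hw : ∀ γ : List K, NZ γ → N ≤ γ.length + 1 → (1 - u w) * pf γ = 0)
    {s : List K} (hs : NZ s) {a : K} (ha : Rep (ppr [1] s) a) :
    ∃ s', NZ s' ∧ s'.length = s.length ∧ Rep (pl s') (1 + w * a) ∧
      ∀ t, NZ t → N ≤ s.length + t.length → pf s' * pf t = pf s * pf t := by
  by_cases ha0 : a = 0
  · subst ha0
    exact ⟨s, hs, rfl, by simpa using pl_rep_one s, fun t _ _ => rfl⟩
  · obtain ⟨s1, g1, g2, g3⟩ := pure_slot' hs ha0 ha
    refine ⟨(-(w * a)) :: s1, NZ.cons.2 ⟨neg_ne_zero.2 (mul_ne_zero hw0 ha0), g1⟩, by simpa using g2, ?_, ?_⟩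
    · refine rep_append.2 ⟨1, _, pl_rep_one s1, rep_map (pl_rep_one s1), by ring⟩
    · intro t ht hN
      have := hw (s1 ++ t) (NZ.append.2 ⟨g1, ht⟩) (by simp; omega)
      rw [pf_append] at this
      rw [pf_cons, g3, u_neg, u_mul]
      linear_combination (-u a) * this

theorem star_L {N : ℕ} {w : K} {L : Type} [Field L] [Algebra K L] [NeZero (2 : L)] {r : L}
    (hQ : QE w L r)
    (hw : ∀ γ : List K, NZ γ → N ≤ γ.length + 1 → (1 - u w) * pf γ = 0) (k : ℕ) :
    ∀ {s t1 t2 : List K}, NZ s → NZ t1 → NZ t2 → t1.length = k → t2.length = k →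
      N ≤ s.length + k → res L (pf s * pf t1) = res L (pf s * pf t2) →
      pf s * pf t1 = pf s * pf t2 := by
  have hw0 : w ≠ 0 := fun h0 => hQ.nsq 0 (by rw [h0]; ring)
  induction k with
  | zero =>
    intro s t1 t2 _ _ _ h1 h2 _ _
    rw [List.length_eq_zero_iff.1 h1, List.length_eq_zero_iff.1 h2]
  | succ k ih =>
    intro s t1 t2 hs ht1 ht2 hl1 hl2 hN hres
    match t1, ht1, hl1 with
    | a :: t1, ht1, hl1 =>
    obtain ⟨ha, ht1'⟩ := NZ.cons.1 ht1
    simp only [List.length_cons, Nat.add_right_cancel_iff] at hl1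
    have hna : -a ≠ 0 := neg_ne_zero.2 ha
    -- the reduction
    suffices hmain : ∃ s' γ, NZ s' ∧ NZ γ ∧ s'.length = s.length ∧ γ.length = k ∧
        pf s' * pf (a :: t1) = pf s * pf (a :: t1) ∧
        pf s * pf t2 = pf s' * ((1 - u a) * pf γ) by
      obtain ⟨s', γ, n1, n2, l1, l2, e1, e2⟩ := hmain
      have := ih (s := a :: s') (t1 := t1) (t2 := γ) (NZ.cons.2 ⟨ha, n1⟩) ht1' n2 hl1 l2
        (by simp; omega) (by
          have a1 : pf (a :: s') * pf t1 = pf s * pf (a :: t1) := by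
            rw [← e1, pf_cons, pf_cons]; ring
          have a2 : pf (a :: s') * pf γ = pf s * pf t2 := by
            rw [e2, pf_cons]; ring
          rw [a1, a2, hres])
      rw [pf_cons] at this
      rw [← e1, e2, pf_cons]
      linear_combination this
    have hrep : Rep ((ppr (pl s) t2).map (algebraMap K L)) (algebraMap K L (-a)) := by
      have hA := (pl_nz hs)
      refine rep_of_cls_cons (l := (ppr (pl s) (a :: t1)).map (algebraMap K L))
        ((ppr_nz hA ht1).ext L) ((ppr_nz hA ht2).ext L) ?_ ?_ ?_
      · rw [← res_cls, ← res_cls]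
        rw [ppr_cls s (a :: t1), ppr_cls s t2, map_add, map_add] at hres
        linear_combination hres
      · have h1 := ppr_length s (a :: t1)
        have h2 := ppr_length s t2
        rw [hl2] at h2
        simp only [List.length_cons, hl1] at h1
        simp only [List.length_map]; omega
      · rw [ppr_ext, pl_ext, List.map_cons]
        have := rep_ppr_cons (a := algebraMap K L a) (rep_plA (pl_rep_one (s.map (algebraMap K L)))
          (t1.map (algebraMap K L)))
        simpa using this
    rcases hQ.rep (ppr_nz (pl_nz hs) ht2) hrep with ⟨y, hy, hey⟩ | ⟨x, y, l', hx, hl', hiso, hy, hexy⟩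
    · have hy0 : y ≠ 0 := by rintro rfl; exact hna (by rw [hey]; ring)
      obtain ⟨γ, g1, g2, g3⟩ := pure_slot hs ht2 hy0 hy
      refine ⟨s, γ, hs, g1, rfl, by omega, rfl, ?_⟩
      have h1 := hw (s ++ γ) (NZ.append.2 ⟨hs, g1⟩) (by simp; omega)
      rw [pf_append] at h1
      have h2 : u a = - (u w * u y) := by
        rw [← u_mul, ← hey, u_neg]; ring
      rw [g3, h2]
      linear_combination u y * h1
    · have hxrep : Rep (ppr (pl s) t2) x :=
        Rep.iso hiso.symm (rep_cons.2 ⟨1, 0, rep_zero _, by ring⟩)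
      obtain ⟨γ, g1, g2, g3⟩ := pure_slot hs ht2 hx hxrep
      have hnx : -x ≠ 0 := neg_ne_zero.2 hx
      have hxs : NZ (-x :: s) := NZ.cons.2 ⟨hnx, hs⟩
      have hyrep : Rep ((ppr [1] s).map (x * ·) ++ ppr (pl (-x :: s)) γ) y := by
        refine rep_of_cls_cons hl' (NZ.append.2 ⟨(ppr_nz nz_one hs).map hx,
          ppr_nz (pl_nz hxs) g1⟩) ?_ ?_ hy
        · have a1 := hiso.cls (ppr_nz (pl_nz hs) ht2)
          have a2 := ppr_cls s t2
          have a3 := ppr_cls (-x :: s) γ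
          have a4 := pp_cls s
          rw [cls_cons] at a1
          rw [pf_cons, u_neg] at a3
          rw [cls_append, cls_map]
          linear_combination u x * a4 + a3 - a1 - a2 + g3
        · have a1 := hiso.length
          have a2 := ppr_length s t2
          have a3 := ppr_length (-x :: s) γ
          have a4 := pp_length s
          have e1 : 2 ^ t2.length = 2 * 2 ^ γ.length := by rw [← g2, pow_succ]; ring
          simp only [List.length_cons, List.length_append, List.length_map, pow_succ] at *
          rw [e1] at a2
          have e2 : 2 ^ s.length * (2 * 2 ^ γ.length) = 2 ^ s.length * 2 * 2 ^ γ.length := by ring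
          omega
      obtain ⟨y1, y2, hy1, hy2, rfl⟩ := rep_append.1 hyrep
      obtain ⟨a', ha', rfl⟩ := rep_map_iff.1 hy1
      obtain ⟨s', n1, l1, r1, tw⟩ := star_twist hw0 hw hs ha'
      -- a new version of t2
      obtain ⟨t3, n3, l3, e3, r3⟩ : ∃ t3, NZ t3 ∧ t3.length = t2.length ∧
          pf s * pf t2 = pf s * pf t3 ∧ Rep (ppr (pl s') t3) (-a) := by
        have hbase : ∀ δ : List K, Rep (ppr (pl s') (-x :: δ)) (x * (1 + w * a')) := by
          intro δ
          simpa using rep_ppr_cons (a := -x) (rep_plA r1 δ)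
        by_cases hy20 : y2 = 0
        · refine ⟨-x :: γ, NZ.cons.2 ⟨hnx, g1⟩, by simpa using g2, ?_, ?_⟩
          · rw [g3, pf_cons, u_neg]; ring
          · have := hbase γ
            rw [hexy, hy20]
            convert this using 1; ring
        · obtain ⟨γ2, m1, m2, m3⟩ := pure_slot hxs g1 hy20 hy2
          refine ⟨(-(w * y2)) :: -x :: γ2, NZ.cons.2 ⟨neg_ne_zero.2 (mul_ne_zero hw0 hy20),
            NZ.cons.2 ⟨hnx, m1⟩⟩, by simp; omega, ?_, ?_⟩
          · have h1 := hw (-x :: s ++ γ2) (NZ.append.2 ⟨hxs, m1⟩) (by simp; omega)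
            rw [pf_append] at h1
            rw [pf_cons, u_neg] at m3 h1
            rw [g3, pf_cons, pf_cons, u_neg, u_neg, u_mul]
            linear_combination m3 + u y2 * h1
          · have := rep_ppr_cons' (a := -(w * y2)) (rep_plA (pl_rep_one s') (-x :: γ2)) (hbase γ2)
            rw [hexy]
            convert this using 1; ring
      obtain ⟨γ', p1, p2, p3⟩ := pure_slot n1 n3 hna r3
      refine ⟨s', γ', n1, p1, l1, by omega, ?_, ?_⟩
      · exact tw _ ht1 (by simp; omega)
      · rw [e3, ← tw t3 n3 (by omega), p3, u_neg]; ring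

end Star

section Star2

theorem star_one {N : ℕ} (n : ℕ) : ∀ {K : Type} [Field K] [NeZero (2 : K)], CN K N →
    ∀ {s1 s2 mm : List K}, NZ s1 → NZ s2 → s1.length = N → s2.length = N → NZ mm → mm.length = n →
      cls mm = pf s1 - pf s2 → 2 * cls mm = 0 → cls mm = 0 := by
  induction n using Nat.strong_induction_on with
  | _ n ih =>
    intro K _ _ hC s1 s2 m hs1 hs2 hl1 hl2 hm hlm hcls h2
    obtain ⟨m1, hm1, han, hc1, hlen1⟩ := exists_aniso m hm
    rw [← hc1]
    rcases hC.cases with hZ | ⟨hsq, -⟩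
    · rw [hc1, hcls, hZ s1 hs1 hl1, hZ s2 hs2 hl2, sub_zero]
    match m1, hm1, han, hc1, hlen1 with
    | [], _, _, _, _ => rfl
    | c :: m0, hm1, han, hc1, hlen1 =>
    obtain ⟨hc, hm0⟩ := NZ.cons.1 hm1
    have hi : Isot ([c, c] ++ m0) := by
      refine isot_of_cls (m := m0) (NZ.append.2 ⟨NZ.cons.2 ⟨hc, NZ.cons.2 ⟨hc, NZ.nil⟩⟩, hm0⟩) hm0 ?_ (by simp)
      rw [cls_cons] at hc1
      rw [cls_append, cls_append, cls_cons, cls_cons, cls_nil]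
      linear_combination 2 * hc1 + h2
    rcases isot_append_cases hi with h3 | h3 | ⟨x, hx, h3, h4⟩
    · obtain ⟨t, ht⟩ := sq_of_isot hc h3
      exact absurd ht (hsq t)
    · exact absurd (isot_append_right (l := [c]) h3) han
    obtain ⟨p, q, hpq⟩ := rep_two h3
    set w := p * p + q * q with hwdef
    have hw0 : w ≠ 0 := by intro h0; exact hx (by rw [hpq, h0, mul_zero])
    obtain ⟨l', hl', hiso⟩ := rep_split hm0 (neg_ne_zero.2 hx) h4
    have hc2 := hiso.cls hm0
    have hlen2 := hiso.length
    rw [cls_cons, hpq, u_neg, u_mul] at hc2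
    simp only [List.length_cons] at hlen1 hlen2
    have hnsq : ∀ t : K, t * t ≠ w := by
      intro t ht
      apply han
      have ht0 : t ≠ 0 := by rintro rfl; exact hw0 (by rw [← ht]; ring)
      refine isot_of_cls (m := l'.map ((-1) * ·)) hm1 (hl'.map (neg_ne_zero.2 one_ne_zero)) ?_ (by simp; omega)
      rw [cls_append, cls_map, cls_cons, hc2, ← ht, u_sq ht0, u_neg_one]; ring
    obtain ⟨L, _, _, r, hQ⟩ := exists_QE hnsq
    have : NeZero (2 : L) := neZero_ext (K := K) L
    have huw : u (algebraMap K L w) = 1 := by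
      have hr : r ≠ 0 := by
        rintro rfl
        have := hQ.sq
        rw [mul_zero] at this
        exact hw0 ((_root_.map_eq_zero _).1 this.symm)
      rw [← hQ.sq, u_sq hr]
    have hres : cls (l'.map (algebraMap K L)) = res L (cls m) := by
      rw [← hc1, cls_cons, hc2, ← res_cls]
      simp only [map_add, map_mul, map_neg, res_u, huw]
      ring
    have hz := ih l'.length (by omega) (hC.up hQ) (s1 := s1.map (algebraMap K L))
      (s2 := s2.map (algebraMap K L)) (mm := l'.map (algebraMap K L)) (hs1.ext L) (hs2.ext L)
      (by simpa) (by simpa) (hl'.ext L) (by simp) (by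
        rw [hres, hcls, map_sub, res_pf, res_pf]) (by
        rw [hres, two_mul, ← map_add, ← two_mul, h2, map_zero])
    rw [hres, hcls, map_sub] at hz
    have := star_L (N := N) hQ (fun γ hγ hl => w_kill hC hw0 hwdef hγ hl) N (s := []) NZ.nil hs1 hs2 hl1 hl2
      (by simp) (by rw [pf_nil, one_mul, one_mul]; exact sub_eq_zero.1 hz)
    rw [pf_nil, one_mul, one_mul] at this
    rw [hc1, hcls, this, sub_self]

theorem star {K : Type} [Field K] [NeZero (2 : K)] (j : ℕ) : ∀ {N : ℕ}, CN K N →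
    ∀ {s1 s2 : List K}, NZ s1 → NZ s2 → s1.length = N → s2.length = N →
      2 ^ j * (pf s1 - pf s2) = 0 → pf s1 = pf s2 := by
  induction j with
  | zero => intro N _ s1 s2 _ _ _ _ h; rw [pow_zero, one_mul] at h; exact sub_eq_zero.1 h
  | succ j ih =>
    intro N hC s1 s2 h1 h2 l1 l2 h
    have h3 := ih (hC.mono (Nat.le_succ N)) (nz_neg_one h1) (nz_neg_one h2) (by simp; omega)
      (by simp; omega) (by rw [pf_neg_one, pf_neg_one]; linear_combination h)
    rw [pf_neg_one, pf_neg_one] at h3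
    obtain ⟨m, hm, hm'⟩ := exists_cls (pf s1 - pf s2)
    have := star_one _ hC h1 h2 l1 l2 hm rfl hm' (by rw [hm']; linear_combination h3)
    rw [hm'] at this
    exact sub_eq_zero.1 this

end Star2
end WQ

set_option linter.unusedSectionVars false
set_option linter.style.haveILetI false

namespace WQ

open QuadraticMap Module Polynomial

section TF

variable {K : Type} [Field K] [NeZero (2 : K)]

/-- membership in the `N`-th power of the fundamental ideal -/
inductive InI (N : ℕ) : W K → Prop
  | zero : InI N 0
  | step (c : K) (s : List K) (x : W K) : c ≠ 0 → NZ s → s.length = N → InI N x →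
      InI N (u c * pf s + x)

theorem InI.list {N : ℕ} {x : W K} (h : InI N x) : ∃ D : List (K × List K),
    (∀ d ∈ D, d.1 ≠ 0 ∧ NZ d.2 ∧ d.2.length = N) ∧ x = (D.map fun d => u d.1 * pf d.2).sum := by
  induction h with
  | zero => exact ⟨[], by simp, by simp⟩
  | step c s x hc hs hl _ ih =>
    obtain ⟨D, h1, rfl⟩ := ih
    refine ⟨(c, s) :: D, ?_, by simp⟩
    intro d hd
    rcases List.mem_cons.1 hd with rfl | hd
    · exact ⟨hc, hs, hl⟩
    · exact h1 d hd

theorem InI.gen {N : ℕ} {c : K} {s : List K} (hc : c ≠ 0) (hs : NZ s) (hl : s.length = N) :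
    InI N (u c * pf s) := by
  simpa using InI.step c s 0 hc hs hl InI.zero

theorem InI.add {N : ℕ} {x y : W K} (hx : InI N x) (hy : InI N y) : InI N (x + y) := by
  induction hx with
  | zero => simpa using hy
  | step c s x hc hs hl _ ih => rw [add_assoc]; exact InI.step c s _ hc hs hl ih

theorem InI.smul {N : ℕ} {a : K} (ha : a ≠ 0) {x : W K} (hx : InI N x) : InI N (u a * x) := by
  induction hx with
  | zero => simpa using InI.zero
  | step c s x hc hs hl _ ih =>
    rw [mul_add, ← mul_assoc, ← u_mul]; exact InI.step _ s _ (mul_ne_zero ha hc) hs hl ih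

theorem InI.neg {N : ℕ} {x : W K} (hx : InI N x) : InI N (-x) := by
  have := hx.smul (neg_ne_zero.2 (one_ne_zero (α := K)))
  rw [u_neg_one] at this
  simpa using this

theorem InI.pf_mul {N : ℕ} {t : List K} (ht : NZ t) {x : W K} (hx : InI N x) :
    InI (t.length + N) (pf t * x) := by
  induction hx with
  | zero => simpa using InI.zero
  | step c s x hc hs hl _ ih =>
    have : pf t * (u c * pf s + x) = u c * pf (t ++ s) + pf t * x := by rw [pf_append]; ring
    rw [this]
    exact InI.step _ _ _ hc (NZ.append.2 ⟨ht, hs⟩) (by simp [hl]) ih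

theorem InI.one_mul {N : ℕ} {a : K} (ha : a ≠ 0) {x : W K} (hx : InI N x) :
    InI (N + 1) ((1 - u a) * x) := by
  have := hx.pf_mul (t := [a]) (NZ.cons.2 ⟨ha, NZ.nil⟩)
  rw [pf_cons, pf_nil, mul_one] at this
  simpa [add_comm] using this

theorem InI.res {N : ℕ} {x : W K} (hx : InI N x) (L : Type) [Field L] [Algebra K L]
    [NeZero (2 : L)] : InI N (res L x) := by
  induction hx with
  | zero => simpa using InI.zero
  | step c s x hc hs hl _ ih =>
    rw [map_add, map_mul, res_u, res_pf]
    exact InI.step _ _ _ ((_root_.map_ne_zero _).2 hc) (hs.ext L) (by simpa) ih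

theorem InI.of_pf {N : ℕ} (k : ℕ) : ∀ {c : K} {s : List K}, c ≠ 0 → NZ s → s.length = N + k →
    InI N (u c * pf s) := by
  induction k with
  | zero => intro c s hc hs hl; exact InI.gen hc hs hl
  | succ k ih =>
    intro c s hc hs hl
    match s, hs, hl with
    | a :: s, hs, hl =>
      obtain ⟨ha, hs'⟩ := NZ.cons.1 hs
      simp only [List.length_cons] at hl
      have h1 := ih hc hs' (by omega)
      have h2 := ih (mul_ne_zero hc (neg_ne_zero.2 ha)) hs' (by omega)
      have : u c * pf (a :: s) = u c * pf s + u (c * -a) * pf s := by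
        rw [pf_cons, u_mul, u_neg]; ring
      rw [this]; exact h1.add h2

theorem pm_pf {P : W K} {s : List K} (h : ∀ g ∈ s, u g * P = P ∨ u g * P = -P) :
    P * pf s = 0 ∨ ((∀ g ∈ s, u g * P = -P) ∧ P * pf s = 2 ^ s.length * P) := by
  induction s with
  | nil => right; exact ⟨by simp, by simp [pf_nil]⟩
  | cons a s ih =>
    rw [pf_cons]
    rcases ih (fun g hg => h g (List.mem_cons_of_mem _ hg)) with h1 | ⟨h1, h2⟩
    · left; linear_combination (1 - u a) * h1
    · rcases h a List.mem_cons_self with h3 | h3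
      · left; linear_combination (-pf s) * h3
      · right
        refine ⟨?_, ?_⟩
        · intro g hg
          rcases List.mem_cons.1 hg with rfl | hg
          · exact h3
          · exact h1 g hg
        · rw [List.length_cons, pow_succ]
          linear_combination 2 * h2 - pf s * h3

theorem pm_mul {P g : W K} (Q : W K) (h : g * P = P ∨ g * P = -P) :
    g * (Q * P) = Q * P ∨ g * (Q * P) = -(Q * P) := by
  rcases h with h | h
  · left; linear_combination Q * h
  · right; linear_combination Q * h

theorem sum_mul_left' {α : Type} (a : W K) (D : List α) (f : α → W K) :
    (D.map fun d => a * f d).sum = a * (D.map f).sum := by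
  induction D with
  | nil => simp
  | cons d D ih => simp [ih, mul_add]

theorem sum_add' {α : Type} (D : List α) (f g : α → W K) :
    (D.map fun d => f d + g d).sum = (D.map f).sum + (D.map g).sum := by
  induction D with
  | nil => simp
  | cons d D ih => simp [ih]; ring

theorem sum_congr' {α : Type} (D : List α) {f g : α → W K} (h : ∀ d ∈ D, f d = g d) :
    (D.map f).sum = (D.map g).sum := by
  rw [List.map_congr_left h]

/-- data for the torsion-freeness argument -/
def TD (N : ℕ) (E : List K) (P : W K) (M : ℕ) (d : K × List K × List K) : Prop :=
  d.1 ≠ 0 ∧ NZ d.2.1 ∧ NZ d.2.2 ∧ d.2.1.length = N ∧ d.2.2.length = N ∧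
    2 ^ M * pf d.2.2 = P * pf d.2.1 ∧ ∀ g ∈ d.1 :: d.2.1, g ∈ E ∨ u g * P = P ∨ u g * P = -P

theorem TD.split {N : ℕ} {E : List K} {P : W K} {M : ℕ} {e e' : K} {d : K × List K × List K}
    (he : e ≠ 0) (hee : e' = e ∨ e' = -e) (h : TD N (e :: E) P M d) {σ : List K} (hσ : NZ σ) (hl : σ.length + 1 = N)
    (h2 : pf d.2.2 = 2 * pf σ) : TD N E ((1 - u e') * P) (M + 1) (d.1, d.2.1, e' :: σ) := by
  obtain ⟨h1, n1, n2, l1, l2, heq, hg⟩ := h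
  have he' : e' ≠ 0 := by
    rcases hee with rfl | rfl
    · exact he
    · exact neg_ne_zero.2 he
  refine ⟨h1, n1, NZ.cons.2 ⟨he', hσ⟩, l1, by simpa using hl, ?_, ?_⟩
  · show 2 ^ (M + 1) * pf (e' :: σ) = _
    rw [pf_cons, pow_succ]
    linear_combination (1 - u e') * heq - (1 - u e') * 2 ^ M * h2
  · intro g hg'
    rcases hg g hg' with h3 | h3
    · rcases List.mem_cons.1 h3 with rfl | h3
      · right
        have := u_mul_self he
        rcases hee with rfl | rfl
        · right; linear_combination (-P) * this
        · left; rw [u_neg]; linear_combination P * this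
      · left; exact h3
    · right; exact pm_mul _ h3

theorem tf_aux {N : ℕ} (hC : CN K N) (hN : 2 ≤ N) (E : List K) : NZ E →
    ∀ (P : W K) (M : ℕ) (D : List (K × List K × List K)), (∀ d ∈ D, TD N E P M d) →
      (∃ j : ℕ, 2 ^ j * (D.map fun d => u d.1 * pf d.2.2).sum = 0) →
      (D.map fun d => u d.1 * pf d.2.2).sum = 0 := by
  induction E with
  | nil =>
    rintro - P M D hD ⟨j, hj⟩
    -- scalars act by signs
    have hpm : ∀ d ∈ D, u d.1 * pf d.2.2 = pf d.2.2 ∨ u d.1 * pf d.2.2 = -pf d.2.2 := by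
      intro d hd
      obtain ⟨h1, n1, n2, l1, l2, heq, hg⟩ := hD d hd
      rcases hg d.1 List.mem_cons_self with h3 | h3 | h3
      · simp at h3
      · left
        have := tors_pow hC M (s := d.1 :: d.2.2) (NZ.cons.2 ⟨h1, n2⟩) (by simp; omega)
          (by rw [pf_cons]; linear_combination (1 - u d.1) * heq - pf d.2.1 * h3)
        rw [pf_cons] at this
        linear_combination -this
      · right
        have := tors_pow hC M (s := (-d.1) :: d.2.2) (NZ.cons.2 ⟨neg_ne_zero.2 h1, n2⟩) (by simp; omega)
          (by rw [pf_cons, u_neg]; linear_combination (1 + u d.1) * heq + pf d.2.1 * h3)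
        rw [pf_cons, u_neg] at this
        linear_combination this
    have hcase : ∀ d ∈ D, pf d.2.2 = 0 ∨ 2 ^ M * pf d.2.2 = 2 ^ N * P := by
      intro d hd
      obtain ⟨h1, n1, n2, l1, l2, heq, hg⟩ := hD d hd
      rcases pm_pf (P := P) (s := d.2.1) (fun g hg' => by
        rcases hg g (List.mem_cons_of_mem _ hg') with h | h
        · simp at h
        · exact h) with h3 | ⟨-, h3⟩
      · left
        exact tors_pow hC M n2 (by omega) (by rw [heq, h3])
      · right
        rw [heq, h3, l1]
    by_cases hall : ∀ d ∈ D, pf d.2.2 = 0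
    · have := sum_congr' (g := fun _ => (0 : W K)) D (f := fun d => u d.1 * pf d.2.2)
        (fun d hd => by rw [hall d hd, mul_zero])
      rw [this]; simp
    · push Not at hall
      obtain ⟨d0, hd0, hne⟩ := hall
      obtain ⟨h1, n1, n2, l1, l2, heq, hg⟩ := hD d0 hd0
      have h0 : 2 ^ M * pf d0.2.2 = 2 ^ N * P := by
        rcases hcase d0 hd0 with h | h
        · exact absurd h hne
        · exact h
      have hk : ∀ d ∈ D, ∃ k : ℤ, u d.1 * pf d.2.2 = (k : W K) * pf d0.2.2 := by
        intro d hd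
        obtain ⟨-, -, n2', -, l2', -, -⟩ := hD d hd
        rcases hcase d hd with h | h
        · exact ⟨0, by rw [h]; simp⟩
        · have he : pf d.2.2 = pf d0.2.2 := star M hC n2' n2 l2' l2 (by linear_combination h - h0)
          rcases hpm d hd with h' | h'
          · exact ⟨1, by rw [h', he]; simp⟩
          · exact ⟨-1, by rw [h', he]; simp⟩
      have hsum : ∃ k : ℤ, (D.map fun d => u d.1 * pf d.2.2).sum = (k : W K) * pf d0.2.2 := by
        clear hD hpm hcase hd0 hj
        induction D with
        | nil => exact ⟨0, by simp⟩
        | cons d D ih =>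
          obtain ⟨k1, hk1⟩ := hk d List.mem_cons_self
          obtain ⟨k2, hk2⟩ := ih (fun d hd => hk d (List.mem_cons_of_mem _ hd))
          exact ⟨k1 + k2, by rw [List.map_cons, List.sum_cons, hk1, hk2]; push_cast; ring⟩
      obtain ⟨k, hk⟩ := hsum
      rw [hk] at hj ⊢
      by_cases hk0 : k = 0
      · rw [hk0]; simp
      · obtain ⟨j', hj'⟩ := tors_int n2 (m := 2 ^ j * k) (mul_ne_zero (by positivity) hk0)
          (by push_cast; linear_combination hj)
        exact absurd (tors_pow hC j' n2 (by omega) hj') hne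
  | cons e E ih =>
    rintro hE P M D hD ⟨j, hj⟩
    obtain ⟨he, hE'⟩ := NZ.cons.1 hE
    have hhalf : ∀ d : K × List K × List K, ∃ σ, d ∈ D → NZ σ ∧ σ.length + 1 = N ∧ pf d.2.2 = 2 * pf σ := by
      intro d
      by_cases hd : d ∈ D
      · obtain ⟨h1, n1, n2, l1, l2, heq, hg⟩ := hD d hd
        obtain ⟨σ, hσ⟩ := half hC hN n2 l2
        exact ⟨σ, fun _ => hσ⟩
      · exact ⟨[], fun h => absurd h hd⟩
    choose σ hσ using hhalf
    have key : ∀ e' : K, (e' = e ∨ e' = -e) →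
        (D.map fun d => u d.1 * pf (e' :: σ d)).sum = 0 := by
      intro e' he'
      have := ih hE' ((1 - u e') * P) (M + 1) (D.map fun d => (d.1, d.2.1, e' :: σ d)) (by
        intro d' hd'
        obtain ⟨d, hd, rfl⟩ := List.mem_map.1 hd'
        obtain ⟨a1, a2, a3⟩ := hσ d hd
        exact TD.split he he' (hD d hd) a1 a2 a3) ⟨j + 1, by
          rw [List.map_map]
          have h1 : (D.map fun d => 2 * (u d.1 * pf (e' :: σ d))).sum =
              (D.map fun d => (1 - u e') * (u d.1 * pf d.2.2)).sum := by
            apply sum_congr'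
            intro d hd
            rw [(hσ d hd).2.2, pf_cons]; ring
          rw [sum_mul_left', sum_mul_left'] at h1
          have h2 : (D.map ((fun d : K × List K × List K => u d.1 * pf d.2.2) ∘
            fun d => (d.1, d.2.1, e' :: σ d))).sum = (D.map fun d => u d.1 * pf (e' :: σ d)).sum := rfl
          rw [h2, pow_succ]
          linear_combination 2 ^ j * h1 + (1 - u e') * hj⟩
      rw [List.map_map] at this
      exact this
    have k1 := key e (Or.inl rfl)
    have k2 := key (-e) (Or.inr rfl)
    have h3 : (D.map fun d => u d.1 * pf d.2.2).sum =
        (D.map fun d => u d.1 * pf (e :: σ d) + u d.1 * pf (-e :: σ d)).sum := by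
      apply sum_congr'
      intro d hd
      rw [(hσ d hd).2.2, pf_cons, pf_cons, u_neg]; ring
    rw [h3, sum_add', k1, k2, add_zero]

theorem tf {N : ℕ} (hC : CN K N) (hN : 2 ≤ N) {x : W K} (hx : InI N x) {j : ℕ}
    (hj : 2 ^ j * x = 0) : x = 0 := by
  obtain ⟨D, h1, rfl⟩ := hx.list
  have h2 : (D.map fun d => u d.1 * pf d.2).sum =
      ((D.map fun d => (d.1, d.2, d.2)).map fun d => u d.1 * pf d.2.2).sum := by
    rw [List.map_map]; rfl
  rw [h2] at hj ⊢
  refine tf_aux hC hN (D.flatMap fun d => d.1 :: d.2) ?_ 1 0 _ ?_ ⟨j, hj⟩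
  · intro a ha
    obtain ⟨d, hd, ha'⟩ := List.mem_flatMap.1 ha
    obtain ⟨a1, a2, a3⟩ := h1 d hd
    rcases List.mem_cons.1 ha' with rfl | h
    · exact a1
    · exact a2 a h
  · intro d' hd'
    obtain ⟨d, hd, rfl⟩ := List.mem_map.1 hd'
    obtain ⟨a1, a2, a3⟩ := h1 d hd
    refine ⟨a1, a2, a2, a3, a3, by ring, fun g hg => Or.inl ?_⟩
    exact List.mem_flatMap.2 ⟨d, hd, hg⟩

theorem haupt_aux {N : ℕ} {t : List K} (htN : t.length < N) (D : List (K × List K))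
    (hD : ∀ d ∈ D, d.2.length = N) (E : List K) : NZ E → ∀ q : List K, NZ q →
    (∀ g ∈ t ++ D.flatMap (fun d => d.1 :: d.2), g ∈ E ∨ u g * pf q = pf q ∨ u g * pf q = - pf q) →
    pf q * pf t = pf q * (D.map fun d => u d.1 * pf d.2).sum → ∃ j : ℕ, 2 ^ j * (pf q * pf t) = 0 := by
  induction E with
  | nil =>
    intro _ q hq hg heq
    have hg' : ∀ g ∈ t ++ D.flatMap (fun d => d.1 :: d.2), u g * pf q = pf q ∨ u g * pf q = - pf q := by
      intro g h
      rcases hg g h with h | h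
      · simp at h
      · exact h
    rcases pm_pf (P := pf q) (s := t) (fun g h => hg' g (List.mem_append_left _ h)) with h1 | ⟨-, h1⟩
    · exact ⟨0, by rw [h1, mul_zero]⟩
    have hk : ∃ k : ℤ, pf q * (D.map fun d => u d.1 * pf d.2).sum = 2 ^ N * (k : W K) * pf q := by
      have hD' : ∀ d ∈ D, ∃ k : ℤ, pf q * (u d.1 * pf d.2) = 2 ^ N * (k : W K) * pf q := by
        intro d hd
        have hm : ∀ g ∈ d.1 :: d.2, u g * pf q = pf q ∨ u g * pf q = - pf q := fun g h =>
          hg' g (List.mem_append_right _ (List.mem_flatMap.2 ⟨d, hd, h⟩))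
        rcases pm_pf (P := pf q) (s := d.2) (fun g h => hm g (List.mem_cons_of_mem _ h)) with h2 | ⟨-, h2⟩
        · exact ⟨0, by push_cast; linear_combination u d.1 * h2⟩
        · rw [hD d hd] at h2
          rcases hm d.1 List.mem_cons_self with h3 | h3
          · exact ⟨1, by push_cast; linear_combination u d.1 * h2 + 2 ^ N * h3⟩
          · exact ⟨-1, by push_cast; linear_combination u d.1 * h2 + 2 ^ N * h3⟩
      clear hg hg' heq hD
      induction D with
      | nil => exact ⟨0, by simp⟩
      | cons d D ih =>
        obtain ⟨k1, hk1⟩ := hD' d List.mem_cons_self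
        obtain ⟨k2, hk2⟩ := ih (fun d hd => hD' d (List.mem_cons_of_mem _ hd))
        exact ⟨k1 + k2, by rw [List.map_cons, List.sum_cons, mul_add, hk1, hk2]; push_cast; ring⟩
    obtain ⟨k, hk⟩ := hk
    rw [h1, hk] at heq
    obtain ⟨j, hj⟩ := tors_int hq (m := 2 ^ t.length - 2 ^ N * k) (by
      obtain ⟨e, he⟩ : ∃ e, N = t.length + (e + 1) := ⟨N - t.length - 1, by omega⟩
      have h2 : (2 : ℤ) ^ t.length - 2 ^ N * k = 2 ^ t.length * (1 - 2 * (2 ^ e * k)) := by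
        rw [he, pow_add, pow_succ]; ring
      rw [h2]
      refine mul_ne_zero (by positivity) ?_
      omega) (by push_cast; linear_combination heq)
    exact ⟨j, by linear_combination pf t * hj⟩
  | cons e E ih =>
    intro hE q hq hg heq
    obtain ⟨he, hE'⟩ := NZ.cons.1 hE
    have key : ∀ e' : K, (e' = e ∨ e' = -e) → ∃ j : ℕ, 2 ^ j * (pf (e' :: q) * pf t) = 0 := by
      intro e' hee
      have he' : e' ≠ 0 := by
        rcases hee with rfl | rfl
        · exact he
        · exact neg_ne_zero.2 he
      refine ih hE' (e' :: q) (NZ.cons.2 ⟨he', hq⟩) ?_ ?_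
      · intro g hg'
        rw [pf_cons]
        rcases hg g hg' with h3 | h3
        · rcases List.mem_cons.1 h3 with rfl | h3
          · right
            have := u_mul_self he
            rcases hee with rfl | rfl
            · right; linear_combination (-pf q) * this
            · left; rw [u_neg]; linear_combination pf q * this
          · left; exact h3
        · right; exact pm_mul _ h3
      · rw [pf_cons]; linear_combination (1 - u e') * heq
    obtain ⟨j1, h1⟩ := key e (Or.inl rfl)
    obtain ⟨j2, h2⟩ := key (-e) (Or.inr rfl)
    rw [pf_cons] at h1 h2
    rw [u_neg] at h2
    refine ⟨j1 + j2 + 1, ?_⟩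
    rw [pow_succ, pow_add]
    linear_combination 2 ^ j2 * h1 + 2 ^ j1 * h2

theorem haupt {N : ℕ} (hC : CN K N) (hN : 2 ≤ N) {t : List K} (ht : NZ t) (htN : t.length < N)
    (h : InI N (pf t)) : pf t = 0 := by
  obtain ⟨D, h1, h2⟩ := h.list
  obtain ⟨j, hj⟩ := haupt_aux htN D (fun d hd => (h1 d hd).2.2)
    (t ++ D.flatMap (fun d => d.1 :: d.2)) (NZ.append.2 ⟨ht, by
      intro a ha
      obtain ⟨d, hd, ha'⟩ := List.mem_flatMap.1 ha
      obtain ⟨a1, a2, a3⟩ := h1 d hd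
      rcases List.mem_cons.1 ha' with rfl | h
      · exact a1
      · exact a2 a h⟩) [] NZ.nil (fun g hg => Or.inl hg) (by rw [← h2])
  rw [pf_nil, one_mul] at hj
  exact tf hC hN h hj

end TF
end WQ

set_option linter.unusedSectionVars false
set_option linter.style.haveILetI false

namespace WQ

open QuadraticMap Module Polynomial

section Main

/-- norms from finite extensions killing `x` -/
def hypC {K : Type} [Field K] [NeZero (2 : K)] (x : W K) : Set K :=
  {a | ∃ (L : Type) (_ : Field L) (_ : Algebra K L) (_ : NeZero (2 : L)), FiniteDimensional K L ∧
    res L x = 0 ∧ ∃ y : L, y ≠ 0 ∧ Algebra.norm K y = a}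

/-- the group generated by squares and norms -/
def HH {K : Type} [Field K] [NeZero (2 : K)] (x : W K) : Set K :=
  {a | ∃ s : K, s ≠ 0 ∧ ∃ h ∈ Submonoid.closure (hypC x), a = s ^ 2 * h}

variable {K : Type} [Field K] [NeZero (2 : K)]

theorem HH.of_sq (x : W K) {s : K} (hs : s ≠ 0) : s * s ∈ HH x :=
  ⟨s, hs, 1, one_mem _, by ring⟩

theorem HH.cancel {x : W K} {a k : K} (hk : k ≠ 0) (h : k * k * a ∈ HH x) : a ∈ HH x := by
  obtain ⟨s, hs, h, hh, he⟩ := h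
  refine ⟨s / k, div_ne_zero hs hk, h, hh, ?_⟩
  field_simp
  linear_combination he

theorem hypC.norm {x : W K} {K1 : Type} [Field K1] [Algebra K K1] [FiniteDimensional K K1]
    [NeZero (2 : K1)] {a : K1} (h : a ∈ hypC (res K1 x)) : Algebra.norm K a ∈ hypC x := by
  obtain ⟨L, _, _, _, hf, h0, y, hy, rfl⟩ := h
  let alg : Algebra K L := ((algebraMap K1 L).comp (algebraMap K K1)).toAlgebra
  haveI : IsScalarTower K K1 L := IsScalarTower.of_algebraMap_eq (fun _ => rfl)
  haveI : FiniteDimensional K L := FiniteDimensional.trans K K1 L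
  refine ⟨L, _, alg, inferInstance, inferInstance, ?_, y, hy, ?_⟩
  · rw [← res_res (L := K1), h0]
  · rw [Algebra.norm_norm]

theorem HH.norm {x : W K} {K1 : Type} [Field K1] [Algebra K K1] [FiniteDimensional K K1]
    [NeZero (2 : K1)] {a : K1} (h : a ∈ HH (res K1 x)) : Algebra.norm K a ∈ HH x := by
  obtain ⟨s, hs, h, hh, rfl⟩ := h
  refine ⟨Algebra.norm K s, by rwa [Algebra.norm_ne_zero_iff], Algebra.norm K h, ?_, by
    rw [map_mul, map_pow]⟩
  clear hs
  induction hh using Submonoid.closure_induction with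
  | mem y hy => exact Submonoid.subset_closure (hypC.norm hy)
  | one => rw [map_one]; exact one_mem _
  | mul y z _ _ h1 h2 => rw [map_mul]; exact mul_mem h1 h2

theorem HH.stab {x : W K} {a : K} (h : a ∈ HH x) : a ≠ 0 ∧ u a * x = x := by
  obtain ⟨s, hs, h, hh, rfl⟩ := h
  have : h ≠ 0 ∧ u h * x = x := by
    induction hh using Submonoid.closure_induction with
    | mem y hy =>
      obtain ⟨L, _, _, _, hf, h0, z, hz, rfl⟩ := hy
      exact ⟨by rwa [Algebra.norm_ne_zero_iff], norm_principle h0 hz⟩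
    | one => exact ⟨one_ne_zero, by rw [u_one, one_mul]⟩
    | mul y z _ _ h1 h2 =>
      exact ⟨mul_ne_zero h1.1 h2.1, by rw [u_mul, mul_assoc, h2.2, h1.2]⟩
  refine ⟨mul_ne_zero (pow_ne_zero _ hs) this.1, ?_⟩
  rw [u_mul, pow_two, u_sq hs, one_mul, this.2]

theorem two_kill {n : ℕ} (hn : 1 ≤ n) (hC : CN K (n + 1)) {x : W K} (hx : InI n x) {z : K}
    (hz : z ≠ 0) (h : 2 * ((1 - u z) * x) = 0) : u z * x = x := by
  have := tf hC (by omega) (hx.one_mul hz) (j := 1) (by rw [pow_one]; exact h)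
  linear_combination -this

theorem descend {n : ℕ} (hn : 1 ≤ n) (hC : CN K (n + 1)) {b : K} {K1 : Type} [Field K1]
    [Algebra K K1] [NeZero (2 : K1)] {r : K1} (hQ : QE b K1 r) {x : W K} (hx : InI n (res K1 x))
    {a t : K} (ha : a ≠ 0) (hat : a = t * t - b) (hax : u a * x = x)
    (hmain : ∀ z : K1, z ≠ 0 → u z * res K1 x = res K1 x → z ∈ HH (res K1 x)) : a ∈ HH x := by
  haveI := hQ.finite
  have hC1 := hC.up hQ
  set f := algebraMap K K1 with hf
  set z : K1 := f t + f 1 * r with hz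
  have hnorm : Algebra.norm K z = a := by
    rw [hz, hQ.norm t one_ne_zero, hat]; ring
  have hz0 : z ≠ 0 := by
    rw [← Algebra.norm_ne_zero_iff (R := K), hnorm]; exact ha
  have hax1 : u (f a) * res K1 x = res K1 x := by
    have := congrArg (res K1) hax
    rwa [map_mul, res_u] at this
  have hfa : f a ≠ 0 := (_root_.map_ne_zero _).2 ha
  have hsq := hQ.sq
  have hzz : z * z + f a = f (2 * t) * z := by
    rw [hz, hat]
    simp only [map_sub, map_mul, map_one, map_ofNat]
    rw [← hf] at hsq
    linear_combination hsq
  obtain ⟨k, hk, hkz⟩ : ∃ k : K, k ≠ 0 ∧ u (f k * z) * res K1 x = res K1 x := by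
    by_cases ht : t = 0
    · refine ⟨1, one_ne_zero, ?_⟩
      rw [map_one, one_mul]
      apply two_kill hn hC1 hx hz0
      have h1 : f a = -(z * z) := by
        rw [ht] at hzz; simp only [mul_zero, map_zero, zero_mul] at hzz; linear_combination hzz
      rw [h1, u_neg, u_sq hz0] at hax1
      linear_combination (-(1 - u z)) * hax1
    · have h2t : (2 * t) ≠ 0 := mul_ne_zero (NeZero.ne 2) ht
      have h2 : f (2 * t) * z ≠ 0 := mul_ne_zero ((_root_.map_ne_zero _).2 h2t) hz0
      refine ⟨2 * t, h2t, ?_⟩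
      apply two_kill hn hC1 hx h2
      have h3 := u_add (mul_ne_zero hz0 hz0) hfa (by rw [hzz]; exact h2)
      rw [hzz, u_mul (z * z * f a), u_mul (z * z), u_sq hz0] at h3
      linear_combination res K1 x * h3 + (u (f (2 * t) * z) - 1) * hax1
  have h4 := HH.norm (hmain _ (mul_ne_zero ((_root_.map_ne_zero _).2 hk) hz0) hkz)
  rw [map_mul, hnorm, hf, Algebra.norm_algebraMap, hQ.finrank, pow_two] at h4
  exact HH.cancel hk h4

theorem main_lemma {n : ℕ} (hn : 1 ≤ n) (len : ℕ) : ∀ {K : Type} [Field K] [NeZero (2 : K)],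
    CN K (n + 1) → ∀ {l : List K} {a : K}, NZ l → l.length = len → InI n (cls l) → a ≠ 0 →
      u a * cls l = cls l → a ∈ HH (cls l) := by
  induction len using Nat.strong_induction_on with
  | _ len ih =>
    intro K _ _ hC l a hl hlen hI ha hax
    obtain ⟨m, hm, han, hc, hml⟩ := exists_aniso l hl
    rw [← hc] at hI hax ⊢
    match m, hm, han, hc, hml with
    | [], _, _, _, _ =>
      refine ⟨1, one_ne_zero, a, Submonoid.subset_closure ?_, by ring⟩
      refine ⟨K, _, Algebra.id K, inferInstance, inferInstance, ?_, a, ha, ?_⟩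
      · rw [cls_nil, map_zero]
      · rw [Algebra.norm_self]; rfl
    | c :: l0, hm, han, hc, hml =>
      obtain ⟨hc0, hl0⟩ := NZ.cons.1 hm
      have hrep : Rep (c :: l0) (a * c) := by
        refine rep_of_cls_cons (l := (c :: l0).map (a * ·)) (hm.map ha) hm ?_ (by simp) ?_
        · rw [cls_map, hax]
        · exact rep_map (rep_cons.2 ⟨1, 0, rep_zero _, by ring⟩)
      obtain ⟨t, y, hy, hty⟩ := rep_cons.1 hrep
      by_cases hy0 : y = 0
      · have hat : a = t * t := by
          rw [hy0] at hty
          apply mul_left_cancel₀ hc0; linear_combination hty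
        have ht : t ≠ 0 := by rintro rfl; exact ha (by rw [hat]; ring)
        rw [hat]; exact HH.of_sq _ ht
      · obtain ⟨b, hb⟩ : ∃ b, y = -(c * b) := ⟨-y / c, by field_simp⟩
        have hb0 : b ≠ 0 := by rintro rfl; exact hy0 (by rw [hb]; ring)
        have hat : a = t * t - b := by
          apply mul_left_cancel₀ hc0; rw [hb] at hty; linear_combination hty
        obtain ⟨l', hl', hiso⟩ := rep_split hl0 hy0 hy
        have hc2 := hiso.cls hl0
        have hlen2 := hiso.length
        rw [cls_cons, hb, u_neg, u_mul] at hc2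
        simp only [List.length_cons] at hml hlen2
        have hnsq : ∀ t : K, t * t ≠ b := by
          intro t ht
          apply han
          have ht0 : t ≠ 0 := by rintro rfl; exact hb0 (by rw [← ht]; ring)
          refine isot_of_cls (m := l'.map ((-1) * ·)) hm (hl'.map (neg_ne_zero.2 one_ne_zero)) ?_ (by simp; omega)
          rw [cls_append, cls_map, cls_cons, hc2, ← ht, u_sq ht0, u_neg_one]; ring
        obtain ⟨L, _, _, r, hQ⟩ := exists_QE hnsq
        have : NeZero (2 : L) := neZero_ext (K := K) L
        have huw : u (algebraMap K L b) = 1 := by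
          have hr : r ≠ 0 := by
            rintro rfl
            have := hQ.sq
            rw [mul_zero] at this
            exact hb0 ((_root_.map_eq_zero _).1 this.symm)
          rw [← hQ.sq, u_sq hr]
        have hres : cls (l'.map (algebraMap K L)) = res L (cls (c :: l0)) := by
          rw [cls_cons, hc2, ← res_cls]
          simp only [map_add, map_mul, map_neg, res_u, huw]
          ring
        refine descend hn hC hQ (hI.res L) ha hat hax ?_
        intro z hz0 hz
        rw [← hres] at hz ⊢
        exact ih l'.length (by omega) (hC.up hQ) (hl'.ext L) (by simp) (by rw [hres]; exact hI.res L) hz0 hz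

theorem main_sub {n : ℕ} (hn : 1 ≤ n) (hC : CN K (n + 1)) {l t : List K} {c a : K} (hl : NZ l)
    (ht : NZ t) (hc : c ≠ 0) (hx : InI n (cls l - u c * pf t)) (ha : a ≠ 0)
    (hax : u a * cls l = cls l) : a ∈ HH (cls l) := by
  have hin : InI n (u c * pf t) → a ∈ HH (cls l) := fun h =>
    main_lemma hn _ hC hl rfl (by simpa using hx.add h) ha hax
  by_cases htn : n ≤ t.length
  · exact hin (InI.of_pf (t.length - n) hc ht (by omega))
  have h1 : InI (n + 1) (pf (a :: t)) := by
    have h2 := ((hx.one_mul ha).smul hc).neg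
    have h3 : -(u c * ((1 - u a) * (cls l - u c * pf t))) = pf (a :: t) := by
      rw [pf_cons]
      linear_combination u c * hax + (1 - u a) * pf t * u_mul_self hc
    rwa [h3] at h2
  have h2 := haupt hC (by omega) (NZ.cons.2 ⟨ha, ht⟩) (by simp; omega) h1
  rw [pf_cons] at h2
  obtain ⟨r, e, he, hae⟩ := rep_cons.1 (Rep.iso (Iso.of_perm (plA_perm [1] t)) (rep_of_pf ht ha h2))
  by_cases he0 : e = 0
  · have har : a = r * r := by rw [hae, he0]; ring
    have hr : r ≠ 0 := by rintro rfl; exact ha (by rw [har]; ring)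
    rw [har]; exact HH.of_sq _ hr
  obtain ⟨t', n1, n2, n3⟩ := pure_slot' ht he0 he
  by_cases hsq : ∃ β : K, β * β = -e
  · obtain ⟨β, hβ⟩ := hsq
    have hβ0 : β ≠ 0 := by rintro rfl; exact he0 (by simpa using hβ.symm)
    have hue : u e = -1 := by
      have := u_sq hβ0
      rw [hβ, u_neg] at this; linear_combination -this
    apply hin
    rw [n3, hue]
    simpa using InI.zero
  · push Not at hsq
    obtain ⟨L, _, _, ρ, hQ⟩ := exists_QE hsq
    have : NeZero (2 : L) := neZero_ext (K := K) L
    have hue : u (algebraMap K L (-e)) = 1 := by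
      have hr : ρ ≠ 0 := by
        rintro rfl
        have := hQ.sq
        rw [mul_zero] at this
        exact neg_ne_zero.2 he0 ((_root_.map_eq_zero _).1 this.symm)
      rw [← hQ.sq, u_sq hr]
    have hpf : res L (pf t) = 0 := by
      rw [map_neg, u_neg] at hue
      rw [n3, map_mul, map_add, map_one, res_u]
      linear_combination (-res L (pf t')) * hue
    have hres : InI n (res L (cls l)) := by
      have := hx.res L
      rwa [map_sub, map_mul, hpf, mul_zero, sub_zero] at this
    refine descend hn hC hQ hres ha (t := r) (by rw [hae]; ring) hax ?_
    intro z hz0 hz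
    rw [res_cls] at hz hres ⊢
    exact main_lemma hn _ (hC.up hQ) (hl.ext L) rfl hres hz0 hz

end Main
end WQ

set_option linter.unusedSectionVars false
set_option linter.style.haveILetI false

namespace WQ

open QuadraticMap Module
open scoped TensorProduct

section Bridge

variable {K : Type} [Field K] [Invertible (2 : K)]

theorem tm_val {V : Type} [AddCommGroup V] [Module K V] (q : QuadraticForm K V) (a : K) (v w : V) :
    QuadraticForm.tmul (weightedSumSquares K ![(1 : K), -a]) q
      ((![1, 0] : Fin 2 → K) ⊗ₜ[K] v + (![0, 1] : Fin 2 → K) ⊗ₜ[K] w) = q v + -a * q w := by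
  rw [QuadraticMap.map_add (QuadraticForm.tmul (weightedSumSquares K ![(1 : K), -a]) q)]
  have h1 : ∀ (b : Fin 2 → K) (v : V), QuadraticForm.tmul (weightedSumSquares K ![(1 : K), -a]) q
      (b ⊗ₜ[K] v) = q v * (weightedSumSquares K ![(1 : K), -a]) b := by
    intro b v
    simp [QuadraticForm.tmul]
  have h2 : polar (QuadraticForm.tmul (weightedSumSquares K ![(1 : K), -a]) q)
      ((![1, 0] : Fin 2 → K) ⊗ₜ[K] v) ((![0, 1] : Fin 2 → K) ⊗ₜ[K] w) = 0 := by
    have h3 : polarBilin (QuadraticForm.tmul (weightedSumSquares K ![(1 : K), -a]) q)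
      ((![1, 0] : Fin 2 → K) ⊗ₜ[K] v) ((![0, 1] : Fin 2 → K) ⊗ₜ[K] w) = 0 := by
      rw [QuadraticForm.polarBilin_tmul]
      simp [polar, weightedSumSquares_apply, Fin.sum_univ_two]
    exact h3
  rw [h1, h1, h2]
  simp [weightedSumSquares_apply, Fin.sum_univ_two]
  ring

/-- splitting of the tensor product with a plane -/
noncomputable def tmE (V : Type) [AddCommGroup V] [Module K V] :
    ((Fin 2 → K) ⊗[K] V) ≃ₗ[K] V × V :=
  (TensorProduct.congr (LinearEquiv.finTwoArrow K K) (LinearEquiv.refl K V)).trans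
    ((TensorProduct.prodLeft K K K K V).trans
      ((TensorProduct.lid K V).prodCongr (TensorProduct.lid K V)))

theorem tmE_symm {V : Type} [AddCommGroup V] [Module K V] (v w : V) :
    (tmE (K := K) V).symm (v, w) =
      (![1, 0] : Fin 2 → K) ⊗ₜ[K] v + (![0, 1] : Fin 2 → K) ⊗ₜ[K] w := by
  rw [LinearEquiv.symm_apply_eq]
  simp [tmE]

theorem tmul_bin (a : K) (ψ : QF K) :
    (QF.tmul (QF.bin a) ψ).Equiv (QF.add ψ (QF.smul (-a) ψ)) := by
  apply equiv_symm
  let e : (QF.add ψ (QF.smul (-a) ψ)).V ≃ₗ[K] (QF.tmul (QF.bin a) ψ).V := (tmE ψ.V).symm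
  refine equiv_of e ?_
  rintro ⟨(v : ψ.V), (w : ψ.V)⟩
  have h1 : (QF.add ψ (QF.smul (-a) ψ)).q (v, w) = ψ.q v + -a * ψ.q w := rfl
  refine Eq.trans ?_ h1.symm
  refine Eq.trans ?_ (tm_val ψ.q a v w)
  exact congrArg (QuadraticForm.tmul (weightedSumSquares K ![(1 : K), -a]) ψ.q) (tmE_symm v w)

theorem one_equiv : (QF.one : QF K).Equiv (ofList [1]) := by
  refine equiv_trans (ψ := line 1) ?_ ?_
  · let e : (QF.one : QF K).V ≃ₗ[K] (line (1 : K)).V := LinearEquiv.funUnique (Fin 1) K K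
    refine equiv_of e ?_
    intro (x : Fin 1 → K)
    have h1 : (line (1 : K)).q (e x) = (line (1 : K)).q (x 0) := rfl
    have h2 : (QF.one : QF K).q x = weightedSumSquares K (fun _ : Fin 1 => (1 : K)) x := rfl
    refine h1.trans (Eq.trans ?_ h2.symm)
    rw [line_q, weightedSumSquares_apply]; simp
  · exact equiv_trans (equiv_symm (zero_add' _)) (add_comm' _ _)

theorem pfister_equiv (s : List K) : (QF.pfister s).Equiv (ofList (pl s)) := by
  induction s with
  | nil => exact one_equiv
  | cons a s ih =>
    refine equiv_trans (tmul_bin a _) ?_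
    refine equiv_trans (add_congr ih (equiv_trans (smul_congr _ ih) (ofList_smul _ _))) ?_
    exact equiv_symm (ofList_append _ _)

theorem pl_nz_inv {s : List K} (h : NZ (pl s)) : NZ s := by
  induction s with
  | nil => exact NZ.nil
  | cons a s ih =>
    have h' := NZ.append.1 h
    refine NZ.cons.2 ⟨?_, ih h'.1⟩
    rintro rfl
    have hlen : 0 < (pl s).length := by rw [plA_length]; simp
    obtain ⟨x, hx⟩ := List.exists_mem_of_length_pos hlen
    exact h'.2 (-0 * x) (List.mem_map.2 ⟨x, hx, rfl⟩) (by ring)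

theorem NZ.unmap {l : List K} {c : K} (h : NZ (l.map (c * ·))) : NZ l := by
  intro a ha h0
  exact h (c * a) (List.mem_map.2 ⟨a, ha, rfl⟩) (by rw [h0, mul_zero])

variable [NeZero (2 : K)]

theorem sum_inI {n : ℕ} (L : List (K × (Fin n → K))) (hc : ∀ p ∈ L, p.1 ≠ 0)
    (hnd : (QF.sumList (L.map fun p => QF.smul p.1 (QF.pfister (List.ofFn p.2)))).Nondeg) :
    ∃ m : List K, NZ m ∧
      (QF.sumList (L.map fun p => QF.smul p.1 (QF.pfister (List.ofFn p.2)))).Equiv (ofList m) ∧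
      InI n (cls m) := by
  induction L with
  | nil => exact ⟨[], NZ.nil, equiv_refl _, by rw [cls_nil]; exact InI.zero⟩
  | cons p L ih =>
    have h1 := Nondeg.of_add_left hnd
    have h2 := Nondeg.of_add_right hnd
    obtain ⟨m, hm, he, hi⟩ := ih (fun p hp => hc p (List.mem_cons_of_mem _ hp)) h2
    have hp := hc p List.mem_cons_self
    have e1 : (QF.smul p.1 (QF.pfister (List.ofFn p.2))).Equiv
        (ofList ((pl (List.ofFn p.2)).map (p.1 * ·))) :=
      equiv_trans (smul_congr _ (pfister_equiv _)) (ofList_smul _ _)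
    have n1 := NZ.of_nondeg (Nondeg.congr e1 h1)
    refine ⟨(pl (List.ofFn p.2)).map (p.1 * ·) ++ m, NZ.append.2 ⟨n1, hm⟩,
      equiv_trans (add_congr e1 he) (equiv_symm (ofList_append _ _)), ?_⟩
    rw [cls_append, cls_map, pl_cls]
    exact InI.step _ _ _ hp (pl_nz_inv n1.unmap) (by simp) hi

theorem inI_of {n : ℕ} {ψ : QF K} {m : List K} (hm : NZ m) (he : ψ.Equiv (ofList m))
    (h : QF.InFundPow n ψ) : InI n (cls m) := by
  obtain ⟨r, c, l, hc, hW⟩ := h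
  have hnd := IsHyperbolic.nondeg hW
  have h2 := Nondeg.of_add_right hnd
  have hl : ((List.finRange r).map fun i => QF.smul (c i) (QF.pfister (List.ofFn (l i)))) =
    (((List.finRange r).map fun i => (c i, l i)).map
      fun p => QF.smul p.1 (QF.pfister (List.ofFn p.2))) := by simp [Function.comp_def]
  unfold QF.WittEquiv at hW
  rw [hl] at h2 hW
  set S := QF.sumList (((List.finRange r).map fun i => (c i, l i)).map
      fun p => QF.smul p.1 (QF.pfister (List.ofFn p.2))) with hS
  have h3 : S.Nondeg := by
    have h4 := Nondeg.smul h2 (a := (-1 : K)) (neg_ne_zero.2 one_ne_zero)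
    refine Nondeg.congr (equiv_of (φ := QF.smul (-1) (QF.smul (-1) S)) (ψ := S) (LinearEquiv.refl K S.V) ?_) h4
    intro x
    have : (QF.smul (-1) (QF.smul (-1) S)).q x = -1 * (-1 * S.q x) := rfl
    refine Eq.trans ?_ this.symm
    have h6 : S.q x = -1 * (-1 * S.q x) := by ring
    exact h6
  obtain ⟨k, hk, hke, hki⟩ := sum_inI _ (by
    intro p hp
    obtain ⟨i, -, rfl⟩ := List.mem_map.1 hp
    exact hc i) h3
  have e2 : (QF.add ψ (QF.smul (-1) S)).Equiv (ofList (m ++ k.map (-1 * ·))) :=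
    equiv_trans (add_congr he (equiv_trans (smul_congr _ hke) (ofList_smul _ _)))
      (equiv_symm (ofList_append _ _))
  have h5 := (isHyperbolic_iff (NZ.append.2 ⟨hm, hk.map (neg_ne_zero.2 one_ne_zero)⟩) e2).1 hW
  rw [cls_append, cls_map, u_neg_one] at h5
  have : cls m = cls k := by linear_combination h5
  rw [this]; exact hki

theorem cn_of {n : ℕ}
    (hI : ∀ (L : FieldExt K) [Invertible (2 : L.carrier)],
      (∃ i : L.carrier, i * i = -1 ∧ Algebra.adjoin K {i} = ⊤) →
      ∀ ψ : QF L.carrier, ψ.Nondeg → QF.InFundPow (n + 1) ψ → ψ.IsHyperbolic) :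
    CN K (n + 1) := by
  have key : ∀ (M : Type) (_ : Field M) (_ : Algebra K M) (i : M), i * i = -1 →
      (∀ x, ∃ p q, x = algebraMap K M p + algebraMap K M q * i) → CN K (n + 1) := by
    intro M _ _ i hi hs
    refine ⟨M, _, _, i, hi, hs, ?_⟩
    intro s hs0 hlen
    have : NeZero (2 : M) := neZero_ext (K := K) M
    letI : Invertible (2 : M) := invertibleOfNonzero (NeZero.ne 2)
    have had : Algebra.adjoin K {i} = ⊤ := by
      rw [eq_top_iff]
      rintro x -
      obtain ⟨p, q, rfl⟩ := hs x
      exact add_mem (Subalgebra.algebraMap_mem _ _)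
        (mul_mem (Subalgebra.algebraMap_mem _ _) (Algebra.subset_adjoin rfl))
    have hnz := pl_nz hs0
    have h1 : QF.IsHyperbolic (ofList (pl s)) := by
      refine hI ⟨M⟩ ⟨i, hi, had⟩ (ofList (pl s)) (Nondeg.ofList hnz) ?_
      refine ⟨1, fun _ => 1, fun _ j => s.get (j.cast hlen.symm), fun _ => one_ne_zero, ?_⟩
      have hof : List.ofFn (fun j : Fin (n + 1) => s.get (j.cast hlen.symm)) = s := by
        apply List.ext_getElem
        · simp [hlen]
        · intro k _ _; rw [List.getElem_ofFn]; rfl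
      have hl : ((List.finRange 1).map fun _ => QF.smul (1 : M) (QF.pfister
          (List.ofFn (fun j : Fin (n + 1) => s.get (j.cast hlen.symm))))) =
          [QF.smul (1 : M) (QF.pfister s)] := by rw [hof]; rfl
      unfold QF.WittEquiv
      rw [hl]
      have e1 : (QF.sumList [QF.smul (1 : M) (QF.pfister s)]).Equiv
          (ofList ((pl s).map (1 * ·) ++ [])) :=
        equiv_trans (add_congr (equiv_trans (smul_congr _ (pfister_equiv s)) (ofList_smul _ _))
          (equiv_refl _)) (equiv_symm (ofList_append _ []))
      have e2 : (QF.add (ofList (pl s)) (QF.smul (-1)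
          (QF.sumList [QF.smul (1 : M) (QF.pfister s)]))).Equiv
          (ofList (pl s ++ ((pl s).map (1 * ·) ++ []).map (-1 * ·))) :=
        equiv_trans (add_congr (equiv_refl _) (equiv_trans (smul_congr _ e1) (ofList_smul _ _)))
          (equiv_symm (ofList_append _ _))
      refine (isHyperbolic_iff ?_ e2).2 ?_
      · refine NZ.append.2 ⟨hnz, NZ.map ?_ (neg_ne_zero.2 one_ne_zero)⟩
        exact NZ.append.2 ⟨hnz.map one_ne_zero, NZ.nil⟩
      · rw [cls_append, cls_map, cls_append, cls_map, cls_nil, u_neg_one, u_one]; ring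
    have h2 := (isHyperbolic_iff hnz (equiv_refl _)).1 h1
    rwa [pl_cls] at h2
  by_cases h : ∃ t : K, t * t = -1
  · obtain ⟨t, ht⟩ := h
    exact key K _ (Algebra.id K) t ht (fun x => ⟨x, 0, by simp⟩)
  · push Not at h
    obtain ⟨M, _, _, r, hr⟩ := exists_QE h
    exact key M _ _ r (by rw [hr.sq]; simp) hr.span

theorem hypSet_eq {φ : QF K} {m : List K} (hm : NZ m) (he : φ.Equiv (ofList m)) :
    QF.hypSet φ = hypC (cls m) := by
  ext a
  constructor
  · rintro ⟨L, hf, hh, y, hy, hya⟩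
    have : NeZero (2 : L.carrier) := neZero_ext (K := K) L.carrier
    refine ⟨L.carrier, _, _, this, hf, ?_, y, hy, hya⟩
    rw [res_cls]
    exact (isHyperbolic_iff (hm.ext L.carrier)
      (equiv_trans (bc_congr L.carrier he) (bc_ofList L.carrier m))).1 hh
  · rintro ⟨L, _, _, _, hf, hh, y, hy, hya⟩
    refine ⟨⟨L⟩, hf, ?_, y, hy, hya⟩
    rw [res_cls] at hh
    exact (isHyperbolic_iff (hm.ext L)
      (equiv_trans (bc_congr L he) (bc_ofList L m))).2 hh

theorem hgrp_eq {φ : QF K} {m : List K} (hm : NZ m) (he : φ.Equiv (ofList m)) :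
    QF.Hgrp φ = HH (cls m) := by
  unfold QF.Hgrp QF.Hyp HH
  rw [hypSet_eq hm he]

theorem mem_G {φ : QF K} {m : List K} (hm : NZ m) (he : φ.Equiv (ofList m)) (a : K) :
    a ∈ QF.G φ ↔ a ≠ 0 ∧ u a * cls m = cls m := by
  refine and_congr_right fun ha => ?_
  have e1 : (QF.smul a φ).Equiv (ofList (m.map (a * ·))) :=
    equiv_trans (smul_congr _ he) (ofList_smul _ _)
  rw [← cls_map]
  constructor
  · intro h
    have : Iso (m.map (a * ·)) m := equiv_trans (equiv_symm e1) (equiv_trans h he)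
    exact this.cls (hm.map ha)
  · intro h
    have : Iso (m.map (a * ·)) m := iso_of_cls (hm.map ha) hm h (by simp)
    exact equiv_trans e1 (equiv_trans this (equiv_symm he))

end Bridge

end WQ

/-- if `I^{n+1}K(√-1) = 0` and `φ` is congruent to a scaled Pfister
form modulo `IⁿK`, then `G(φ) = H(φ)`. -/
theorem stmt8 (K : Type) [Field K] [Invertible (2 : K)] (n : ℕ) (hn : 1 ≤ n)
    (hI : ∀ (L : FieldExt K) [Invertible (2 : L.carrier)],
      (∃ i : L.carrier, i * i = -1 ∧ Algebra.adjoin K {i} = ⊤) →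
      ∀ ψ : QF L.carrier, ψ.Nondeg → QF.InFundPow (n + 1) ψ → ψ.IsHyperbolic)
    (φ : QF K) (hφ : φ.Nondeg)
    (hcong : ∃ (c : K) (_ : c ≠ 0) (l : List K),
      QF.InFundPow n (QF.add φ (QF.smul (-1) (QF.smul c (QF.pfister l))))) :
    QF.G φ = QF.Hgrp φ := by
  haveI : NeZero (2 : K) := ⟨Invertible.ne_zero 2⟩
  obtain ⟨m, hm, he⟩ := WQ.exists_list hφ
  obtain ⟨c, hc, l, hl⟩ := hcong
  have e1 : (QF.add φ (QF.smul (-1) (QF.smul c (QF.pfister l)))).Equiv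
      (WQ.ofList (m ++ ((WQ.pl l).map (c * ·)).map (-1 * ·))) := by
    refine WQ.equiv_trans (WQ.add_congr he ?_) (WQ.equiv_symm (WQ.ofList_append _ _))
    refine WQ.equiv_trans (WQ.smul_congr _ ?_) (WQ.ofList_smul _ _)
    exact WQ.equiv_trans (WQ.smul_congr _ (WQ.pfister_equiv l)) (WQ.ofList_smul _ _)
  have hnd : (QF.add φ (QF.smul (-1) (QF.smul c (QF.pfister l)))).Nondeg := by
    obtain ⟨r, c', l', -, hW⟩ := hl
    exact WQ.Nondeg.of_add_left (WQ.IsHyperbolic.nondeg hW)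
  have hnz := WQ.NZ.of_nondeg (WQ.Nondeg.congr e1 hnd)
  have hlz : WQ.NZ l := WQ.pl_nz_inv (WQ.NZ.append.1 hnz).2.unmap.unmap
  have hx := WQ.inI_of hnz e1 hl
  have hx' : WQ.InI n (WQ.cls m - WQ.u c * WQ.pf l) := by
    rw [WQ.cls_append, WQ.cls_map, WQ.cls_map, WQ.pl_cls, WQ.u_neg_one] at hx
    convert hx using 1
    ring
  rw [WQ.hgrp_eq hm he]
  ext a
  rw [WQ.mem_G hm he]
  constructor
  · rintro ⟨ha, hax⟩
    exact WQ.main_sub hn (WQ.cn_of hI) hm hlz hc hx' ha hax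
  · exact WQ.HH.stab
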